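/- There exists a constant c = c(r) ∈ ℕ depending only on r such that whenever p > c and q ≡ 1 (mod r) the following holds: for any two distinct nonzero prime ideals 𝔩₁ ≠ 𝔩₂ of A and any integers n₁, n₂ ≥ 1, every A/(𝔩₁^{n₁}𝔩₂^{n₂})-module automorphism of φ[𝔩₁^{n₁}𝔩₂^{n₂}] is the restriction of some σ ∈ Gal(F̄/F). (Equivalently, the product representation σ ↦ (ρ_{φ,𝔩₁}(σ), ρ_{φ,𝔩₂}(σ)) maps Gal(F^sep/F) onto GL_r(A_{𝔩₁}) × GL_r(A_{𝔩₂}).) -/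

import Mathlib

open Polynomial

noncomputable section

/-- `F̄`: a fixed algebraic closure of `F = 𝔽_q(T)`. -/
abbrev Kbar (Fq : Type) [Field Fq] := AlgebraicClosure (RatFunc Fq)

/-- `φ` is (encodes) the rank-`r` Drinfeld `𝔽_q[T]`-module over `𝔽_q(T)` given by
`φ_T = T + τ^{r-1} + T^{q-1} τ^r`: it is a ring homomorphism from `A = 𝔽_q[T]` to the
additive endomorphisms of `F̄` which is `𝔽_q`-linear (the condition on `C c`) and sends
`T` to `x ↦ T·x + x^{q^{r-1}} + T^{q-1}·x^{q^r}`. -/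
def IsDrinfeldPhi (Fq : Type) [Field Fq] (q r : ℕ)
    (φ : Polynomial Fq →+* AddMonoid.End (Kbar Fq)) : Prop :=
  (∀ (c : Fq) (x : Kbar Fq),
      φ (C c) x = algebraMap (RatFunc Fq) (Kbar Fq) (RatFunc.C c) * x) ∧
  (∀ x : Kbar Fq, φ X x =
      algebraMap (RatFunc Fq) (Kbar Fq) RatFunc.X * x + x ^ q ^ (r - 1) +
        algebraMap (RatFunc Fq) (Kbar Fq) RatFunc.X ^ (q - 1) * x ^ q ^ r)

/-- The `a`-torsion `φ[a] ⊆ F̄`. -/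
def phiTorsion (Fq : Type) [Field Fq] (φ : Polynomial Fq →+* AddMonoid.End (Kbar Fq))
    (a : Polynomial Fq) : Set (Kbar Fq) := {x | φ a x = 0}

/-- `g` is an `A/(a)`-module automorphism of `φ[a]`: a bijection of `φ[a]` with itself
which is additive and commutes with the `A`-action through `φ`. -/
def IsTorsionAut (Fq : Type) [Field Fq] (φ : Polynomial Fq →+* AddMonoid.End (Kbar Fq))
    (a : Polynomial Fq) (g : Kbar Fq → Kbar Fq) : Prop :=
  Set.BijOn g (phiTorsion Fq φ a) (phiTorsion Fq φ a) ∧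
  (∀ x ∈ phiTorsion Fq φ a, ∀ y ∈ phiTorsion Fq φ a, g (x + y) = g x + g y) ∧
  (∀ b : Polynomial Fq, ∀ x ∈ phiTorsion Fq φ a, g (φ b x) = φ b (g x))

section SpecialLinear

variable {n R : Type*} [DecidableEq n] [Fintype n] [CommRing R]

/-- The columns of `M` outside `u` are those of the identity matrix. -/
def StandardOutside (u : Finset n) (M : Matrix n n R) : Prop :=
  ∀ j, j ∉ u → ∀ i, M i j = (1 : Matrix n n R) i j

lemma StandardOutside.transvection_mul {u : Finset n} {M : Matrix n n R}
    (h : StandardOutside u M) {i k : n} (hk : k ∈ u) (c : R) :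
    StandardOutside u (Matrix.transvection i k c * M) := by
  intro j hj a
  have hkj : k ≠ j := fun e => hj (e ▸ hk)
  by_cases ha : a = i
  · subst ha
    rw [Matrix.transvection_mul_apply_same, h j hj, h j hj, Matrix.one_apply_ne hkj]
    simp
  · rw [Matrix.transvection_mul_apply_of_ne _ _ _ _ ha, h j hj]

lemma mem_of_transvection_mul_mem {S : Submonoid (Matrix n n R)}
    (hS : ∀ i j, i ≠ j → ∀ c, Matrix.transvection i j c ∈ S) {i j : n} (hij : i ≠ j) (c : R)
    {M : Matrix n n R} (h : Matrix.transvection i j c * M ∈ S) : M ∈ S := by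
  have := S.mul_mem (hS i j hij (-c)) h
  rwa [← mul_assoc, Matrix.transvection_mul_transvection_same _ _ hij, neg_add_cancel,
    Matrix.transvection_zero, one_mul] at this

lemma mem_of_clear_column {S : Submonoid (Matrix n n R)}
    (hS : ∀ i j, i ≠ j → ∀ c, Matrix.transvection i j c ∈ S) {u : Finset n} {k : n}
    (hu : ∀ M : Matrix n n R, M.det = 1 → StandardOutside u M → M ∈ S) (w : Finset n) :
    ∀ M : Matrix n n R, M.det = 1 → StandardOutside (insert k u) M → M k k = 1 →
      k ∉ w → (∀ i, i ∉ w → i ≠ k → M i k = 0) → M ∈ S := by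
  induction w using Finset.induction_on with
  | empty =>
    intro M hd hM hk _ h0
    refine hu M hd fun j hj i => ?_
    by_cases hjk : j = k
    · subst hjk
      by_cases hi : i = j
      · subst hi; simpa using hk
      · rw [h0 i (by simp) hi, Matrix.one_apply_ne hi]
    · exact hM j (by simp [hjk, hj]) i
  | insert a w ha ih =>
    intro M hd hM hk hkw h0
    have hak : a ≠ k := fun e => hkw (by simp [e])
    refine mem_of_transvection_mul_mem hS hak (-M a k) (ih _ ?_ ?_ ?_ ?_ ?_)
    · rw [Matrix.det_mul, Matrix.det_transvection_of_ne _ _ hak, hd, one_mul]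
    · exact hM.transvection_mul (by simp) _
    · rw [Matrix.transvection_mul_apply_of_ne _ _ _ _ hak.symm, hk]
    · exact fun h => hkw (by simp [h])
    · intro i hi hik
      by_cases hia : i = a
      · subst hia
        rw [Matrix.transvection_mul_apply_same, hk]; ring
      · rw [Matrix.transvection_mul_apply_of_ne _ _ _ _ hia]
        exact h0 i (by simp [hia, hi]) hik

/-- Over a local ring, elementary matrices generate all matrices of determinant one. -/
theorem mem_of_det_eq_one [IsLocalRing R] {S : Submonoid (Matrix n n R)}
    (hS : ∀ i j, i ≠ j → ∀ c, Matrix.transvection i j c ∈ S) {M : Matrix n n R}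
    (hM : M.det = 1) : M ∈ S := by
  suffices H : ∀ u : Finset n, ∀ M : Matrix n n R, M.det = 1 → StandardOutside u M → M ∈ S from
    H Finset.univ M hM fun j hj => absurd (Finset.mem_univ j) hj
  intro u
  induction u using Finset.induction_on with
  | empty =>
    intro M _ h
    have : M = 1 := by ext i j; exact h j (by simp) i
    rw [this]; exact S.one_mem
  | insert k u hku ih =>
    have key : ∀ M : Matrix n n R, M.det = 1 → StandardOutside (insert k u) M → M k k = 1 →
        M ∈ S := fun M hd hM hk =>
      mem_of_clear_column hS ih (Finset.univ.erase k) M hd hM hk (by simp)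
        fun i hi hik => absurd (by simp [hik]) hi
    have key2 : ∀ M : Matrix n n R, M.det = 1 → StandardOutside (insert k u) M →
        ∀ i ∈ u, IsUnit (M i k) → M ∈ S := by
      intro M hd hM i hi hun
      have hki : k ≠ i := fun e => hku (e ▸ hi)
      obtain ⟨b, hb⟩ := hun.exists_left_inv
      refine mem_of_transvection_mul_mem hS hki ((1 - M k k) * b) (key _ ?_ ?_ ?_)
      · rw [Matrix.det_mul, Matrix.det_transvection_of_ne _ _ hki, hd, one_mul]
      · exact hM.transvection_mul (by simp [hi]) _
      · rw [Matrix.transvection_mul_apply_same, mul_assoc, hb]; ring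
    intro M hd hM
    rcases u.eq_empty_or_nonempty with hu | ⟨j, hj⟩
    · subst hu
      refine key M hd hM ?_
      have : M = (1 : Matrix n n R).updateCol k (fun i => M i k) := by
        ext i j
        by_cases hj : j = k
        · subst hj; simp
        · rw [Matrix.updateCol_ne hj]; exact hM j (by simp [hj]) i
      rw [this, ← Matrix.cramer_apply, Matrix.cramer_one] at hd
      simpa using hd
    · have hN : M.adjugate * M = 1 := by rw [Matrix.adjugate_mul, hd, one_smul]
      have h0 : ∀ i, i ∉ insert k u → M.adjugate k i = 0 := by
        intro i hi
        have h1 := congrFun (congrFun hN k) i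
        rw [Matrix.mul_apply] at h1
        have h2 : ∀ x, M.adjugate k x * M x i = if x = i then M.adjugate k i else 0 := by
          intro x
          rw [hM i hi x, Matrix.one_apply]; split_ifs with h <;> simp [h]
        rw [Finset.sum_congr rfl fun x _ => h2 x] at h1
        have hki : k ≠ i := fun e => hi (by simp [e])
        simpa [Matrix.one_apply_ne hki] using h1
      have hk1 := congrFun (congrFun hN k) k
      rw [Matrix.mul_apply, Matrix.one_apply_eq,
        ← Finset.sum_subset (Finset.subset_univ (insert k u))
          (fun i _ hi => by rw [h0 i hi, zero_mul])] at hk1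
      obtain ⟨i, hi, hun⟩ : ∃ i ∈ insert k u, IsUnit (M.adjugate k i * M i k) := by
        by_contra hcon
        push Not at hcon
        have : (∑ i ∈ insert k u, M.adjugate k i * M i k) ∈ IsLocalRing.maximalIdeal R :=
          Ideal.sum_mem _ fun i hi => (IsLocalRing.mem_maximalIdeal _).2 (hcon i hi)
        rw [hk1] at this
        exact (IsLocalRing.mem_maximalIdeal _).1 this isUnit_one
      have hun' : IsUnit (M i k) := isUnit_of_mul_isUnit_right hun
      rcases Finset.mem_insert.1 hi with rfl | hi'
      · have hji : j ≠ i := fun e => hku (e ▸ hj)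
        obtain ⟨b, hb⟩ := hun'.exists_left_inv
        refine mem_of_transvection_mul_mem hS hji ((1 - M j i) * b) (key2 _ ?_ ?_ j hj ?_)
        · rw [Matrix.det_mul, Matrix.det_transvection_of_ne _ _ hji, hd, one_mul]
        · exact hM.transvection_mul (by simp) _
        · rw [Matrix.transvection_mul_apply_same, mul_assoc, hb]; simp
      · exact key2 M hd hM i hi' hun'

end SpecialLinear

section SkewPolynomials

variable {Fq S : Type*} [Field Fq] [CommRing S] [Algebra Fq S]

/-- The `n`-th iterate of the polynomial `d`. -/
def iterPoly (d : S[X]) : ℕ → S[X]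
  | 0 => X
  | n + 1 => d.comp (iterPoly d n)

/-- The polynomial of the operator `b ∈ 𝔽_q[T]`, when `T` acts through the polynomial `d`. -/
def actionPoly (d : S[X]) (b : Fq[X]) : S[X] :=
  b.sum fun i c => C (algebraMap Fq S c) * iterPoly d i

lemma actionPoly_eq_sum_range (d : S[X]) (b : Fq[X]) :
    actionPoly d b =
      ∑ i ∈ Finset.range (b.natDegree + 1), C (algebraMap Fq S (b.coeff i)) * iterPoly d i :=
  b.sum_over_range (by simp)

lemma iterPoly_map {S' : Type*} [CommRing S'] (f : S →+* S') (d : S[X]) (n : ℕ) :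
    (iterPoly d n).map f = iterPoly (d.map f) n := by
  induction n with
  | zero => simp [iterPoly]
  | succ n ih => rw [iterPoly, iterPoly, Polynomial.map_comp, ih]

lemma actionPoly_map {S' : Type*} [CommRing S'] [Algebra Fq S'] (f : S →+* S')
    (hf : ∀ c : Fq, f (algebraMap Fq S c) = algebraMap Fq S' c) (d : S[X]) (b : Fq[X]) :
    (actionPoly d b).map f = actionPoly (d.map f) b := by
  simp [actionPoly_eq_sum_range, Polynomial.map_sum, iterPoly_map, hf]

lemma natDegree_iterPoly [IsDomain S] (d : S[X]) (n : ℕ) :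
    (iterPoly d n).natDegree = d.natDegree ^ n := by
  induction n with
  | zero => simp [iterPoly]
  | succ n ih => rw [iterPoly, natDegree_comp, ih, pow_succ']

lemma leadingCoeff_iterPoly_succ [IsDomain S] (d : S[X]) (hd : 2 ≤ d.natDegree) (n : ℕ) :
    (iterPoly d (n + 1)).leadingCoeff =
      d.leadingCoeff * (iterPoly d n).leadingCoeff ^ d.natDegree := by
  rw [iterPoly, leadingCoeff_comp]
  rw [natDegree_iterPoly]
  positivity

lemma actionPoly_sub_mem [IsDomain S] (d : S[X]) (hd : 2 ≤ d.natDegree) (b : Fq[X]) :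
    actionPoly d b - C (algebraMap Fq S b.leadingCoeff) * iterPoly d b.natDegree ∈
      degreeLT S (d.natDegree ^ b.natDegree) := by
  rw [actionPoly_eq_sum_range, Finset.sum_range_succ, leadingCoeff, add_sub_cancel_right]
  refine Submodule.sum_mem _ fun i hi => mem_degreeLT.2 ?_
  rw [Finset.mem_range] at hi
  refine degree_le_natDegree.trans_lt ?_
  refine (WithBot.coe_le_coe.2 (natDegree_C_mul_le _ _)).trans_lt ?_
  rw [natDegree_iterPoly]
  exact WithBot.coe_lt_coe.2 (Nat.pow_lt_pow_right hd hi)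

lemma degree_lead_actionPoly [IsDomain S] [FaithfulSMul Fq S] (d : S[X])
    (hd : 2 ≤ d.natDegree) {b : Fq[X]} (hb : b ≠ 0) :
    (C (algebraMap Fq S b.leadingCoeff) * iterPoly d b.natDegree).degree =
      ((d.natDegree ^ b.natDegree : ℕ) : WithBot ℕ) := by
  have h0 : algebraMap Fq S b.leadingCoeff ≠ 0 := by simpa using hb
  rw [degree_C_mul h0, ← natDegree_iterPoly, degree_eq_natDegree]
  intro h
  have := natDegree_iterPoly d b.natDegree
  rw [h, natDegree_zero] at this
  have : 0 < d.natDegree ^ b.natDegree := by positivity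
  omega

lemma natDegree_actionPoly [IsDomain S] [FaithfulSMul Fq S] (d : S[X])
    (hd : 2 ≤ d.natDegree) {b : Fq[X]} (hb : b ≠ 0) :
    (actionPoly d b).natDegree = d.natDegree ^ b.natDegree := by
  have h1 := mem_degreeLT.1 (actionPoly_sub_mem d hd b)
  have h2 := degree_lead_actionPoly (S := S) d hd hb
  have h3 := degree_add_eq_right_of_degree_lt (h1.trans_eq h2.symm)
  rw [sub_add_cancel, h2] at h3
  exact natDegree_eq_of_degree_eq_some h3

lemma leadingCoeff_actionPoly [IsDomain S] [FaithfulSMul Fq S] (d : S[X])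
    (hd : 2 ≤ d.natDegree) {b : Fq[X]} (hb : b.Monic) :
    (actionPoly d b).leadingCoeff = (iterPoly d b.natDegree).leadingCoeff := by
  have h1 := mem_degreeLT.1 (actionPoly_sub_mem d hd b)
  have h2 := degree_lead_actionPoly (S := S) d hd hb.ne_zero
  have h3 := leadingCoeff_add_of_degree_lt (h1.trans_eq h2.symm)
  rw [sub_add_cancel, hb.leadingCoeff] at h3
  simpa using h3

lemma actionPoly_ne_zero [IsDomain S] [FaithfulSMul Fq S] (d : S[X])
    (hd : 2 ≤ d.natDegree) {b : Fq[X]} (hb : b ≠ 0) : actionPoly d b ≠ 0 := by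
  intro h
  have := natDegree_actionPoly (S := S) d hd hb
  rw [h, natDegree_zero] at this
  have : 0 < d.natDegree ^ b.natDegree := by positivity
  omega

lemma derivative_iterPoly {d : S[X]} {t : S} (hd : derivative d = C t) (n : ℕ) :
    derivative (iterPoly d n) = C (t ^ n) := by
  induction n with
  | zero => simp [iterPoly]
  | succ n ih => rw [iterPoly, derivative_comp, ih, hd, C_comp, ← C_mul, pow_succ]

lemma derivative_actionPoly {d : S[X]} {t : S} (hd : derivative d = C t) (b : Fq[X]) :
    derivative (actionPoly d b) = C (aeval t b) := by
  rw [actionPoly_eq_sum_range, derivative_sum, aeval_eq_sum_range, map_sum]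
  refine Finset.sum_congr rfl fun i _ => ?_
  rw [derivative_C_mul, derivative_iterPoly hd, ← C_mul, Algebra.smul_def]

lemma action_mul {S : Type*} [AddCommMonoid S] (φ : Fq[X] →+* AddMonoid.End S) (a b : Fq[X])
    (x : S) : φ (a * b) x = φ a (φ b x) := by
  rw [map_mul]; rfl

lemma action_add {S : Type*} [AddCommMonoid S] (φ : Fq[X] →+* AddMonoid.End S) (a b : Fq[X])
    (x : S) : φ (a + b) x = φ a x + φ b x := by
  rw [map_add]; rfl

lemma action_one {S : Type*} [AddCommMonoid S] (φ : Fq[X] →+* AddMonoid.End S) (x : S) :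
    φ 1 x = x := by
  rw [map_one]; rfl

lemma action_zero {S : Type*} [AddCommMonoid S] (φ : Fq[X] →+* AddMonoid.End S) (x : S) :
    φ 0 x = 0 := by
  rw [map_zero]; rfl

lemma action_sum {S ι : Type*} [AddCommMonoid S] (φ : Fq[X] →+* AddMonoid.End S)
    (s : Finset ι) (f : ι → Fq[X]) (x : S) : φ (∑ i ∈ s, f i) x = ∑ i ∈ s, φ (f i) x := by
  induction s using Finset.cons_induction with
  | empty => simp
  | cons a s ha ih => rw [Finset.sum_cons, Finset.sum_cons, action_add, ih]

lemma eval_iterPoly {S : Type*} [CommRing S] (φ : Fq[X] →+* AddMonoid.End S) {d : S[X]}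
    (hX : ∀ x, φ X x = d.eval x) (x : S) (n : ℕ) :
    (iterPoly d n).eval x = φ (X ^ n) x := by
  induction n with
  | zero => simp [iterPoly]
  | succ n ih => rw [iterPoly, eval_comp, ih, pow_succ', action_mul, hX]

lemma eval_actionPoly (φ : Fq[X] →+* AddMonoid.End S)
    (hC : ∀ (c : Fq) (x : S), φ (C c) x = algebraMap Fq S c * x) {d : S[X]}
    (hX : ∀ x, φ X x = d.eval x) (b : Fq[X]) (x : S) :
    (actionPoly d b).eval x = φ b x := by
  conv_rhs => rw [b.as_sum_range_C_mul_X_pow, action_sum]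
  rw [actionPoly_eq_sum_range, eval_finsetSum]
  refine Finset.sum_congr rfl fun i _ => ?_
  rw [action_mul, hC, eval_mul, eval_C, eval_iterPoly φ hX]

lemma ringHom_apply_action (φ : Fq[X] →+* AddMonoid.End S)
    (hC : ∀ (c : Fq) (x : S), φ (C c) x = algebraMap Fq S c * x) {d : S[X]}
    (hX : ∀ x, φ X x = d.eval x) (σ : S →+* S)
    (hσ : ∀ c, σ (algebraMap Fq S c) = algebraMap Fq S c) (hd : d.map σ = d) (b : Fq[X]) (x : S) :
    σ (φ b x) = φ b (σ x) := by
  rw [← eval_actionPoly φ hC hX, ← eval_actionPoly φ hC hX]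
  conv_rhs => rw [← hd, ← actionPoly_map σ hσ, eval_map_apply]

end SkewPolynomials

section TorsionCount

variable {Fq K : Type*} [Field Fq] [Field K] [Algebra Fq K]

lemma actionPoly_separable {d : K[X]} {t : K} (hd : derivative d = C t) {b : Fq[X]}
    (hb : aeval t b ≠ 0) : (actionPoly d b).Separable := by
  rw [separable_def, derivative_actionPoly hd]
  exact ⟨0, C (aeval t b)⁻¹, by rw [zero_mul, zero_add, ← C_mul, inv_mul_cancel₀ hb, C_1]⟩

lemma ncard_torsion [IsAlgClosed K] (φ : Fq[X] →+* AddMonoid.End K)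
    (hC : ∀ (c : Fq) (x : K), φ (C c) x = algebraMap Fq K c * x) {d : K[X]}
    (hX : ∀ x, φ X x = d.eval x) {t : K} (hd : derivative d = C t) (hd2 : 2 ≤ d.natDegree)
    {b : Fq[X]} (hb : aeval t b ≠ 0) :
    {x | φ b x = 0}.Finite ∧ {x | φ b x = 0}.ncard = d.natDegree ^ b.natDegree := by
  classical
  have hb0 : b ≠ 0 := by rintro rfl; simp at hb
  have hne := actionPoly_ne_zero (S := K) d hd2 hb0
  have hset : {x | φ b x = 0} = ((actionPoly d b).roots.toFinset : Set K) := by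
    ext x
    simp [hne, ← eval_actionPoly φ hC hX]
  rw [hset, Set.ncard_coe_finset, Multiset.toFinset_card_of_nodup
    (nodup_roots (actionPoly_separable hd hb)), ← natDegree_actionPoly d hd2 hb0]
  exact ⟨Finset.finite_toSet _, (splits_iff_card_roots.1 (IsAlgClosed.splits _))⟩

end TorsionCount

section FiniteFieldAux

variable {Fq K : Type*} [Field Fq] [Fintype Fq] [Field K] [Algebra Fq K]

/-- The `n`-th iterate of the `q`-Frobenius of an `𝔽_q`-algebra. -/
def frobPow (Fq : Type*) [Field Fq] [Fintype Fq] {S : Type*} [CommRing S] [Algebra Fq S] (n : ℕ) :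
    S →ₐ[Fq] S := FiniteField.frobeniusAlgHom Fq S ^ n

lemma frobPow_apply {S : Type*} [CommRing S] [Algebra Fq S] (n : ℕ) (x : S) :
    frobPow Fq n x = x ^ Fintype.card Fq ^ n := by
  induction n generalizing x with
  | zero => simp [frobPow]
  | succ n ih =>
    have : frobPow Fq (n + 1) x = frobPow Fq n (FiniteField.frobeniusAlgHom Fq S x) := by
      rw [frobPow, pow_succ]; rfl
    rw [this, ih, FiniteField.coe_frobeniusAlgHom, ← pow_mul, ← pow_succ']

lemma algebraMap_pow_card_pow {S : Type*} [CommRing S] [Algebra Fq S] (n : ℕ) (c : Fq) :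
    algebraMap Fq S c ^ Fintype.card Fq ^ n = algebraMap Fq S c := by
  rw [← frobPow_apply (Fq := Fq), AlgHom.commutes]

lemma sub_pow_card_pow {S : Type*} (Fq : Type*) [Field Fq] [Fintype Fq] [CommRing S] [Algebra Fq S]
    (n : ℕ) (x y : S) :
    (x - y) ^ Fintype.card Fq ^ n = x ^ Fintype.card Fq ^ n - y ^ Fintype.card Fq ^ n := by
  rw [← frobPow_apply (Fq := Fq), map_sub, frobPow_apply, frobPow_apply]

lemma prod_sub_algebraMap (y : K) :
    ∏ c : Fq, (y - algebraMap Fq K c) = y ^ Fintype.card Fq - y := by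
  have hcard : 1 < Fintype.card Fq := Fintype.one_lt_card
  have hroots := FiniteField.roots_X_pow_card_sub_X Fq
  have h := prod_multiset_X_sub_C_of_monic_of_roots_card_eq
    (p := (X ^ Fintype.card Fq - X : Fq[X])) (monic_X_pow_sub (by
      rw [degree_X]; exact_mod_cast hcard))
    (by rw [hroots, FiniteField.X_pow_card_sub_X_natDegree_eq _ hcard]; rfl)
  rw [hroots] at h
  have h' := congrArg (Polynomial.aeval y) h
  simpa [map_prod] using h'

end FiniteFieldAux

section Ultrametric

variable {K : Type*} [Field K] {v : AbsoluteValue K ℝ}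

lemma abv_sub_le (na : ∀ x y, v (x + y) ≤ max (v x) (v y)) (x y : K) :
    v (x - y) ≤ max (v x) (v y) := by
  simpa [sub_eq_add_neg] using na x (-y)

lemma abv_add_eq_left (na : ∀ x y, v (x + y) ≤ max (v x) (v y)) {x y : K} (h : v y < v x) :
    v (x + y) = v x := by
  refine le_antisymm ((na x y).trans (by simp [h.le])) ?_
  by_contra hc
  push Not at hc
  have := abv_sub_le na (x + y) y
  rw [add_sub_cancel_right] at this
  exact absurd (this.trans_lt (max_lt hc h)) (lt_irrefl _)

lemma abv_add_eq_right (na : ∀ x y, v (x + y) ≤ max (v x) (v y)) {x y : K} (h : v x < v y) :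
    v (x + y) = v y := by rw [add_comm]; exact abv_add_eq_left na h

lemma abv_add_lt (na : ∀ x y, v (x + y) ≤ max (v x) (v y)) {x y : K} {c : ℝ} (hx : v x < c)
    (hy : v y < c) : v (x + y) < c := (na x y).trans_lt (max_lt hx hy)

lemma abv_add_le (na : ∀ x y, v (x + y) ≤ max (v x) (v y)) {x y : K} {c : ℝ} (hx : v x ≤ c)
    (hy : v y ≤ c) : v (x + y) ≤ c := (na x y).trans (max_le hx hy)

lemma abv_sub_lt (na : ∀ x y, v (x + y) ≤ max (v x) (v y)) {x y : K} {c : ℝ} (hx : v x < c)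
    (hy : v y < c) : v (x - y) < c := (abv_sub_le na x y).trans_lt (max_lt hx hy)

lemma abv_algebraMap_eq_one {Fq : Type*} [Field Fq] [Fintype Fq] [Algebra Fq K] {c : Fq}
    (hc : c ≠ 0) : v (algebraMap Fq K c) = 1 := by
  have h : v (algebraMap Fq K c) ^ (Fintype.card Fq - 1) = 1 := by
    rw [← map_pow, ← map_pow, FiniteField.pow_card_sub_one_eq_one c hc, map_one, map_one]
  have : 1 < Fintype.card Fq := Fintype.one_lt_card
  exact (pow_eq_one_iff_of_nonneg (v.nonneg _) (by omega)).1 h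

lemma abv_algebraMap_le_one {Fq : Type*} [Field Fq] [Fintype Fq] [Algebra Fq K] (c : Fq) :
    v (algebraMap Fq K c) ≤ 1 := by
  by_cases hc : c = 0
  · simp [hc]
  · exact (abv_algebraMap_eq_one hc).le

lemma abv_algebraMap_mul_le {Fq : Type*} [Field Fq] [Fintype Fq] [Algebra Fq K] (c : Fq) (x : K) :
    v (algebraMap Fq K c * x) ≤ v x := by
  rw [map_mul]
  exact mul_le_of_le_one_left (v.nonneg _) (abv_algebraMap_le_one c)

/-- If the powers of `T` move `x` to elements of increasing size, the size of `b x` is determined by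
the leading term of `b`. -/
lemma abv_action_eq_of_increasing {Fq : Type*} [Field Fq] [Fintype Fq] [Algebra Fq K]
    (na : ∀ x y, v (x + y) ≤ max (v x) (v y)) {φ : Fq[X] →+* AddMonoid.End K}
    (hC : ∀ (c : Fq) (x : K), φ (C c) x = algebraMap Fq K c * x) {x : K} {b : Fq[X]} (hb : b ≠ 0)
    (h : ∀ i < b.natDegree, v (φ (X ^ i) x) < v (φ (X ^ (i + 1)) x)) :
    v (φ b x) = v (φ (X ^ b.natDegree) x) := by
  have hmono : ∀ i j, i ≤ j → j ≤ b.natDegree → v (φ (X ^ i) x) ≤ v (φ (X ^ j) x) := by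
    intro i j hij
    induction hij with
    | refl => exact fun _ => le_rfl
    | step _ ih => exact fun hj => (ih (by omega)).trans (h _ (by omega)).le
  have hterm : ∀ (c : Fq) (i : ℕ), φ (C c * X ^ i) x = algebraMap Fq K c * φ (X ^ i) x := by
    intro c i; rw [action_mul, hC]
  have hsum : φ b x = ∑ i ∈ Finset.range b.natDegree, algebraMap Fq K (b.coeff i) * φ (X ^ i) x +
      algebraMap Fq K b.leadingCoeff * φ (X ^ b.natDegree) x := by
    conv_lhs => rw [b.as_sum_range_C_mul_X_pow, action_sum]
    rw [Finset.sum_range_succ]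
    simp only [hterm, leadingCoeff]
  have hlead : v (algebraMap Fq K b.leadingCoeff * φ (X ^ b.natDegree) x) =
      v (φ (X ^ b.natDegree) x) := by
    rw [map_mul, abv_algebraMap_eq_one (by simpa using hb), one_mul]
  rcases Nat.eq_zero_or_pos b.natDegree with h0 | h0
  · rw [hsum, h0, Finset.sum_range_zero, zero_add, ← h0, hlead]
  · have hpos : 0 < v (φ (X ^ b.natDegree) x) := by
      have := h (b.natDegree - 1) (by omega)
      rw [Nat.sub_add_cancel h0] at this
      exact (v.nonneg _).trans_lt this
    rw [hsum, abv_add_eq_right na, hlead]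
    rw [hlead]
    have : ∀ n ≤ b.natDegree, v (∑ i ∈ Finset.range n, algebraMap Fq K (b.coeff i) * φ (X ^ i) x) <
        v (φ (X ^ b.natDegree) x) := by
      intro n
      induction n with
      | zero => intro _; simpa using hpos
      | succ n ih =>
        intro hn
        rw [Finset.sum_range_succ]
        refine abv_add_lt na (ih (by omega)) ((abv_algebraMap_mul_le _ _).trans_lt ?_)
        exact (h n (by omega)).trans_le (hmono _ _ hn le_rfl)
    exact this _ le_rfl

end Ultrametric

/-- `T` acts through `φ` as `T + τ^s + T^(q-1) τ^(s+1)`, where `q` is the cardinality of `𝔽_q`. -/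
structure IsDrinfeldAction {Fq K : Type*} [Field Fq] [Fintype Fq] [Field K] [Algebra Fq K]
    (q s : ℕ) (T : K) (φ : Fq[X] →+* AddMonoid.End K) : Prop where
  card : Fintype.card Fq = q
  three_le : 3 ≤ q
  pos : 1 ≤ s
  apply_C : ∀ (c : Fq) (x : K), φ (C c) x = algebraMap Fq K c * x
  apply_X : ∀ x : K, φ X x = T * x + x ^ q ^ s + T ^ (q - 1) * x ^ (q ^ s * q)

/-- `v` is a nonarchimedean absolute value at which `T` is a nonzero non-unit. -/
structure IsPlaceAtZero {K : Type*} [Field K] (T : K) (v : AbsoluteValue K ℝ) : Prop where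
  na : ∀ x y, v (x + y) ≤ max (v x) (v y)
  T_pos : 0 < v T
  T_lt_one : v T < 1

section Place

variable {Fq K : Type*} [Field Fq] [Fintype Fq] [Field K] [Algebra Fq K] {q s : ℕ} {T : K}
  {φ : Fq[X] →+* AddMonoid.End K} {v : AbsoluteValue K ℝ}

namespace IsDrinfeldAction

variable (h : IsDrinfeldAction q s T φ)
include h

lemma two_le_pow : 3 ≤ q ^ s :=
  h.three_le.trans (Nat.le_self_pow (by have := h.pos; omega) q)

lemma apply_C_mul (c : Fq) (b : Fq[X]) (x : K) :
    φ (C c * b) x = algebraMap Fq K c * φ b x := by rw [action_mul, h.apply_C]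

lemma apply_smul (b : Fq[X]) (c : Fq) (x : K) :
    φ b (algebraMap Fq K c * x) = algebraMap Fq K c * φ b x := by
  rw [← h.apply_C, ← action_mul, mul_comm, action_mul, h.apply_C]

lemma abv_apply_le (hv : IsPlaceAtZero T v) (b : Fq[X]) {x : K} (hx : v x ≤ 1) :
    v (φ b x) ≤ v x := by
  have hQ := h.two_le_pow
  have hq := h.three_le
  have hX : ∀ y, v y ≤ 1 → v (φ X y) ≤ v y := by
    intro y hy
    rw [h.apply_X]
    refine abv_add_le hv.na (abv_add_le hv.na ?_ ?_) ?_
    · rw [map_mul]; exact mul_le_of_le_one_left (v.nonneg _) hv.T_lt_one.le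
    · rw [map_pow]; exact pow_le_of_le_one (v.nonneg _) hy (by omega)
    · rw [map_mul, map_pow, map_pow]
      exact (mul_le_of_le_one_left (pow_nonneg (v.nonneg _) _)
        (pow_le_one₀ hv.T_pos.le hv.T_lt_one.le)).trans
        (pow_le_of_le_one (v.nonneg _) hy (by positivity))
  induction b using Polynomial.induction_on' with
  | add p p' hp hp' => rw [action_add]; exact abv_add_le hv.na hp hp'
  | monomial n c =>
    rw [← C_mul_X_pow_eq_monomial, h.apply_C_mul]
    refine (abv_algebraMap_mul_le _ _).trans ?_
    induction n with
    | zero => rw [pow_zero, action_one]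
    | succ n ih => rw [pow_succ', action_mul]; exact (hX _ (ih.trans hx)).trans ih

lemma abv_apply_le_one (hv : IsPlaceAtZero T v) (b : Fq[X]) {x : K} (hx : v x ≤ 1) :
    v (φ b x) ≤ 1 := (h.abv_apply_le hv b hx).trans hx

lemma abv_apply_eq_of_lt_one (hv : IsPlaceAtZero T v) {b : Fq[X]} (hb : b.coeff 0 ≠ 0) {x : K}
    (hx : v x < 1) : v (φ b x) = v x := by
  have hQ := h.two_le_pow
  have hq := h.three_le
  rcases eq_or_ne x 0 with rfl | hx0
  · simp
  have hpos : 0 < v x := v.pos hx0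
  have hX : v (φ X x) < v x := by
    rw [h.apply_X]
    refine abv_add_lt hv.na (abv_add_lt hv.na ?_ ?_) ?_
    · rw [map_mul]; exact mul_lt_of_lt_one_left hpos hv.T_lt_one
    · rw [map_pow]
      calc v x ^ q ^ s < v x ^ 1 := pow_lt_pow_right_of_lt_one₀ hpos hx (by omega)
        _ = v x := pow_one _
    · rw [map_mul, map_pow, map_pow]
      refine (mul_le_of_le_one_left (pow_nonneg (v.nonneg _) _)
        (pow_le_one₀ hv.T_pos.le hv.T_lt_one.le)).trans_lt ?_
      calc v x ^ (q ^ s * q) < v x ^ 1 := pow_lt_pow_right_of_lt_one₀ hpos hx (by nlinarith)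
        _ = v x := pow_one _
  have hdec : φ b x = φ b.divX (φ X x) + algebraMap Fq K (b.coeff 0) * x := by
    conv_lhs => rw [← b.divX_mul_X_add, action_add, action_mul, h.apply_C]
  have hlead : v (algebraMap Fq K (b.coeff 0) * x) = v x := by
    rw [map_mul, abv_algebraMap_eq_one hb, one_mul]
  rw [hdec, abv_add_eq_right hv.na, hlead]
  rw [hlead]
  exact (h.abv_apply_le hv _ (hX.le.trans hx.le)).trans_lt hX

/-- Nonzero integral torsion prime to `T` consists of units. -/
lemma abv_eq_one (hv : IsPlaceAtZero T v) {b : Fq[X]} (hb : b.coeff 0 ≠ 0) {x : K}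
    (hx : v x ≤ 1) (hx0 : x ≠ 0) (hbx : φ b x = 0) : v x = 1 := by
  refine le_antisymm hx (not_lt.1 fun hlt => ?_)
  have := h.abv_apply_eq_of_lt_one hv hb hlt
  rw [hbx, map_zero] at this
  exact hx0 (v.eq_zero.1 this.symm)

lemma abv_third (x : K) : v (T ^ (q - 1) * x ^ (q ^ s * q)) =
    v x ^ q ^ s * (v x ^ q ^ s * v T) ^ (q - 1) := by
  have hq := h.three_le
  rw [map_mul, map_pow, map_pow, mul_pow, pow_mul]
  have : (v x ^ q ^ s) ^ q = v x ^ q ^ s * (v x ^ q ^ s) ^ (q - 1) := by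
    rw [← pow_succ', Nat.sub_add_cancel (by omega)]
  rw [this]; ring

lemma abv_T_mul_lt (hv : IsPlaceAtZero T v) {x : K} (hx : 1 < v x) : v (T * x) < v x ^ q ^ s := by
  have hQ := h.two_le_pow
  rw [map_mul]
  calc v T * v x < v x := mul_lt_of_lt_one_left (by linarith) hv.T_lt_one
    _ ≤ v x ^ q ^ s := le_self_pow₀ hx.le (by omega)

lemma abv_apply_X_of_small (hv : IsPlaceAtZero T v) {x : K} (hx : 1 < v x)
    (hs : v x ^ q ^ s * v T < 1) : v (φ X x) = v x ^ q ^ s := by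
  have hq := h.three_le
  have h1 := h.abv_T_mul_lt hv hx
  have h2 : v (T ^ (q - 1) * x ^ (q ^ s * q)) < v x ^ q ^ s := by
    rw [h.abv_third]
    exact mul_lt_of_lt_one_right (by positivity)
      (pow_lt_one₀ (mul_nonneg (by positivity) (v.nonneg _)) hs (by omega))
  rw [← map_pow] at h1 h2 ⊢
  have h3 := abv_add_eq_right hv.na h1
  rw [h.apply_X, abv_add_eq_left hv.na (by rwa [h3]), h3]

lemma abv_apply_X_of_large (hv : IsPlaceAtZero T v) {x : K} (hs : 1 < v x ^ q ^ s * v T) :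
    1 < v x ∧ v x < v (φ X x) ∧ 1 < v (φ X x) ^ q ^ s * v T := by
  have hq := h.three_le
  have hQ := h.two_le_pow
  have hx : 1 < v x := by
    by_contra hc
    push Not at hc
    have : v x ^ q ^ s * v T < 1 :=
      mul_lt_one_of_nonneg_of_lt_one_right (pow_le_one₀ (v.nonneg _) hc) (v.nonneg _) hv.T_lt_one
    linarith
  have h1 := h.abv_T_mul_lt hv hx
  have h2 : v x ^ q ^ s < v (T ^ (q - 1) * x ^ (q ^ s * q)) := by
    rw [h.abv_third]
    exact lt_mul_of_one_lt_right (by positivity) (one_lt_pow₀ hs (by omega))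
  have h3 : v x ≤ v x ^ q ^ s := le_self_pow₀ hx.le (by omega)
  have h4 : v (φ X x) = v (T ^ (q - 1) * x ^ (q ^ s * q)) := by
    rw [h.apply_X, abv_add_eq_right hv.na]
    refine abv_add_lt hv.na (h1.trans h2) (by rwa [map_pow])
  have h5 : v x < v (φ X x) := by rw [h4]; exact h3.trans_lt h2
  refine ⟨hx, h5, hs.trans ?_⟩
  gcongr
  exact hv.T_pos

lemma pow_mul_le_one_of_torsion (hv : IsPlaceAtZero T v) {b : Fq[X]} (hb : b ≠ 0) {x : K}
    (hbx : φ b x = 0) : v x ^ q ^ s * v T ≤ 1 := by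
  by_contra hc
  push Not at hc
  have hall : ∀ i, 1 < v (φ (X ^ i) x) ^ q ^ s * v T := by
    intro i
    induction i with
    | zero => rwa [pow_zero, action_one]
    | succ i ih => rw [pow_succ', action_mul]; exact (h.abv_apply_X_of_large hv ih).2.2
  have := abv_action_eq_of_increasing hv.na h.apply_C hb (x := x) fun i _ => by
    rw [pow_succ', action_mul]; exact (h.abv_apply_X_of_large hv (hall i)).2.1
  rw [hbx, map_zero] at this
  have h1 := (h.abv_apply_X_of_large hv (hall b.natDegree)).1
  linarith

/-- The orbit of `x` under `T` as long as the last exponent keeps it below the critical size. -/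
lemma abv_apply_X_pow (hv : IsPlaceAtZero T v) {x : K} (hx : 1 < v x) (j : ℕ)
    (hs : v x ^ (q ^ s) ^ j * v T < 1) : ∀ i ≤ j, v (φ (X ^ i) x) = v x ^ (q ^ s) ^ i := by
  have hQ := h.two_le_pow
  intro i
  induction i with
  | zero => intro _; rw [pow_zero, action_one, pow_zero, pow_one]
  | succ i ih =>
    intro hi
    have h1 := ih (by omega)
    have h2 : v (φ (X ^ i) x) ^ q ^ s = v x ^ (q ^ s) ^ (i + 1) := by
      rw [h1, ← pow_mul, pow_succ (q ^ s) i]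
    rw [pow_succ', action_mul, h.abv_apply_X_of_small hv, h2]
    · rw [h1]; exact one_lt_pow₀ hx (by positivity)
    · rw [h2]
      refine lt_of_le_of_lt ?_ hs
      gcongr
      · exact hx.le
      · omega

lemma abv_apply_eq (hv : IsPlaceAtZero T v) {x : K} (hx : 1 < v x) (j : ℕ)
    (hs : v x ^ (q ^ s) ^ j * v T < 1) {b : Fq[X]} (hb : b ≠ 0) (hbj : b.natDegree ≤ j) :
    v (φ b x) = v x ^ (q ^ s) ^ b.natDegree := by
  have hQ := h.two_le_pow
  rw [abv_action_eq_of_increasing hv.na h.apply_C hb (x := x), h.abv_apply_X_pow hv hx j hs _ hbj]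
  intro i hi
  rw [h.abv_apply_X_pow hv hx j hs _ (by omega), h.abv_apply_X_pow hv hx j hs _ (by omega)]
  exact pow_lt_pow_right₀ hx (Nat.pow_lt_pow_right (by omega) (by omega))

/-- The residue equation satisfied by critical torsion points. -/
lemma residue_equation (hv : IsPlaceAtZero T v) {b : Fq[X]} (hb : b ≠ 0) {x : K}
    (hbx : φ b x = 0) (hx : v x ^ q ^ s * v T = 1) :
    v ((T * x ^ q ^ s) ^ q + T * x ^ q ^ s) < 1 := by
  have hQ := h.two_le_pow
  have hq := h.three_le
  have key : ∀ y, v y ^ q ^ s * v T ≤ 1 → v (T * y) < 1 := by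
    intro y hy
    rw [map_mul]
    rcases le_or_gt (v y) 1 with hy1 | hy1
    · exact mul_lt_one_of_nonneg_of_lt_one_left hv.T_pos.le hv.T_lt_one hy1
    · refine lt_of_lt_of_le ?_ hy
      rw [mul_comm]
      gcongr
      · exact hv.T_pos
      · calc v y = v y ^ 1 := (pow_one _).symm
          _ < v y ^ q ^ s := pow_lt_pow_right₀ hy1 (by omega)
  have h1 : v (T * φ X x) < 1 := by
    refine key _ (h.pow_mul_le_one_of_torsion hv hb ?_)
    rw [← action_mul, mul_comm, action_mul, hbx, map_zero]
  have h2 : v (T * (T * x)) < 1 := by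
    rw [map_mul]
    exact mul_lt_one_of_nonneg_of_lt_one_left hv.T_pos.le hv.T_lt_one (key x hx.le).le
  have h3 : (T * x ^ q ^ s) ^ q + T * x ^ q ^ s = T * φ X x - T * (T * x) := by
    rw [h.apply_X]
    have : T ^ q = T * T ^ (q - 1) := by rw [← pow_succ', Nat.sub_add_cancel (by omega)]
    rw [mul_pow, ← pow_mul, this]; ring
  rw [h3]
  exact abv_sub_lt hv.na h1 h2

lemma sub_pow_eq (n : ℕ) (x y : K) : (x - y) ^ (q ^ s) ^ n = x ^ (q ^ s) ^ n - y ^ (q ^ s) ^ n := by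
  rw [← pow_mul, ← h.card, sub_pow_card_pow Fq]

lemma algebraMap_pow (n : ℕ) (c : Fq) : algebraMap Fq K c ^ (q ^ s) ^ n = algebraMap Fq K c := by
  rw [← pow_mul, ← h.card, algebraMap_pow_card_pow]

lemma exists_sub_small (hv : IsPlaceAtZero T v) {b : Fq[X]} (hb : b ≠ 0) {x x' : K}
    (hbx : φ b x = 0) (hbx' : φ b x' = 0) (hx : v x ^ q ^ s * v T = 1)
    (hx' : v x' ^ q ^ s * v T = 1) :
    ∃ c : Fq, v (x - algebraMap Fq K c * x') ^ q ^ s * v T < 1 := by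
  have e1 := h.residue_equation hv hb hbx hx
  have e2 := h.residue_equation hv hb hbx' hx'
  have hu : v (T * x ^ q ^ s) = 1 := by rw [map_mul, map_pow, mul_comm, hx]
  have hu' : v (T * x' ^ q ^ s) = 1 := by rw [map_mul, map_pow, mul_comm, hx']
  set u := T * x ^ q ^ s with hudef
  set u' := T * x' ^ q ^ s with hudef'
  have hu0' : u' ≠ 0 := by rw [← v.pos_iff, hu']; exact one_pos
  have e3 : v ((u / u') ^ q - u / u') < 1 := by
    have : (u / u') ^ q - u / u' = ((u ^ q + u) * u' - u * (u' ^ q + u')) / u' ^ (q + 1) := by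
      rw [div_pow, pow_succ]; field_simp; ring
    rw [this, map_div₀, map_pow, hu', one_pow, div_one]
    refine abv_sub_lt hv.na ?_ ?_
    · rwa [map_mul, hu', mul_one]
    · rwa [map_mul, hu, one_mul]
  obtain ⟨c, hc⟩ : ∃ c : Fq, v (u / u' - algebraMap Fq K c) < 1 := by
    by_contra hcon
    push Not at hcon
    rw [← h.card, ← prod_sub_algebraMap, map_prod] at e3
    exact absurd e3 (not_lt.2 (Finset.one_le_prod fun c _ => hcon c))
  refine ⟨c, ?_⟩
  have e4 := h.sub_pow_eq 1 x (algebraMap Fq K c * x')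
  have e5 := h.algebraMap_pow (K := K) 1 c
  rw [pow_one] at e4 e5
  rw [mul_pow, e5] at e4
  rw [← map_pow, ← map_mul, e4]
  have : (x ^ q ^ s - algebraMap Fq K c * x' ^ q ^ s) * T = u' * (u / u' - algebraMap Fq K c) := by
    rw [mul_sub, mul_div_cancel₀ _ hu0', hudef, hudef']; ring
  rwa [this, map_mul, hu', one_mul]

end IsDrinfeldAction

end Place

section IntegralTorsion

variable {Fq K : Type*} [Field Fq] [Fintype Fq] [Field K] [Algebra Fq K] {q s : ℕ} {T : K}
  {φ : Fq[X] →+* AddMonoid.End K} {v : AbsoluteValue K ℝ}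

/-- The polynomial `T Y + Y^(q^s) + T^(q-1) Y^(q^(s+1))`. -/
def drinfeldPoly {S : Type*} [CommRing S] (q s : ℕ) (t : S) : S[X] :=
  C t * X + X ^ q ^ s + C (t ^ (q - 1)) * X ^ (q ^ s * q)

lemma drinfeldPoly_map {S S' : Type*} [CommRing S] [CommRing S'] (f : S →+* S') (t : S) :
    (drinfeldPoly q s t).map f = drinfeldPoly q s (f t) := by
  simp [drinfeldPoly]

/-- The ring of elements of absolute value at most one. -/
def integerSubring (v : AbsoluteValue K ℝ) (na : ∀ x y, v (x + y) ≤ max (v x) (v y)) :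
    Subring K where
  carrier := {x | v x ≤ 1}
  mul_mem' {x y} hx hy := by
    simp only [Set.mem_ofPred_eq, map_mul] at *
    exact mul_le_one₀ hx (v.nonneg _) hy
  one_mem' := by simp
  add_mem' hx hy := abv_add_le na hx hy
  zero_mem' := by simp
  neg_mem' := by simp

/-- The ideal of elements of absolute value less than one. -/
def integerIdeal (v : AbsoluteValue K ℝ) (na : ∀ x y, v (x + y) ≤ max (v x) (v y)) :
    Ideal (integerSubring v na) where
  carrier := {x | v x < 1}
  add_mem' hx hy := abv_add_lt na hx hy
  zero_mem' := by simp
  smul_mem' c x hx := by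
    simp only [Set.mem_ofPred_eq, smul_eq_mul, Subring.coe_mul, map_mul] at *
    exact mul_lt_one_of_nonneg_of_lt_one_right c.2 (v.nonneg _) hx

lemma integerIdeal_isPrime (na : ∀ x y, v (x + y) ≤ max (v x) (v y)) :
    (integerIdeal v na).IsPrime where
  ne_top' := by
    rw [Ideal.ne_top_iff_one]
    intro h
    have h1 : v ((1 : integerSubring v na) : K) < 1 := h
    simp at h1
  mem_or_mem' {x y} hxy := by
    have h1 : v (x : K) ≤ 1 := x.2
    have h2 : v (y : K) ≤ 1 := y.2
    have h3 : v ((x * y : integerSubring v na) : K) < 1 := hxy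
    rw [Subring.coe_mul, map_mul] at h3
    by_contra hcon
    push Not at hcon
    have h4 : ¬ v (x : K) < 1 := hcon.1
    have h5 : ¬ v (y : K) < 1 := hcon.2
    rw [le_antisymm h1 (not_lt.1 h4), le_antisymm h2 (not_lt.1 h5)] at h3
    simp at h3

namespace IsDrinfeldAction

variable (h : IsDrinfeldAction q s T φ)
include h

lemma apply_X_eq_eval (x : K) : φ X x = (drinfeldPoly q s T).eval x := by
  rw [h.apply_X]; simp [drinfeldPoly]

lemma ncard_integral_le (hv : IsPlaceAtZero T v) {a : Fq[X]} (ha : a.Monic)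
    (hfin : {x | φ a x = 0}.Finite) :
    {x | φ a x = 0 ∧ v x ≤ 1}.ncard ≤ (q ^ s) ^ a.natDegree := by
  classical
  have hQ := h.two_le_pow
  have hq := h.three_le
  let O := integerSubring v hv.na
  let m := integerIdeal v hv.na
  have : m.IsPrime := integerIdeal_isPrime hv.na
  let _ : Algebra Fq O :=
    ((algebraMap Fq K).codRestrict O fun c => abv_algebraMap_le_one c).toAlgebra
  have : IsDomain (O ⧸ m) := Ideal.Quotient.isDomain m
  have : FaithfulSMul Fq (O ⧸ m) :=
    (faithfulSMul_iff_algebraMap_injective Fq _).2 (algebraMap Fq (O ⧸ m)).injective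
  let t : O := ⟨T, hv.T_lt_one.le⟩
  let f : O[X] := actionPoly (drinfeldPoly q s t) a
  have hfeval : ∀ w : O, ((f.eval w : O) : K) = φ a w := by
    intro w
    rw [← eval_actionPoly φ h.apply_C h.apply_X_eq_eval]
    have : (actionPoly (drinfeldPoly q s T) a) = f.map O.subtype := by
      rw [actionPoly_map O.subtype (fun c => rfl), drinfeldPoly_map]; rfl
    rw [this]
    exact (eval_map_apply (f := O.subtype) w).symm
  have hfm : f.map (Ideal.Quotient.mk m) = actionPoly (X ^ q ^ s) a := by
    rw [actionPoly_map _ (fun c => rfl), drinfeldPoly_map]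
    have ht : Ideal.Quotient.mk m t = 0 := Ideal.Quotient.eq_zero_iff_mem.2 hv.T_lt_one
    rw [ht, drinfeldPoly, zero_pow (by omega)]
    simp
  have hdeg : (X ^ q ^ s : (O ⧸ m)[X]).natDegree = q ^ s := natDegree_X_pow _
  have hfm0 : f.map (Ideal.Quotient.mk m) ≠ 0 := by
    rw [hfm]; exact actionPoly_ne_zero _ (by omega) ha.ne_zero
  have hf0 : f ≠ 0 := fun h0 => hfm0 (by rw [h0, Polynomial.map_zero])
  have hfinW : {x | φ a x = 0 ∧ v x ≤ 1}.Finite := hfin.subset fun x hx => hx.1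
  let W : Set O := {x | φ a (x : K) = 0}
  have himg : {x | φ a x = 0 ∧ v x ≤ 1} = Subtype.val '' W := by
    ext x; constructor
    · rintro ⟨h1, h2⟩; exact ⟨⟨x, h2⟩, h1, rfl⟩
    · rintro ⟨y, hy, rfl⟩; exact ⟨hy, y.2⟩
  have hWfin : W.Finite := by
    rw [himg] at hfinW
    exact hfinW.of_finite_image Subtype.val_injective.injOn
  rw [himg, Set.ncard_image_of_injective _ Subtype.val_injective,
    Set.ncard_eq_toFinset_card W hWfin]
  have hdvd : (hWfin.toFinset.val.map fun w => X - C w).prod ∣ f := by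
    rw [Multiset.prod_X_sub_C_dvd_iff_le_roots hf0,
      Multiset.le_iff_subset hWfin.toFinset.nodup]
    intro w hw
    have hw' : φ a (w : K) = 0 := hWfin.mem_toFinset.1 hw
    rw [mem_roots hf0, IsRoot.def]
    exact Subtype.ext (by rw [hfeval, hw']; rfl)
  have h1 := natDegree_le_of_dvd (Polynomial.map_dvd (Ideal.Quotient.mk m) hdvd) hfm0
  rw [(monic_multisetProd_X_sub_C _).natDegree_map, natDegree_multiset_prod_X_sub_C_eq_card, hfm,
    natDegree_actionPoly _ (by omega) ha.ne_zero, hdeg] at h1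
  exact h1

lemma natDegree_drinfeldPoly {S : Type*} [CommRing S] [IsDomain S] {t : S} (ht : t ≠ 0) :
    (drinfeldPoly q s t).natDegree = q ^ s * q := by
  have hQ := h.two_le_pow
  have hq := h.three_le
  rw [drinfeldPoly, natDegree_add_eq_right_of_natDegree_lt, natDegree_C_mul_X_pow]
  · exact pow_ne_zero _ ht
  · rw [natDegree_C_mul_X_pow _ _ (pow_ne_zero _ ht)]
    refine (natDegree_add_le _ _).trans_lt (max_lt ?_ ?_)
    · refine (natDegree_C_mul_le _ _).trans_lt ?_
      rw [natDegree_X]; nlinarith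
    · rw [natDegree_X_pow]; nlinarith

lemma derivative_drinfeldPoly {S : Type*} [CommRing S] [Algebra Fq S] (t : S) :
    derivative (drinfeldPoly q s t) = C t := by
  have h0 : (q : S) = 0 := by
    rw [← h.card, ← map_natCast (algebraMap Fq S), Nat.cast_card_eq_zero, map_zero]
  have hs := h.pos
  have h0' : (0 : S[X]) ^ s = 0 := zero_pow (by omega)
  simp [drinfeldPoly, h0, h0', derivative_pow]

lemma ncard_torsion [IsAlgClosed K] (hT : Transcendental Fq T) {b : Fq[X]} (hb : b ≠ 0) :
    {x | φ b x = 0}.Finite ∧ {x | φ b x = 0}.ncard = (q ^ s * q) ^ b.natDegree := by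
  have hQ := h.two_le_pow
  have hq := h.three_le
  have hT0 : T ≠ 0 := by rintro rfl; exact hT (isAlgebraic_zero)
  have := _root_.ncard_torsion φ h.apply_C h.apply_X_eq_eval (h.derivative_drinfeldPoly T)
    (by rw [h.natDegree_drinfeldPoly hT0]; nlinarith)
    (b := b) (fun h0 => hb ((transcendental_iff.1 hT) b h0))
  rwa [h.natDegree_drinfeldPoly hT0] at this

lemma small_of_torsion_succ (hv : IsPlaceAtZero T v) {b : Fq[X]} (hb : b ≠ 0) {x : K}
    (hbx : φ b x = 0) (hx : 1 < v x) {j : ℕ} (hs : v x ^ (q ^ s) ^ j * v T < 1) :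
    v x ^ (q ^ s) ^ (j + 1) * v T ≤ 1 := by
  have h1 := h.abv_apply_X_pow hv hx j hs j le_rfl
  have h2 : φ b (φ (X ^ j) x) = 0 := by rw [← action_mul, mul_comm, action_mul, hbx, map_zero]
  have h3 := h.pow_mul_le_one_of_torsion hv hb h2
  rwa [h1, ← pow_mul, ← pow_succ] at h3

lemma pow_lt_of_pow_succ_le (hv : IsPlaceAtZero T v) {x : K} (hx : 1 < v x) {i j : ℕ} (hij : i < j)
    (hs : v x ^ (q ^ s) ^ j * v T ≤ 1) : v x ^ (q ^ s) ^ i * v T < 1 := by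
  have hQ := h.two_le_pow
  refine lt_of_lt_of_le ?_ hs
  exact mul_lt_mul_of_pos_right (pow_lt_pow_right₀ hx (Nat.pow_lt_pow_right (by omega) hij))
    hv.T_pos

lemma abv_le_one_of_small (hv : IsPlaceAtZero T v) {a : Fq[X]} (ha : a ≠ 0) {x : K}
    (hax : φ a x = 0) (hs : v x ^ (q ^ s) ^ a.natDegree * v T < 1) : v x ≤ 1 := by
  by_contra hx
  push Not at hx
  have h1 := h.abv_apply_eq hv hx a.natDegree hs ha le_rfl
  rw [hax, map_zero] at h1
  have : 0 < v x ^ (q ^ s) ^ a.natDegree := by positivity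
  linarith

lemma exists_sub_small_pow (hv : IsPlaceAtZero T v) {b : Fq[X]} (hb : b ≠ 0) {x x' : K}
    (hbx : φ b x = 0) (hbx' : φ b x' = 0) {j : ℕ} (hx1 : 1 < v x) (hx1' : 1 < v x')
    (hx : v x ^ (q ^ s) ^ (j + 1) * v T = 1) (hx' : v x' ^ (q ^ s) ^ (j + 1) * v T = 1) :
    ∃ c : Fq, v (x - algebraMap Fq K c * x') ≤ 1 ∨
      v (x - algebraMap Fq K c * x') ^ (q ^ s) ^ (j + 1) * v T < 1 := by
  have tors : ∀ y, φ b y = 0 → φ b (φ (X ^ j) y) = 0 := fun y hy => by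
    rw [← action_mul, mul_comm, action_mul, hy, map_zero]
  have size : ∀ y, 1 < v y → v y ^ (q ^ s) ^ (j + 1) * v T = 1 →
      v (φ (X ^ j) y) ^ q ^ s * v T = 1 := fun y hy1 hy => by
    rw [h.abv_apply_X_pow hv hy1 j (h.pow_lt_of_pow_succ_le hv hy1 j.lt_succ_self hy.le) j le_rfl,
      ← pow_mul, ← pow_succ, hy]
  obtain ⟨c, hc⟩ := h.exists_sub_small hv hb (tors x hbx) (tors x' hbx') (size x hx1 hx)
    (size x' hx1' hx')
  refine ⟨c, ?_⟩
  by_contra hcon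
  push Not at hcon
  rw [← h.apply_smul, ← map_sub] at hc
  set w := x - algebraMap Fq K c * x' with hw
  have hle : v w ^ (q ^ s) ^ (j + 1) * v T ≤ 1 := by
    have h1 : v w ≤ max (v x) (v x') :=
      (abv_sub_le hv.na _ _).trans (max_le_max le_rfl (abv_algebraMap_mul_le _ _))
    rcases le_max_iff.1 h1 with h2 | h2
    · rw [← hx]; gcongr
    · rw [← hx']; gcongr
  rw [size w hcon.1 (le_antisymm hle hcon.2)] at hc
  exact lt_irrefl _ hc

/-- There is a torsion point of the largest size that allows the orbit of length `deg a`. -/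
lemma exists_extremal [IsAlgClosed K] (hT : Transcendental Fq T) (hv : IsPlaceAtZero T v)
    {a : Fq[X]} (ha : a.Monic) (ha0 : a ≠ 1) :
    ∃ x, φ a x = 0 ∧ v x ^ (q ^ s) ^ a.natDegree * v T = 1 := by
  have hQ := h.two_le_pow
  have hq := h.three_le
  obtain ⟨hfin, hcard⟩ := h.ncard_torsion hT ha.ne_zero
  set D := a.natDegree with hD
  have hDpos : 0 < D := ha.natDegree_pos.2 ha0
  let B : ℕ → Set K := fun j => {x | φ a x = 0 ∧ (v x ≤ 1 ∨ v x ^ (q ^ s) ^ j * v T ≤ 1)}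
  have hBfin : ∀ j, (B j).Finite := fun j => hfin.subset fun x hx => hx.1
  have hstep : ∀ j, (B (j + 1)).ncard ≤ q * (B (j + 2)).ncard := by
    intro j
    by_cases hsub : B (j + 1) ⊆ B (j + 2)
    · calc (B (j + 1)).ncard ≤ (B (j + 2)).ncard := Set.ncard_le_ncard hsub (hBfin _)
        _ ≤ q * (B (j + 2)).ncard := Nat.le_mul_of_pos_left _ (by omega)
    · obtain ⟨x', hx', hxn'⟩ := Set.not_subset.1 hsub
      have key : ∀ x ∈ B (j + 1), x ∉ B (j + 2) →
          1 < v x ∧ v x ^ (q ^ s) ^ (j + 1) * v T = 1 := by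
        intro x hx hxn
        have h1 : 1 < v x := not_le.1 fun hc => hxn ⟨hx.1, Or.inl hc⟩
        refine ⟨h1, le_antisymm (hx.2.resolve_left (not_le.2 h1)) (not_lt.1 fun hc => hxn ?_)⟩
        exact ⟨hx.1, Or.inr (h.small_of_torsion_succ hv ha.ne_zero hx.1 h1 hc)⟩
      obtain ⟨h1', h2'⟩ := key x' hx' hxn'
      have hcover : B (j + 1) ⊆
          (fun p : Fq × K => algebraMap Fq K p.1 * x' + p.2) '' (Set.univ ×ˢ B (j + 2)) := by
        intro x hx
        by_cases hxn : x ∈ B (j + 2)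
        · exact ⟨(0, x), ⟨trivial, hxn⟩, by simp⟩
        obtain ⟨h1, h2⟩ := key x hx hxn
        obtain ⟨c, hc⟩ := h.exists_sub_small_pow hv ha.ne_zero hx.1 hx'.1 h1 h1' h2 h2'
        refine ⟨(c, x - algebraMap Fq K c * x'), ⟨trivial, ?_, ?_⟩, by simp⟩
        · change φ a (x - algebraMap Fq K c * x') = 0
          rw [map_sub, h.apply_smul, hx.1, hx'.1, mul_zero, sub_zero]
        · rcases le_or_gt (v (x - algebraMap Fq K c * x')) 1 with h3 | h3
          · exact Or.inl h3
          · refine Or.inr (h.small_of_torsion_succ hv ha.ne_zero ?_ h3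
              (hc.resolve_left (not_le.2 h3)))
            rw [map_sub, h.apply_smul, hx.1, hx'.1, mul_zero, sub_zero]
      calc (B (j + 1)).ncard ≤ _ := Set.ncard_le_ncard hcover
            ((Set.finite_univ.prod (hBfin _)).image _)
        _ ≤ _ := Set.ncard_image_le (Set.finite_univ.prod (hBfin _))
        _ = q * (B (j + 2)).ncard := by
          rw [Set.ncard_prod, Set.ncard_univ, Nat.card_eq_fintype_card, h.card]
  have hchain : ∀ j, (B 1).ncard ≤ q ^ j * (B (j + 1)).ncard := by
    intro j
    induction j with
    | zero => simp
    | succ j ih =>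
      calc (B 1).ncard ≤ q ^ j * (B (j + 1)).ncard := ih
        _ ≤ q ^ j * (q * (B (j + 2)).ncard) := Nat.mul_le_mul_left _ (hstep j)
        _ = _ := by ring
  have hB1 : B 1 = {x | φ a x = 0} := by
    ext x
    refine ⟨fun hx => hx.1, fun hx => ⟨hx, Or.inr ?_⟩⟩
    rw [pow_one]; exact h.pow_mul_le_one_of_torsion hv ha.ne_zero hx
  have hex : ∃ x ∈ B D, 1 < v x := by
    by_contra hcon
    push Not at hcon
    have h1 : (B D).ncard ≤ (q ^ s) ^ D :=
      (Set.ncard_le_ncard (t := {x | φ a x = 0 ∧ v x ≤ 1}) (fun x hx => ⟨hx.1, hcon x hx⟩)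
        (hfin.subset fun x hx => hx.1)).trans
        (h.ncard_integral_le hv ha hfin)
    have h2 := hchain (D - 1)
    rw [Nat.sub_add_cancel hDpos, hB1, hcard, mul_pow] at h2
    have h3 : q ^ (D - 1) * (B D).ncard ≤ q ^ (D - 1) * (q ^ s) ^ D := Nat.mul_le_mul_left _ h1
    have h4 : q ^ (D - 1) < q ^ D := Nat.pow_lt_pow_right (by omega) (by omega)
    have h5 : 0 < (q ^ s) ^ D := by positivity
    nlinarith
  obtain ⟨x, hx, hx1⟩ := hex
  refine ⟨x, hx.1, le_antisymm (hx.2.resolve_left (not_le.2 hx1)) (not_lt.1 fun hc => ?_)⟩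
  exact absurd (h.abv_le_one_of_small hv ha.ne_zero hx.1 hc) (not_le.2 hx1)

end IsDrinfeldAction

end IntegralTorsion

/-- A group of automorphisms acting through the inertia group of the place `v`, with the property
that valuations of orbit products of torsion points are powers of the valuation of `T`. -/
structure IsInertia (Fq : Type*) {K : Type*} (Γ : Type*) [Field Fq] [Field K] [Algebra Fq K]
    [Group Γ] [MulSemiringAction Γ K] (T : K) (φ : Fq[X] →+* AddMonoid.End K)
    (v : AbsoluteValue K ℝ) : Prop where
  smul_apply : ∀ (σ : Γ) (b : Fq[X]) (x : K), σ • φ b x = φ b (σ • x)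
  smul_T : ∀ σ : Γ, σ • T = T
  smul_algebraMap : ∀ (σ : Γ) (c : Fq), σ • algebraMap Fq K c = algebraMap Fq K c
  abv_smul : ∀ (σ : Γ) (x : K), v (σ • x) = v x
  abv_smul_sub : ∀ (σ : Γ) (x : K), v x ≤ 1 → v (σ • x - x) < 1
  orbit : ∀ b : Fq[X], b ≠ 0 → ∀ x : K, x ≠ 0 → φ b x = 0 →
    ∃ k : ℤ, v x ^ Nat.card (MulAction.orbit Γ x) = v T ^ k

section Inertia

variable {Fq K Γ : Type*} [Field Fq] [Fintype Fq] [Field K] [Algebra Fq K] [Group Γ]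
  [MulSemiringAction Γ K] {q s : ℕ} {T : K} {φ : Fq[X] →+* AddMonoid.End K} {v : AbsoluteValue K ℝ}

lemma ncard_degreeLT (n : ℕ) : {f : Fq[X] | f ∈ degreeLT Fq n}.ncard = Fintype.card Fq ^ n := by
  have h1 : {f : Fq[X] | f ∈ degreeLT Fq n}.ncard = Nat.card (degreeLT Fq n) := rfl
  rw [h1, Nat.card_congr (degreeLTEquiv Fq n).toEquiv, Nat.card_fun, Nat.card_eq_fintype_card,
    Nat.card_eq_fintype_card, Fintype.card_fin]

lemma IsPlaceAtZero.one_lt_of_extremal {K : Type*} [Field K] {T : K} {v : AbsoluteValue K ℝ}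
    (hv : IsPlaceAtZero T v) {n : ℕ} {x : K} (hx : v x ^ n * v T = 1) : 1 < v x := by
  by_contra hc
  push Not at hc
  have : v x ^ n * v T < 1 :=
    mul_lt_one_of_nonneg_of_lt_one_right (pow_le_one₀ (v.nonneg _) hc) (v.nonneg _) hv.T_lt_one
  linarith

namespace IsDrinfeldAction

variable (h : IsDrinfeldAction q s T φ)
include h

lemma extremal_dvd (hv : IsPlaceAtZero T v) {a : Fq[X]} (ha : a.Monic) {x : K}
    (hax : φ a x = 0) (hx : v x ^ (q ^ s) ^ a.natDegree * v T = 1) {f : Fq[X]}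
    (hf : v (φ f x) ≤ 1) : a ∣ f := by
  have hQ := h.two_le_pow
  rw [← modByMonic_eq_zero_iff_dvd ha]
  by_contra hne
  have h1 : 1 < v x := hv.one_lt_of_extremal hx
  have h2 : φ (f %ₘ a) x = φ f x := by
    conv_rhs => rw [← modByMonic_add_div f a, mul_comm, action_add, action_mul, hax, map_zero,
      add_zero]
  have ha1 : a ≠ 1 := by rintro rfl; simp at hne
  have hdeg : (f %ₘ a).natDegree < a.natDegree := natDegree_modByMonic_lt f ha ha1
  have h3 := h.abv_apply_eq hv h1 _ (h.pow_lt_of_pow_succ_le hv h1 hdeg hx.le) hne le_rfl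
  rw [← h2, h3] at hf
  exact absurd hf (not_le.2 (one_lt_pow₀ h1 (by positivity)))

lemma smul_sub_extremal (hΓ : IsInertia Fq Γ T φ v) (hv : IsPlaceAtZero T v) {a : Fq[X]}
    (ha : a ≠ 0) {x : K} (hax : φ a x = 0) (hx : v x ^ (q ^ s) ^ a.natDegree * v T = 1) (σ : Γ) :
    φ a (σ • x - x) = 0 ∧ v (σ • x - x) ≤ 1 := by
  have h1 : φ a (σ • x - x) = 0 := by rw [map_sub, ← hΓ.smul_apply, hax, smul_zero, sub_zero]
  refine ⟨h1, h.abv_le_one_of_small hv ha h1 ?_⟩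
  have h2 := hΓ.abv_smul_sub σ (x ^ (q ^ s) ^ a.natDegree * T) (by rw [map_mul, map_pow, hx])
  rwa [smul_mul', hΓ.smul_T, smul_pow', ← sub_mul, ← h.sub_pow_eq, map_mul, map_pow] at h2

lemma extremal_orbit [IsAlgClosed K] (hT : Transcendental Fq T) (hΓ : IsInertia Fq Γ T φ v)
    (hv : IsPlaceAtZero T v) {a : Fq[X]} (ha : a.Monic) {x : K} (hax : φ a x = 0)
    (hx : v x ^ (q ^ s) ^ a.natDegree * v T = 1) :
    {y | φ a y = 0 ∧ v y ≤ 1}.ncard = (q ^ s) ^ a.natDegree ∧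
      ∀ w, φ a w = 0 → v w ≤ 1 → ∃ σ : Γ, σ • x = x + w := by
  have hQ := h.two_le_pow
  obtain ⟨hfin, -⟩ := h.ncard_torsion hT ha.ne_zero
  have hWfin : {y | φ a y = 0 ∧ v y ≤ 1}.Finite := hfin.subset fun x hx => hx.1
  have hx1 : 1 < v x := hv.one_lt_of_extremal hx
  have hx0 : x ≠ 0 := by rintro rfl; simp at hx1; linarith
  have hsub : MulAction.orbit Γ x ⊆ (fun w => x + w) '' {y | φ a y = 0 ∧ v y ≤ 1} := by
    rintro _ ⟨σ, rfl⟩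
    exact ⟨σ • x - x, h.smul_sub_extremal hΓ hv ha.ne_zero hax hx σ, by simp⟩
  have hofin : (MulAction.orbit Γ x).Finite := (hWfin.image _).subset hsub
  have hinj : Function.Injective fun w => x + w := add_right_injective x
  obtain ⟨k, hk⟩ := hΓ.orbit a ha.ne_zero x hx0 hax
  set n := Nat.card (MulAction.orbit Γ x) with hn
  have hn' : (MulAction.orbit Γ x).ncard = n := rfl
  have hnpos : 0 < n := by
    rw [← hn']; exact (Set.ncard_pos hofin).2 ⟨x, MulAction.mem_orbit_self x⟩
  set M := (q ^ s) ^ a.natDegree with hM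
  have hle : M ≤ n := by
    have e1 : v x ^ M = (v T)⁻¹ := eq_inv_of_mul_eq_one_left hx
    have e2 : v T ^ (k * (M : ℤ)) = v T ^ (-(n : ℤ)) := by
      rw [zpow_mul, ← hk, zpow_natCast, ← pow_mul, mul_comm, pow_mul, e1, zpow_neg, zpow_natCast,
        inv_pow]
    have e3 := zpow_right_injective₀ hv.T_pos hv.T_lt_one.ne e2
    have e4 : (M : ℤ) ∣ n := ⟨-k, by linarith⟩
    exact Nat.le_of_dvd hnpos (Int.natCast_dvd_natCast.1 e4)
  have hWle : {y | φ a y = 0 ∧ v y ≤ 1}.ncard ≤ M := h.ncard_integral_le hv ha hfin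
  have hole : n ≤ {y | φ a y = 0 ∧ v y ≤ 1}.ncard := by
    rw [← hn', ← Set.ncard_image_of_injective {y | φ a y = 0 ∧ v y ≤ 1} hinj]
    exact Set.ncard_le_ncard hsub (hWfin.image _)
  refine ⟨by omega, fun w hw1 hw2 => ?_⟩
  have heq : MulAction.orbit Γ x = (fun w => x + w) '' {y | φ a y = 0 ∧ v y ≤ 1} := by
    refine Set.eq_of_subset_of_ncard_le hsub ?_ (hWfin.image _)
    rw [Set.ncard_image_of_injective _ hinj, hn']; omega
  have hmem : x + w ∈ MulAction.orbit Γ x := by rw [heq]; exact ⟨w, ⟨hw1, hw2⟩, rfl⟩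
  exact hmem

lemma extremal_span [IsAlgClosed K] (hT : Transcendental Fq T) (hΓ : IsInertia Fq Γ T φ v)
    (hv : IsPlaceAtZero T v) {a : Fq[X]} (ha : a.Monic) {x : K} (hax : φ a x = 0)
    (hx : v x ^ (q ^ s) ^ a.natDegree * v T = 1) {y : K} (hay : φ a y = 0) :
    ∃ f w, φ a w = 0 ∧ v w ≤ 1 ∧ y = φ f x + w := by
  obtain ⟨hfin, hcard⟩ := h.ncard_torsion hT ha.ne_zero
  have hWfin : {y | φ a y = 0 ∧ v y ≤ 1}.Finite := hfin.subset fun x hx => hx.1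
  have hWcard := (h.extremal_orbit hT hΓ hv ha hax hx).1
  set W := {y | φ a y = 0 ∧ v y ≤ 1} with hW
  let P : Set (Fq[X] × K) := {f | f ∈ degreeLT Fq a.natDegree} ×ˢ W
  let F : Fq[X] × K → K := fun p => φ p.1 x + p.2
  have hinj : Set.InjOn F P := by
    rintro ⟨f, w⟩ ⟨hf, hw⟩ ⟨f', w'⟩ ⟨hf', hw'⟩ heq
    have h1 : φ f x + w = φ f' x + w' := heq
    have h2 : φ (f - f') x = w' - w := by
      have : φ (f - f') x = φ f x - φ f' x := by rw [map_sub]; rfl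
      rw [this]; linear_combination h1
    have h3 := h.extremal_dvd hv ha hax hx (f := f - f')
      (by rw [h2]; exact (abv_sub_le hv.na _ _).trans (max_le hw'.2 hw.2))
    have h4 : f - f' = 0 := by
      refine eq_zero_of_dvd_of_degree_lt h3 ?_
      rw [degree_eq_natDegree ha.ne_zero]
      exact mem_degreeLT.1 (Submodule.sub_mem _ hf hf')
    have h5 : f = f' := sub_eq_zero.1 h4
    subst h5
    rw [add_right_inj] at h1
    rw [h1]
  have hsub : F '' P ⊆ {y | φ a y = 0} := by
    rintro _ ⟨⟨f, w⟩, ⟨-, hw⟩, rfl⟩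
    change φ a (φ f x + w) = 0
    rw [map_add, ← action_mul, mul_comm, action_mul, hax, map_zero, hw.1, add_zero]
  have heq : F '' P = {y | φ a y = 0} := by
    refine Set.eq_of_subset_of_ncard_le hsub ?_ hfin
    rw [hinj.ncard_image, Set.ncard_prod, ncard_degreeLT, h.card, hWcard, hcard,
      ← mul_pow, mul_comm]
  have hmem : y ∈ F '' P := by rw [heq]; exact hay
  obtain ⟨⟨f, w⟩, ⟨-, hw⟩, rfl⟩ := hmem
  exact ⟨f, w, hw.1, hw.2, rfl⟩

lemma smul_eq_of_integral (hΓ : IsInertia Fq Γ T φ v) (hv : IsPlaceAtZero T v) {b : Fq[X]}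
    (hb : b.coeff 0 ≠ 0) {y : K} (hby : φ b y = 0) (hy : v y ≤ 1) (σ : Γ) : σ • y = y := by
  by_contra hne
  have h1 : φ b (σ • y - y) = 0 := by rw [map_sub, ← hΓ.smul_apply, hby, smul_zero, sub_zero]
  have h2 := hΓ.abv_smul_sub σ y hy
  have h3 := h.abv_eq_one hv hb h2.le (sub_ne_zero.2 hne) h1
  linarith

lemma abv_pow_of_X_torsion (hv : IsPlaceAtZero T v) {y : K} (hXy : φ X y = 0) (hy : v y ≤ 1)
    (hy0 : y ≠ 0) : v y ^ (q ^ s - 1) = v T := by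
  have hQ := h.two_le_pow
  have hq := h.three_le
  have h1 : y ^ (q ^ s - 1) = -(T + T ^ (q - 1) * y ^ (q ^ s * q - 1)) := by
    have e1 : y * y ^ (q ^ s - 1) = y ^ q ^ s := by
      rw [← pow_succ', Nat.sub_add_cancel (by omega)]
    have e2 : y * y ^ (q ^ s * q - 1) = y ^ (q ^ s * q) := by
      rw [← pow_succ', Nat.sub_add_cancel (by nlinarith)]
    rw [h.apply_X] at hXy
    refine mul_left_cancel₀ hy0 ?_
    rw [e1]
    linear_combination hXy + T ^ (q - 1) * e2
  have h2 : v (T ^ (q - 1) * y ^ (q ^ s * q - 1)) < v T := by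
    rw [map_mul, map_pow, map_pow]
    refine (mul_le_of_le_one_right (pow_nonneg (v.nonneg _) _)
      (pow_le_one₀ (v.nonneg _) hy)).trans_lt ?_
    calc v T ^ (q - 1) < v T ^ 1 :=
          pow_lt_pow_right_of_lt_one₀ hv.T_pos hv.T_lt_one (by omega)
      _ = v T := pow_one _
  rw [← map_pow, h1, AbsoluteValue.map_neg, abv_add_eq_left hv.na h2]

lemma exists_scalar_on_X_torsion [IsAlgClosed K] (hT : Transcendental Fq T)
    (hΓ : IsInertia Fq Γ T φ v) (hv : IsPlaceAtZero T v) (c : Fq) (hc : c ≠ 0) :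
    ∃ γ : Γ, ∀ y, φ X y = 0 → v y ≤ 1 → γ • y = algebraMap Fq K c * y := by
  have hQ := h.two_le_pow
  by_cases hex : ∃ y, φ X y = 0 ∧ v y ≤ 1 ∧ y ≠ 0
  swap
  · push Not at hex
    exact ⟨1, fun y h1 h2 => by rw [hex y h1 h2, smul_zero, mul_zero]⟩
  obtain ⟨y, hXy, hy, hy0⟩ := hex
  have hsize := h.abv_pow_of_X_torsion hv hXy hy hy0
  obtain ⟨hfin, -⟩ := h.ncard_torsion hT (X_ne_zero (R := Fq))
  have hWfin : {y | φ X y = 0 ∧ v y ≤ 1}.Finite := hfin.subset fun x hx => hx.1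
  have hWle := h.ncard_integral_le hv monic_X hfin
  rw [natDegree_X, pow_one] at hWle
  set W := {y | φ X y = 0 ∧ v y ≤ 1} with hW
  have hsub : MulAction.orbit Γ y ⊆ W \ {0} := by
    rintro _ ⟨σ, rfl⟩
    refine ⟨⟨?_, ?_⟩, ?_⟩
    · change φ X (σ • y) = 0
      rw [← hΓ.smul_apply, hXy, smul_zero]
    · change v (σ • y) ≤ 1
      rwa [hΓ.abv_smul]
    · exact (smul_ne_zero_iff_ne σ).2 hy0
  have hDfin : (W \ {0}).Finite := hWfin.subset Set.sdiff_subset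
  have hDcard : (W \ {0}).ncard = W.ncard - 1 :=
    Set.ncard_sdiff_singleton_of_mem (by simp [hW])
  have hofin : (MulAction.orbit Γ y).Finite := hDfin.subset hsub
  obtain ⟨k, hk⟩ := hΓ.orbit X X_ne_zero y hy0 hXy
  set n := Nat.card (MulAction.orbit Γ y) with hn
  have hn' : (MulAction.orbit Γ y).ncard = n := rfl
  have hnpos : 0 < n := by
    rw [← hn']; exact (Set.ncard_pos hofin).2 ⟨y, MulAction.mem_orbit_self y⟩
  have hle : q ^ s - 1 ≤ n := by
    have e2 : v T ^ (k * ((q ^ s - 1 : ℕ) : ℤ)) = v T ^ (n : ℤ) := by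
      rw [zpow_mul, ← hk, zpow_natCast, ← pow_mul, mul_comm, pow_mul, hsize, zpow_natCast]
    have e3 := zpow_right_injective₀ hv.T_pos hv.T_lt_one.ne e2
    have e4 : ((q ^ s - 1 : ℕ) : ℤ) ∣ n := ⟨k, by linarith⟩
    exact Nat.le_of_dvd hnpos (Int.natCast_dvd_natCast.1 e4)
  have heq : MulAction.orbit Γ y = W \ {0} := by
    refine Set.eq_of_subset_of_ncard_le hsub ?_ hDfin
    rw [hn', hDcard]; omega
  have hcK : algebraMap Fq K c ≠ 0 := by simpa using hc
  have hcy : algebraMap Fq K c * y ∈ MulAction.orbit Γ y := by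
    rw [heq]
    refine ⟨⟨?_, (abv_algebraMap_mul_le _ _).trans hy⟩, by simp [hc, hy0]⟩
    rw [h.apply_smul, hXy, mul_zero]
  obtain ⟨γ, hγ⟩ := hcy
  have hγ : γ • y = algebraMap Fq K c * y := hγ
  refine ⟨γ, fun z hXz hz => ?_⟩
  rcases eq_or_ne z 0 with rfl | hz0
  · rw [smul_zero, mul_zero]
  have hypos : 0 < v y := v.pos hy0
  have hzy : v z = v y := by
    have := h.abv_pow_of_X_torsion hv hXz hz hz0
    exact (pow_left_inj₀ (v.nonneg _) (v.nonneg _) (by omega)).1 (this.trans hsize.symm)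
  have h1 := hΓ.abv_smul_sub γ (z / y) (by rw [map_div₀, hzy, div_self hypos.ne'])
  rw [div_eq_mul_inv, smul_mul', smul_inv'', hγ] at h1
  by_contra hne
  have h2 : φ X (γ • z - algebraMap Fq K c * z) = 0 := by
    rw [map_sub, ← hΓ.smul_apply, hXz, smul_zero, h.apply_smul, hXz, mul_zero, sub_zero]
  have h3 : v (γ • z - algebraMap Fq K c * z) ≤ 1 :=
    (abv_sub_le hv.na _ _).trans (max_le (by rwa [hΓ.abv_smul])
      ((abv_algebraMap_mul_le _ _).trans hz))
  have h4 : v (γ • z - algebraMap Fq K c * z) = v y := by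
    have := h.abv_pow_of_X_torsion hv h2 h3 (sub_ne_zero.2 hne)
    exact (pow_left_inj₀ (v.nonneg _) (v.nonneg _) (by omega)).1 (this.trans hsize.symm)
  have h5 : γ • z * (algebraMap Fq K c * y)⁻¹ - z * y⁻¹ =
      (γ • z - algebraMap Fq K c * z) * (algebraMap Fq K c * y)⁻¹ := by
    field_simp
  rw [h5, map_mul, map_inv₀, map_mul, abv_algebraMap_eq_one hc, one_mul, h4,
    mul_inv_cancel₀ hypos.ne'] at h1
  exact lt_irrefl _ h1

end IsDrinfeldAction

end Inertia

/-- `φ[a]` is generated by one element `x` modulo its integral part `W`, with `φ[a]/W ≅ A/a`, and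
all the maps fixing `W`, moving `x` by an element of `W`, and fixing `φ[b]`, come from `Γ`. -/
def HasTranslations {Fq K : Type*} (Γ : Type*) [Field Fq] [Field K] [Group Γ]
    [MulSemiringAction Γ K] (φ : Fq[X] →+* AddMonoid.End K) (v : AbsoluteValue K ℝ)
    (a b : Fq[X]) : Prop :=
  ∃ x, φ a x = 0 ∧ (∀ y, φ a y = 0 → ∃ f w, φ a w = 0 ∧ v w ≤ 1 ∧ y = φ f x + w) ∧
    (∀ f, v (φ f x) ≤ 1 → a ∣ f) ∧
    ∀ w, φ a w = 0 → v w ≤ 1 → ∃ σ : Γ, (∀ y, φ a y = 0 → v y ≤ 1 → σ • y = y) ∧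
      σ • x = x + w ∧ ∀ y, φ b y = 0 → σ • y = y

lemma action_eq_zero_of_dvd {Fq S : Type*} [Field Fq] [AddCommMonoid S]
    {φ : Fq[X] →+* AddMonoid.End S}
    {a b : Fq[X]} (h : a ∣ b) {x : S} (hx : φ a x = 0) : φ b x = 0 := by
  obtain ⟨c, rfl⟩ := h
  rw [mul_comm, action_mul, hx, map_zero]

lemma action_sub {Fq S : Type*} [Field Fq] [AddCommGroup S] (φ : Fq[X] →+* AddMonoid.End S)
    (a b : Fq[X]) (x : S) : φ (a - b) x = φ a x - φ b x := by
  rw [map_sub]; rfl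

lemma action_eq_self {Fq S : Type*} [Field Fq] [AddCommGroup S] {φ : Fq[X] →+* AddMonoid.End S}
    {a e : Fq[X]} (h : a ∣ e - 1) {x : S} (hx : φ a x = 0) : φ e x = x := by
  have := action_eq_zero_of_dvd h hx
  rwa [action_sub, action_one, sub_eq_zero] at this

lemma exists_idempotent {Fq : Type*} [Field Fq] {a b : Fq[X]} (hab : IsCoprime a b) :
    ∃ e, a ∣ e - 1 ∧ b ∣ e := by
  obtain ⟨u, w, huw⟩ := hab
  exact ⟨w * b, ⟨-u, by rw [← huw]; ring⟩, Dvd.intro_left _ rfl⟩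

section Translations

variable {Fq K Γ : Type*} [Field Fq] [Fintype Fq] [Field K] [Algebra Fq K] [Group Γ]
  [MulSemiringAction Γ K] {q s : ℕ} {T : K} {φ : Fq[X] →+* AddMonoid.End K} {v : AbsoluteValue K ℝ}

lemma pow_smul_of_translation {γ : Γ} {x w : K} (hx : γ • x = x + w) (hw : γ • w = w) (k : ℕ) :
    γ ^ k • x = x + k * w := by
  induction k with
  | zero => simp
  | succ k ih =>
    rw [pow_succ, mul_smul, hx, smul_add, ih]
    have : γ ^ k • w = w := by
      clear ih
      induction k with
      | zero => simp
      | succ k ih => rw [pow_succ, mul_smul, hw, ih]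
    rw [this]; push_cast; ring

namespace IsDrinfeldAction

variable (h : IsDrinfeldAction q s T φ)
include h

lemma natCast_pow_eq_zero {n : ℕ} (hn : 1 ≤ n) : ((q ^ n : ℕ) : K) = 0 := by
  have h0 : (q : K) = 0 := by
    rw [← h.card, ← map_natCast (algebraMap Fq K), Nat.cast_card_eq_zero, map_zero]
  rw [Nat.cast_pow, h0, zero_pow (by omega)]

lemma pow_smul_of_scalar (hΓ : IsInertia Fq Γ T φ v) {γ : Γ} {c : Fq} (hc : c ≠ 0)
    (hγ : ∀ y, φ X y = 0 → v y ≤ 1 → γ • y = algebraMap Fq K c * y) (hv : IsPlaceAtZero T v)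
    (n : ℕ) : ∀ y, φ (X ^ n) y = 0 → v y ≤ 1 → γ ^ q ^ n • y = algebraMap Fq K c * y := by
  have hcK : algebraMap Fq K c ≠ 0 := by simpa using hc
  have hpow1 : ∀ k y, φ X y = 0 → v y ≤ 1 → γ ^ k • y = algebraMap Fq K c ^ k * y := by
    intro k y hXy hy
    induction k with
    | zero => simp
    | succ k ih =>
      rw [pow_succ, mul_smul, hγ y hXy hy, smul_mul', ih, hΓ.smul_algebraMap]; ring
  have hcq : ∀ n, algebraMap Fq K c ^ q ^ n = algebraMap Fq K c := fun n => by
    rw [← h.card, algebraMap_pow_card_pow]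
  induction n with
  | zero => intro y hy _; rw [pow_zero, action_one] at hy; rw [hy, smul_zero, mul_zero]
  | succ n ih =>
    intro y hy hvy
    set δ := γ ^ q ^ n with hδ
    set z := δ • y - algebraMap Fq K c * y with hz
    have hz1 : φ (X ^ n) z = 0 := by
      have h1 : φ X (φ (X ^ n) y) = 0 := by rw [← action_mul, ← pow_succ', hy]
      have h2 := hpow1 (q ^ n) _ h1 (h.abv_apply_le_one hv _ hvy)
      rw [hcq] at h2
      rw [hz, map_sub, ← hΓ.smul_apply, h2, h.apply_smul, sub_self]
    have hz2 : v z ≤ 1 := (abv_sub_le hv.na _ _).trans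
      (max_le (by rwa [hΓ.abv_smul]) ((abv_algebraMap_mul_le _ _).trans hvy))
    have hδz := ih z hz1 hz2
    have hδy : δ • y = algebraMap Fq K c * y + z := by rw [hz]; ring
    have hk : ∀ k : ℕ, algebraMap Fq K c * (δ ^ k • y) =
        algebraMap Fq K c ^ (k + 1) * y + k * algebraMap Fq K c ^ k * z := by
      intro k
      induction k with
      | zero => simp
      | succ k ihk =>
        have h1 := congrArg (δ • ·) ihk
        simp only [smul_mul', smul_add, smul_pow', hΓ.smul_algebraMap, hδz, hδy] at h1
        have h2 : δ • (k : K) = k := by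
          exact map_natCast (MulSemiringAction.toRingHom Γ K δ) k
        rw [pow_succ', mul_smul, h1, h2]; push_cast; ring
    have h3 := hk q
    have h0 : (q : K) = 0 := by simpa using h.natCast_pow_eq_zero (K := K) (n := 1) le_rfl
    rw [h0, zero_mul, zero_mul, add_zero, pow_succ', mul_assoc] at h3
    have h4 := mul_left_cancel₀ hcK h3
    have h5 := hcq 1
    rw [pow_one] at h5
    rw [pow_succ, pow_mul, h4, h5]

lemma span_and_dvd [IsAlgClosed K] (hT : Transcendental Fq T) (hΓ : IsInertia Fq Γ T φ v)
    (hv : IsPlaceAtZero T v) {a b e : Fq[X]} (ha : a.Monic) (hb : b.Monic) (he : a ∣ e - 1)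
    (hbe : b ∣ e) {x : K} (hax : φ (a * b) x = 0)
    (hx : v x ^ (q ^ s) ^ (a * b).natDegree * v T = 1) :
    φ a (φ e x) = 0 ∧
    (∀ y, φ a y = 0 → ∃ f w, φ a w = 0 ∧ v w ≤ 1 ∧ y = φ f (φ e x) + w) ∧
    (∀ f, v (φ f (φ e x)) ≤ 1 → a ∣ f) := by
  have hpush : ∀ w, φ (a * b) w = 0 → φ a (φ e w) = 0 := fun w hw => by
    rw [← action_mul]; exact action_eq_zero_of_dvd (mul_dvd_mul_left a hbe) hw
  refine ⟨hpush x hax, fun y hy => ?_, fun f hf => ?_⟩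
  · obtain ⟨f, w, hw1, hw2, hy'⟩ := h.extremal_span hT hΓ hv (ha.mul hb) hax hx
      (action_eq_zero_of_dvd (Dvd.intro b rfl) hy)
    refine ⟨f, φ e w, hpush w hw1, h.abv_apply_le_one hv _ hw2, ?_⟩
    rw [← action_mul, mul_comm, action_mul, ← map_add, ← hy', action_eq_self he hy]
  · rw [← action_mul] at hf
    have h1 := (Dvd.intro b rfl).trans (h.extremal_dvd hv (ha.mul hb) hax hx hf)
    obtain ⟨k, hk⟩ := he
    have h2 : f = f * e - a * (k * f) := by rw [← mul_assoc, ← hk]; ring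
    rw [h2]
    exact dvd_sub h1 (Dvd.intro _ rfl)

lemma hasTranslations_of_coeff_zero_ne_zero [IsAlgClosed K] (hT : Transcendental Fq T)
    (hΓ : IsInertia Fq Γ T φ v) (hv : IsPlaceAtZero T v) {a b : Fq[X]} (ha : a.Monic)
    (hb : b.Monic) (ha1 : a ≠ 1) (hab : IsCoprime a b) (ha0 : a.coeff 0 ≠ 0) (hb0 : b.coeff 0 ≠ 0) :
    HasTranslations Γ φ v a b := by
  obtain ⟨e, hae, hbe⟩ := exists_idempotent hab
  obtain ⟨e', hbe', hae'⟩ := exists_idempotent hab.symm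
  have hne : a * b ≠ 1 := fun h1 => ha1 (ha.eq_one_of_isUnit (IsUnit.of_mul_eq_one _ h1))
  obtain ⟨x, hax, hx⟩ := h.exists_extremal hT hv (ha.mul hb) hne
  obtain ⟨h1, h2, h3⟩ := h.span_and_dvd hT hΓ hv ha hb hae hbe hax hx
  obtain ⟨-, h2', -⟩ := h.span_and_dvd hT hΓ hv hb ha hbe' hae' (by rwa [mul_comm])
    (by rwa [mul_comm b])
  refine ⟨φ e x, h1, h2, h3, fun w hw1 hw2 => ?_⟩
  obtain ⟨σ, hσ⟩ := (h.extremal_orbit hT hΓ hv (ha.mul hb) hax hx).2 w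
    (action_eq_zero_of_dvd (Dvd.intro b rfl) hw1) hw2
  refine ⟨σ, fun y hy1 hy2 => h.smul_eq_of_integral hΓ hv ha0 hy1 hy2 σ, ?_, fun y hy => ?_⟩
  · rw [hΓ.smul_apply, hσ, map_add, action_eq_self hae hw1]
  · obtain ⟨f, w', hw1', hw2', rfl⟩ := h2' y hy
    rw [smul_add, h.smul_eq_of_integral hΓ hv hb0 hw1' hw2' σ, hΓ.smul_apply, hΓ.smul_apply, hσ,
      map_add _ x, action_eq_zero_of_dvd hae' hw1, add_zero]

lemma hasTranslations_X_pow [IsAlgClosed K] (hT : Transcendental Fq T)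
    (hΓ : IsInertia Fq Γ T φ v) (hv : IsPlaceAtZero T v) {n : ℕ} {b : Fq[X]} (hn : 1 ≤ n)
    (hb : b.Monic) (hab : IsCoprime (X ^ n) b) (hb0 : b.coeff 0 ≠ 0) :
    HasTranslations Γ φ v (X ^ n) b := by
  have ha : (X ^ n : Fq[X]).Monic := monic_X_pow n
  have ha1 : (X ^ n : Fq[X]) ≠ 1 := by
    intro h1
    have h2 := congrArg natDegree h1
    rw [natDegree_X_pow, natDegree_one] at h2
    omega
  obtain ⟨e, hae, hbe⟩ := exists_idempotent hab
  obtain ⟨e', hbe', hae'⟩ := exists_idempotent hab.symm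
  have hne : X ^ n * b ≠ 1 := fun h1 => ha1 (ha.eq_one_of_isUnit (IsUnit.of_mul_eq_one _ h1))
  obtain ⟨x₀, hax₀, hx₀⟩ := h.exists_extremal hT hv (ha.mul hb) hne
  classical
  obtain ⟨c, hc⟩ : ∃ c : Fq, c ∉ ({0, 1} : Finset Fq) := by
    by_contra hcon
    push Not at hcon
    have : (Finset.univ : Finset Fq) ⊆ {0, 1} := fun c _ => hcon c
    have h1 := Finset.card_le_card this
    rw [Finset.card_univ, h.card] at h1
    have := Finset.card_le_two (a := (0 : Fq)) (b := 1)
    have := h.three_le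
    omega
  have hc0 : c ≠ 0 := fun h0 => hc (by simp [h0])
  have hc1 : c ≠ 1 := fun h0 => hc (by simp [h0])
  have hcK : algebraMap Fq K c - 1 ≠ 0 := by
    rw [sub_ne_zero, ← map_one (algebraMap Fq K)]
    exact fun h0 => hc1 ((algebraMap Fq K).injective h0)
  obtain ⟨γ, hγ⟩ := h.exists_scalar_on_X_torsion hT hΓ hv c hc0
  set ν := γ ^ q ^ n with hν
  have hνW : ∀ y, φ (X ^ n) y = 0 → v y ≤ 1 → ν • y = algebraMap Fq K c * y :=
    h.pow_smul_of_scalar hΓ hc0 hγ hv n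
  have hpush : ∀ w, φ (X ^ n * b) w = 0 → φ (X ^ n) (φ e w) = 0 := fun w hw => by
    rw [← action_mul]; exact action_eq_zero_of_dvd (mul_dvd_mul_left _ hbe) hw
  have hpush' : ∀ w, φ (X ^ n * b) w = 0 → φ b (φ e' w) = 0 := fun w hw => by
    rw [← action_mul, mul_comm]; exact action_eq_zero_of_dvd (mul_dvd_mul_right hae' _) hw
  have hscal : ∀ (k : Fq) (w : K), φ (X ^ n) w = 0 → v w ≤ 1 →
      φ (X ^ n) (algebraMap Fq K k * w) = 0 ∧ v (algebraMap Fq K k * w) ≤ 1 := fun k w h1 h2 =>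
    ⟨by rw [h.apply_smul, h1, mul_zero], (abv_algebraMap_mul_le _ _).trans h2⟩
  have hkinv : algebraMap Fq K (c - 1)⁻¹ = (algebraMap Fq K c - 1)⁻¹ := by
    rw [map_inv₀, map_sub, map_one]
  -- adjust the extremal point so that `ν` fixes its component in `φ[X ^ n]`
  obtain ⟨x, hax, hx, hνx⟩ : ∃ x, φ (X ^ n * b) x = 0 ∧
      v x ^ (q ^ s) ^ (X ^ n * b).natDegree * v T = 1 ∧ ν • φ e x = φ e x := by
    obtain ⟨hd1, hd2⟩ := h.smul_sub_extremal hΓ hv (ha.mul hb).ne_zero hax₀ hx₀ ν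
    set w₁ := φ e (ν • x₀ - x₀) with hw₁
    have hw₁1 : φ (X ^ n) w₁ = 0 := hpush _ hd1
    have hw₁2 : v w₁ ≤ 1 := h.abv_apply_le_one hv _ hd2
    obtain ⟨hw1, hw2⟩ := hscal (-(c - 1)⁻¹) w₁ hw₁1 hw₁2
    set w₀ := algebraMap Fq K (-(c - 1)⁻¹) * w₁ with hw₀
    refine ⟨x₀ + w₀, ?_, ?_, ?_⟩
    · rw [map_add, hax₀, action_eq_zero_of_dvd (Dvd.intro b rfl) hw1, add_zero]
    · rw [abv_add_eq_left hv.na (hw2.trans_lt (hv.one_lt_of_extremal hx₀)), hx₀]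
    · rw [map_add, action_eq_self hae hw1, smul_add, hνW w₀ hw1 hw2, hΓ.smul_apply]
      have h1 : φ e (ν • x₀) = φ e x₀ + w₁ := by rw [hw₁, map_sub]; ring
      rw [h1, hw₀, map_neg, hkinv]
      field_simp
      ring
  obtain ⟨h1, h2, h3⟩ := h.span_and_dvd hT hΓ hv ha hb hae hbe hax hx
  obtain ⟨-, h2', -⟩ := h.span_and_dvd hT hΓ hv hb ha hbe' hae' (by rwa [mul_comm])
    (by rwa [mul_comm b])
  have hνV : ∀ y, φ b y = 0 → ν • y = y := by
    intro y hy
    obtain ⟨f, w', hw1', hw2', rfl⟩ := h2' y hy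
    obtain ⟨hd1, hd2⟩ := h.smul_sub_extremal hΓ hv (ha.mul hb).ne_zero hax hx γ
    have hfix : γ • φ e' (γ • x - x) = φ e' (γ • x - x) :=
      h.smul_eq_of_integral hΓ hv hb0 (hpush' _ hd1) (h.abv_apply_le_one hv _ hd2) γ
    have hmove : γ • φ e' x = φ e' x + φ e' (γ • x - x) := by
      rw [hΓ.smul_apply, ← map_add, add_sub_cancel]
    have h4 := pow_smul_of_translation hmove hfix (q ^ n)
    rw [h.natCast_pow_eq_zero hn, zero_mul, add_zero] at h4
    rw [smul_add, h.smul_eq_of_integral hΓ hv hb0 hw1' hw2' ν, hΓ.smul_apply, h4]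
  refine ⟨φ e x, h1, h2, h3, fun w hw1 hw2 => ?_⟩
  obtain ⟨hu1, hu2⟩ := hscal (c - 1)⁻¹ w hw1 hw2
  set u := algebraMap Fq K (c - 1)⁻¹ * w with hu
  obtain ⟨p, hp⟩ := (h.extremal_orbit hT hΓ hv (ha.mul hb) hax hx).2 u
    (action_eq_zero_of_dvd (Dvd.intro b rfl) hu1) hu2
  have hpx : p • φ e x = φ e x + u := by rw [hΓ.smul_apply, hp, map_add, action_eq_self hae hu1]
  have hker : ∀ y : K, (ν * p * (p * ν)⁻¹) • (p • ν • y) = ν • p • y := fun y => by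
    rw [← mul_smul, ← mul_smul, ← mul_smul]; congr 1; group
  have hstable : ∀ (σ : Γ) (b : Fq[X]) y, φ b y = 0 → φ b (σ • y) = 0 := fun σ b y hy => by
    rw [← hΓ.smul_apply, hy, smul_zero]
  have hW : ∀ y, φ (X ^ n) y = 0 → v y ≤ 1 → (ν * p * (p * ν)⁻¹) • y = y := by
    intro y hy1 hy2
    have e1 : y = p • ν • ((p * ν)⁻¹ • y) := by rw [← mul_smul p, smul_inv_smul]
    have e2 := hstable (p * ν)⁻¹ _ y hy1
    have e3 : v ((p * ν)⁻¹ • y) ≤ 1 := by rwa [hΓ.abv_smul]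
    conv_lhs => rw [e1, hker]
    rw [hνW _ (hstable p _ _ e2) (by rwa [hΓ.abv_smul])]
    conv_rhs => rw [e1, hνW _ e2 e3, smul_mul', hΓ.smul_algebraMap]
  refine ⟨ν * p * (p * ν)⁻¹, hW, ?_, fun y hy => ?_⟩
  · have h5 := hker (φ e x)
    rw [hνx, hpx, smul_add, smul_add, hW u hu1 hu2, hνx, hνW u hu1 hu2] at h5
    have h6 : w = (algebraMap Fq K c - 1) * u := by
      rw [hu, hkinv, mul_inv_cancel_left₀ hcK]
    rw [h6]; linear_combination h5
  · have e1 : y = p • ν • ((p * ν)⁻¹ • y) := by rw [← mul_smul p, smul_inv_smul]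
    have e2 := hstable (p * ν)⁻¹ _ y hy
    conv_lhs => rw [e1, hker]
    rw [hνV _ (hstable p _ _ e2)]
    conv_rhs => rw [e1, hνV _ e2]

end IsDrinfeldAction

end Translations

/-- A complete discretely valued field of equal characteristic, with uniformizer `t` and
coefficient field `k`. -/
structure IsCoefficientField {k E : Type*} [Field k] [NontriviallyNormedField E]
    (c : k →+* E) (t : E) : Prop where
  norm_pos : 0 < ‖t‖
  norm_lt_one : ‖t‖ < 1
  norm_le_one : ∀ x, ‖c x‖ ≤ 1
  residue : ∀ y : E, ‖y‖ ≤ 1 → ∃ x, ‖y - c x‖ < 1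
  discrete : ∀ y : E, y ≠ 0 → ∃ m : ℤ, ‖y‖ = ‖t‖ ^ m

section LaurentSeries

open LaurentSeries

lemma LaurentSeries.valuation_single (k : Type*) [Field k] (s : ℤ) :
    Valued.v (HahnSeries.single s (1 : k) : k⸨X⸩) = WithZero.exp (-s) :=
  LaurentSeries.valuation_single_zpow k s

lemma LaurentSeries.nonempty_rankOne (k : Type*) [Field k] :
    Nonempty (Valued.v (R := k⸨X⸩)).RankOne := by
  refine ⟨{ hom' := (WithZeroMulInt.toNNReal (e := 2) two_ne_zero).comp
              (MonoidWithZeroHom.ValueGroup₀.embedding), strictMono' := ?_, exists_val_nontrivial := ?_ }⟩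
  · exact (WithZeroMulInt.toNNReal_strictMono (by norm_num)).comp
      MonoidWithZeroHom.ValueGroup₀.embedding_strictMono
  · refine ⟨HahnSeries.single 1 1, ?_, ?_⟩
    · rw [LaurentSeries.valuation_single]; exact WithZero.exp_ne_zero
    · rw [LaurentSeries.valuation_single, ← WithZero.exp_zero, ne_eq, WithZero.exp_inj]; omega

lemma exists_isCoefficientField (k : Type) [Field k] :
    ∃ (E : Type) (_ : NontriviallyNormedField E) (_ : IsUltrametricDist E) (_ : CompleteSpace E)
      (c : k →+* E) (t : E), IsCoefficientField c t := by
  obtain ⟨hr⟩ := LaurentSeries.nonempty_rankOne k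
  have hs := LaurentSeries.valuation_single k
  have hle : ∀ y : k⸨X⸩, Valued.v y ≤ 1 ↔ ∀ n < 0, y.coeff n = 0 := fun y => by
    simpa using LaurentSeries.valuation_le_iff_coeff_lt_eq_zero k (D := 0) (f := y)
  have hlt : ∀ y : k⸨X⸩, (∀ n < 1, y.coeff n = 0) → Valued.v y < 1 := fun y hy =>
    ((LaurentSeries.valuation_le_iff_coeff_lt_eq_zero k (D := 1)).2 hy).trans_lt
      (by rw [← WithZero.exp_zero, WithZero.exp_lt_exp]; norm_num)
  have hpow : ∀ m : ℤ, Valued.v ((HahnSeries.single 1 (1 : k) : k⸨X⸩) ^ m) = WithZero.exp (-m) :=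
    fun m => by rw [map_zpow₀, hs, ← WithZero.exp_zsmul]; simp
  let _ : NontriviallyNormedField k⸨X⸩ :=
    Valued.toNontriviallyNormedField k⸨X⸩ (WithZero (Multiplicative ℤ))
  have hu : IsUltrametricDist k⸨X⸩ :=
    inferInstanceAs (@IsUltrametricDist k⸨X⸩
      (Valued.toNormedField k⸨X⸩ (WithZero (Multiplicative ℤ))).toDist)
  have hc : CompleteSpace k⸨X⸩ := LaurentSeries.instLaurentSeriesComplete
  refine ⟨k⸨X⸩, inferInstance, hu, hc, HahnSeries.C, HahnSeries.single 1 1, ?_, ?_, ?_, ?_, ?_⟩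
  · rw [norm_pos_iff]; simp
  · refine Valued.toNormedField.norm_lt_one_iff.2 ?_
    rw [hs, ← WithZero.exp_zero, WithZero.exp_lt_exp]; norm_num
  · intro x
    refine Valued.toNormedField.norm_le_one_iff.2 ((hle _).2 fun n hn => ?_)
    rw [HahnSeries.C_apply, HahnSeries.coeff_single_of_ne hn.ne]
  · intro y hy
    refine ⟨y.coeff 0, Valued.toNormedField.norm_lt_one_iff.2 (hlt _ fun n hn => ?_)⟩
    rw [HahnSeries.coeff_sub, HahnSeries.C_apply]
    rcases (show n = 0 ∨ n < 0 by omega) with rfl | hn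
    · simp
    · rw [HahnSeries.coeff_single_of_ne hn.ne, sub_zero]
      exact (hle _).1 (Valued.toNormedField.norm_le_one_iff.1 hy) n hn
  · intro y hy
    obtain ⟨m, hm⟩ : ∃ m : ℤ, Valued.v y = WithZero.exp (-m) := by
      have h0 : Valued.v y ≠ 0 := (Valuation.ne_zero_iff _).2 hy
      exact ⟨-WithZero.log (Valued.v y), by rw [neg_neg, WithZero.exp_log h0]⟩
    refine ⟨m, ?_⟩
    rw [← norm_zpow]
    have h1 := (hm.trans (hpow m).symm)
    exact le_antisymm (Valued.toNormedField.norm_le_iff.2 h1.le)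
      (Valued.toNormedField.norm_le_iff.2 h1.ge)

end LaurentSeries

section SpectralPlace

variable (E : Type*) [NontriviallyNormedField E] [IsUltrametricDist E] [CompleteSpace E]
  (L : Type*) [Field L] [Algebra E L] [Algebra.IsAlgebraic E L]

/-- The spectral norm as an absolute value. -/
def spectralAbv : AbsoluteValue L ℝ where
  toFun := spectralNorm E L
  map_mul' := spectralAlgNorm_mul
  nonneg' := spectralNorm_nonneg
  eq_zero' x := ⟨fun h => (eq_zero_of_map_eq_zero (spectralMulAlgNorm E L) h), fun h => by
    rw [h, spectralNorm_zero]⟩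
  add_le' x y := map_add_le_add (spectralMulAlgNorm E L) x y

variable {E L}

lemma spectralAbv_apply (x : L) : spectralAbv E L x = spectralNorm E L x := rfl

lemma spectralAbv_na (x y : L) :
    spectralAbv E L (x + y) ≤ max (spectralAbv E L x) (spectralAbv E L y) :=
  isNonarchimedean_spectralNorm x y

lemma spectralAbv_algebraMap (x : E) : spectralAbv E L (algebraMap E L x) = ‖x‖ :=
  spectralNorm_extends x

lemma spectralAbv_algEquiv (σ : L ≃ₐ[E] L) (x : L) : spectralAbv E L (σ x) = spectralAbv E L x :=
  (spectralNorm_eq_of_equiv σ x).symm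

lemma AbsoluteValue.exists_lt_one_of_prod {K : Type*} [Field K] (v : AbsoluteValue K ℝ)
    {s : Multiset K} (h : v s.prod < 1) : ∃ x ∈ s, v x < 1 := by
  induction s using Multiset.induction with
  | empty => simp at h
  | cons a s ih =>
    by_cases ha : v a < 1
    · exact ⟨a, Multiset.mem_cons_self a s, ha⟩
    · have : v s.prod < 1 := by
        rw [Multiset.prod_cons, map_mul] at h
        exact (le_mul_of_one_le_left (v.nonneg _) (not_lt.1 ha)).trans_lt h
      obtain ⟨x, hx, hx'⟩ := ih this
      exact ⟨x, Multiset.mem_cons_of_mem hx, hx'⟩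

lemma abv_sum_lt_one {K ι : Type*} [Field K] {v : AbsoluteValue K ℝ}
    (na : ∀ x y, v (x + y) ≤ max (v x) (v y)) {s : Finset ι} {f : ι → K}
    (h : ∀ i ∈ s, v (f i) < 1) : v (∑ i ∈ s, f i) < 1 :=
  Finset.sum_induction f (fun x => v x < 1) (fun _ _ => abv_add_lt na) (by simp) h

variable {k : Type*} [Field k] [IsAlgClosed k] {c : k →+* E} {t : E}

lemma IsCoefficientField.exists_residue (hc : IsCoefficientField c t) {y : L}
    (hy : spectralAbv E L y ≤ 1) : ∃ x, spectralAbv E L (y - algebraMap E L (c x)) < 1 := by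
  have h_int : IsIntegral E y := Algebra.IsIntegral.isIntegral y
  have hp : (minpoly E y).Monic := minpoly.monic h_int
  have hcoeff := (spectralValue_le_one_iff hp).1 hy
  choose x hx using fun i => hc.residue _ (hcoeff i)
  set n := (minpoly E y).natDegree
  set p : k[X] := X ^ n + ∑ i ∈ Finset.range n, C (x i) * X ^ i with hpdef
  have hpm : p.Monic := by
    refine monic_X_pow_add ?_
    refine (degree_sum_le _ _).trans_lt ((Finset.sup_lt_iff (WithBot.bot_lt_coe n)).2 fun i hi => ?_)
    exact (degree_C_mul_X_pow_le _ _).trans_lt (WithBot.coe_lt_coe.2 (Finset.mem_range.1 hi))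
  have h1 : (p.map ((algebraMap E L).comp c)).eval y =
      ∑ i ∈ Finset.range n, algebraMap E L (c (x i) - (minpoly E y).coeff i) * y ^ i := by
    have h2 := minpoly.aeval E y
    rw [hp.as_sum] at h2
    simp only [hpdef, map_add, map_sum, map_mul, map_pow, aeval_X, aeval_C, Polynomial.map_add,
      Polynomial.map_pow, Polynomial.map_mul, map_X, map_C, Polynomial.map_sum, eval_add, eval_pow,
      eval_X, eval_mul, eval_C, eval_finsetSum, map_sub, sub_mul, Finset.sum_sub_distrib,
      RingHom.comp_apply] at h2 ⊢
    linear_combination h2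
  have h3 : spectralAbv E L ((p.map ((algebraMap E L).comp c)).eval y) < 1 := by
    rw [h1]
    refine abv_sum_lt_one spectralAbv_na fun i _ => ?_
    rw [map_mul, map_pow, spectralAbv_algebraMap, norm_sub_rev]
    exact mul_lt_one_of_nonneg_of_lt_one_left (norm_nonneg _) (hx i)
      (pow_le_one₀ ((spectralAbv E L).nonneg _) hy)
  rw [(IsAlgClosed.splits p).eq_prod_roots_of_monic hpm, Polynomial.map_multiset_prod,
    eval_multiset_prod] at h3
  obtain ⟨z, hz, hz'⟩ := AbsoluteValue.exists_lt_one_of_prod _ h3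
  simp only [Multiset.map_map, Multiset.mem_map] at hz
  obtain ⟨a, -, rfl⟩ := hz
  exact ⟨a, by simpa using hz'⟩

lemma IsCoefficientField.abv_algEquiv_sub (hc : IsCoefficientField c t) {y : L}
    (hy : spectralAbv E L y ≤ 1) (σ : L ≃ₐ[E] L) : spectralAbv E L (σ y - y) < 1 := by
  obtain ⟨x, hx⟩ := hc.exists_residue hy
  have h1 : σ y - y = σ (y - algebraMap E L (c x)) - (y - algebraMap E L (c x)) := by
    rw [map_sub, AlgEquiv.commutes]; ring
  rw [h1]
  exact abv_sub_lt spectralAbv_na (by rwa [spectralAbv_algEquiv]) hx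

omit [IsAlgClosed k] in
lemma IsCoefficientField.abv_pow_card_orbit [IsAlgClosed L] (hc : IsCoefficientField c t) {x : L}
    (hx : x ≠ 0) (hs : IsSeparable E x) :
    ∃ m : ℤ, spectralAbv E L x ^ Nat.card (MulAction.orbit (L ≃ₐ[E] L) x) =
      spectralAbv E L (algebraMap E L t) ^ m := by
  have h_int : IsIntegral E x := Algebra.IsIntegral.isIntegral x
  have : Normal E L := ⟨fun _ => IsAlgClosed.splits _⟩
  have ho : MulAction.orbit (L ≃ₐ[E] L) x = (minpoly E x).rootSet L := by
    ext y
    rw [← Normal.minpoly_eq_iff_mem_orbit, mem_rootSet]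
    constructor
    · intro h; rw [← h]
      exact ⟨minpoly.ne_zero (Algebra.IsIntegral.isIntegral y), minpoly.aeval _ _⟩
    · rintro ⟨-, h⟩
      exact (minpoly.eq_of_irreducible_of_monic (minpoly.irreducible h_int) h (minpoly.monic h_int)).symm
  have hcard : Nat.card (MulAction.orbit (L ≃ₐ[E] L) x) = (minpoly E x).natDegree := by
    rw [ho, Nat.card_eq_fintype_card, card_rootSet_eq_natDegree hs (IsAlgClosed.splits _)]
  have h0 : (minpoly E x).coeff 0 ≠ 0 := minpoly.coeff_zero_ne_zero h_int hx
  obtain ⟨m, hm⟩ := hc.discrete _ h0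
  refine ⟨m, ?_⟩
  have hn : (minpoly E x).natDegree ≠ 0 := (minpoly.natDegree_pos h_int).ne'
  rw [hcard, spectralAbv_algebraMap, ← hm, spectralAbv_apply,
    spectralNorm.spectralNorm_eq_norm_coeff_zero_rpow, one_div,
    Real.rpow_inv_natCast_pow (norm_nonneg _) hn]

end SpectralPlace

section ExistsPlace

lemma exists_restrict {F K L : Type*} [Field F] [Field K] [Field L] [Algebra F K] [Normal F K]
    (ι : K →+* L) (σ : L ≃+* L) (hσ : ∀ x, σ (ι (algebraMap F K x)) = ι (algebraMap F K x)) :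
    ∃ g : K ≃ₐ[F] K, ∀ x, ι (g x) = σ (ι x) := by
  let _ : Algebra F L := (ι.comp (algebraMap F K)).toAlgebra
  let _ : Algebra K L := ι.toAlgebra
  have : IsScalarTower F K L := IsScalarTower.of_algebraMap_eq fun _ => rfl
  let σ' : L ≃ₐ[F] L := AlgEquiv.ofRingEquiv (f := σ) hσ
  exact ⟨σ'.restrictNormal K, AlgEquiv.restrictNormal_commutes σ' K⟩

lemma exists_extend {F K L : Type*} [Field F] [Field K] [Field L] [Algebra F K]
    [Algebra.IsAlgebraic F K] [IsAlgClosed L] (j : F →+* L) :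
    ∃ ι : K →+* L, ∀ x, ι (algebraMap F K x) = j x := by
  let _ : Algebra F L := j.toAlgebra
  exact ⟨(IsAlgClosed.lift (R := F) (S := K) (M := L)).toRingHom, fun x =>
    (IsAlgClosed.lift (R := F) (S := K) (M := L)).commutes x⟩

lemma exists_ratFunc_hom {Fq E : Type*} [Field Fq] [Field E] (c : Fq →+* E) (t : E)
    (ht : ∀ p : Fq[X], p ≠ 0 → p.eval₂ c t ≠ 0) :
    ∃ j : RatFunc Fq →+* E, j RatFunc.X = t ∧ ∀ a, j (RatFunc.C a) = c a := by
  have hi : Function.Injective (eval₂RingHom c t) := (injective_iff_map_eq_zero _).2 fun p hp => by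
    by_contra h; exact ht p h hp
  refine ⟨IsFractionRing.lift hi, ?_, fun a => ?_⟩
  · rw [← RatFunc.algebraMap_X, IsFractionRing.lift_algebraMap]; simp
  · rw [← RatFunc.algebraMap_C, IsFractionRing.lift_algebraMap]; simp

lemma IsCoefficientField.eval₂_ne_zero {k E : Type*} [Field k] [NontriviallyNormedField E]
    [IsUltrametricDist E] {c : k →+* E} {t : E} (hc : IsCoefficientField c t) (p : k[X]) :
    p ≠ 0 → p.eval₂ c t ≠ 0 := by
  have ht0 : t ≠ 0 := norm_pos_iff.1 hc.norm_pos
  have hle : ∀ p : k[X], ‖p.eval₂ c t‖ ≤ 1 := fun p => by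
    rw [eval₂_eq_sum_range]
    refine IsUltrametricDist.norm_sum_le_of_forall_le_of_nonneg zero_le_one fun i _ => ?_
    rw [norm_mul, norm_pow]
    exact mul_le_one₀ (hc.norm_le_one _) (pow_nonneg (norm_nonneg _) _)
      (pow_le_one₀ (norm_nonneg _) hc.norm_lt_one.le)
  induction h : p.natDegree using Nat.strong_induction_on generalizing p with
  | _ n ih =>
    intro hp h0
    have hdec := p.divX_mul_X_add
    have h1 : p.divX.eval₂ c t * t + c (p.coeff 0) = 0 := by
      conv_rhs => rw [← h0, ← hdec]
      simp
    by_cases hp0 : p.coeff 0 = 0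
    · rw [hp0, map_zero, add_zero] at h1
      have h2 : p.divX ≠ 0 := fun h2 => hp (by rw [← hdec, h2, hp0]; simp)
      have h3 : p.divX.natDegree < n := by
        rw [natDegree_divX_eq_natDegree_tsub_one, h]
        have : p.natDegree ≠ 0 := fun h4 => by
          rw [eq_C_of_natDegree_eq_zero h4, hp0, C_0] at hp; exact hp rfl
        omega
      exact ih _ h3 _ rfl h2 ((mul_eq_zero.1 h1).resolve_right ht0)
    · have h2 : ‖c (p.coeff 0)‖ < 1 := by
        rw [eq_neg_of_add_eq_zero_right h1, norm_neg, norm_mul]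
        exact mul_lt_one_of_nonneg_of_lt_one_right (hle _) (norm_nonneg _) hc.norm_lt_one
      have h3 := hc.norm_le_one (p.coeff 0)⁻¹
      have h4 : ‖c (p.coeff 0)‖ * ‖c (p.coeff 0)⁻¹‖ = 1 := by
        rw [← norm_mul, ← map_mul, mul_inv_cancel₀ hp0, map_one, norm_one]
      have := mul_lt_one_of_nonneg_of_lt_one_left (norm_nonneg _) h2 h3
      linarith

variable {Fq : Type} [Field Fq]

lemma transcendental_X : Transcendental Fq (algebraMap (RatFunc Fq)
    (AlgebraicClosure (RatFunc Fq)) RatFunc.X) := by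
  have h : Transcendental Fq (RatFunc.X : RatFunc Fq) := by
    rw [transcendental_iff]
    intro p hp
    rw [← RatFunc.algebraMap_X, aeval_algebraMap_apply] at hp
    simpa using hp
  exact (transcendental_algebraMap_iff (algebraMap (RatFunc Fq)
    (AlgebraicClosure (RatFunc Fq))).injective).2 h

theorem exists_inertia_of_hom {F K E k : Type*} (L : Type*) [Fintype Fq] [Field F] [Field K]
    [Algebra F K]
    [Normal F K] [Algebra Fq F] [Algebra Fq K] [IsScalarTower Fq F K] [Field k] [IsAlgClosed k]
    [NontriviallyNormedField E] [IsUltrametricDist E] [CompleteSpace E] [Field L] [Algebra E L]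
    [IsAlgClosed L] [Algebra.IsAlgebraic E L] {c : k →+* E} {t : E} (hc : IsCoefficientField c t)
    {q s : ℕ} {X₀ : F} (hX : Transcendental Fq X₀)
    {φ : Fq[X] →+* AddMonoid.End K} (h : IsDrinfeldAction q s (algebraMap F K X₀) φ)
    (j : F →+* E) (hjX : j X₀ = t) :
    ∃ (Γ : Subgroup (K ≃ₐ[F] K)) (v : AbsoluteValue K ℝ),
      IsPlaceAtZero (algebraMap F K X₀) v ∧ IsInertia Fq Γ (algebraMap F K X₀) φ v := by
  obtain ⟨ι, hι⟩ := exists_extend (K := K) ((algebraMap E L).comp j)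
  have hιX : ι (algebraMap F K X₀) = algebraMap E L t := by
    rw [hι, RingHom.comp_apply, hjX]
  have hfix : ∀ (σ : L ≃ₐ[E] L) x, σ (ι (algebraMap F K x)) =
      ι (algebraMap F K x) := fun σ x => by
    rw [hι]; exact σ.commutes _
  let Γ : Subgroup (K ≃ₐ[F] K) :=
    { carrier := {g | ∃ σ : L ≃ₐ[E] L, ∀ x, ι (g x) = σ (ι x)}
      mul_mem' := by
        rintro g g' ⟨σ, hσ⟩ ⟨σ', hσ'⟩
        exact ⟨σ * σ', fun x => by simp [hσ, hσ']⟩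
      one_mem' := ⟨1, fun x => rfl⟩
      inv_mem' := by
        rintro g ⟨σ, hσ⟩
        refine ⟨σ⁻¹, fun x => σ.injective ?_⟩
        rw [← hσ, ← AlgEquiv.mul_apply, ← AlgEquiv.mul_apply]; simp }
  let v : AbsoluteValue K ℝ := (spectralAbv E L).comp ι.injective
  have hv : ∀ x, v x = spectralAbv E L (ι x) := fun _ => rfl
  have hΓ : ∀ g : Γ, ∃ σ : L ≃ₐ[E] L, ∀ x, ι (g • x) = σ (ι x) := fun g => g.2
  have hvT : v (algebraMap F K X₀) = ‖t‖ := by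
    rw [hv, hιX, spectralAbv_algebraMap]
  have hF : ∀ (g : Γ) x, g • algebraMap F K x = algebraMap F K x :=
    fun g x => g.1.commutes x
  have hA : ∀ a, algebraMap Fq K a = algebraMap F K (algebraMap Fq F a) :=
    fun a => IsScalarTower.algebraMap_apply _ _ _ a
  refine ⟨Γ, v, ⟨fun x y => ?_, ?_, ?_⟩, ⟨?_, fun g => hF g _, ?_, ?_, ?_, ?_⟩⟩
  · simp only [hv, map_add]; exact spectralAbv_na _ _
  · rw [hvT]; exact hc.norm_pos
  · rw [hvT]; exact hc.norm_lt_one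
  · intro g b x
    refine ringHom_apply_action φ h.apply_C h.apply_X_eq_eval (MulSemiringAction.toRingHom Γ K g)
      (fun a => ?_) ?_ b x
    · rw [hA]; exact hF g _
    · rw [drinfeldPoly_map]; congr 1; exact hF g _
  · intro g a; rw [hA]; exact hF g _
  · intro g x
    obtain ⟨σ, hσ⟩ := hΓ g
    rw [hv, hσ, spectralAbv_algEquiv, hv]
  · intro g x hx
    obtain ⟨σ, hσ⟩ := hΓ g
    rw [hv, map_sub, hσ]
    rw [hv] at hx
    exact hc.abv_algEquiv_sub (y := ι x) hx σ
  · intro b hb x hx0 hx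
    have hsep : (actionPoly (drinfeldPoly q s X₀) b).Separable := by
      refine actionPoly_separable (t := X₀) ?_ fun h0 => hb ((transcendental_iff.1 hX) b h0)
      exact h.derivative_drinfeldPoly _
    have hroot : (actionPoly (drinfeldPoly q s X₀) b).eval₂
        (algebraMap _ K) x = 0 := by
      rw [← eval_map, actionPoly_map _ (fun a => (hA a).symm), drinfeldPoly_map,
        eval_actionPoly φ h.apply_C h.apply_X_eq_eval, hx]
    have hs : IsSeparable E (ι x) := by
      refine Polynomial.Separable.of_dvd (hsep.map (f := j)) (minpoly.dvd _ _ ?_)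
      rw [aeval_def, eval₂_map]
      have h1 := congrArg ι hroot
      rw [hom_eval₂, map_zero] at h1
      rwa [show (algebraMap E L).comp j = ι.comp (algebraMap F K) from
        RingHom.ext fun a => (hι a).symm]
    obtain ⟨m, hm⟩ := hc.abv_pow_card_orbit ((map_ne_zero ι).2 hx0) hs
    refine ⟨m, ?_⟩
    rw [hvT, ← spectralAbv_algebraMap (L := L) t, ← hm, hv]
    congr 1
    have himg : MulAction.orbit (L ≃ₐ[E] L) (ι x) = ι '' MulAction.orbit Γ x := by
      ext y
      constructor
      · rintro ⟨σ, rfl⟩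
        obtain ⟨g, hg⟩ := exists_restrict ι σ.toRingEquiv (hfix σ)
        exact ⟨g x, ⟨⟨g, σ, hg⟩, rfl⟩, hg x⟩
      · rintro ⟨_, ⟨g, rfl⟩, rfl⟩
        obtain ⟨σ, hσ⟩ := hΓ g
        exact ⟨σ, (hσ x).symm⟩
    rw [himg, Nat.card_image_of_injective ι.injective]


theorem exists_inertia [Fintype Fq] {q s : ℕ}
    {φ : Fq[X] →+* AddMonoid.End (AlgebraicClosure (RatFunc Fq))}
    (h : IsDrinfeldAction q s (algebraMap (RatFunc Fq) _ RatFunc.X) φ) :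
    ∃ (Γ : Subgroup (AlgebraicClosure (RatFunc Fq) ≃ₐ[RatFunc Fq] AlgebraicClosure (RatFunc Fq)))
      (v : AbsoluteValue (AlgebraicClosure (RatFunc Fq)) ℝ),
      IsPlaceAtZero (algebraMap (RatFunc Fq) _ RatFunc.X) v ∧
      IsInertia Fq Γ (algebraMap (RatFunc Fq) _ RatFunc.X) φ v := by
  obtain ⟨E, _, _, _, c, t, hc⟩ := exists_isCoefficientField (AlgebraicClosure Fq)
  obtain ⟨j, hjX, -⟩ := exists_ratFunc_hom (c.comp (algebraMap Fq (AlgebraicClosure Fq))) t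
    fun p hp => by
      rw [← eval₂_map]
      exact hc.eval₂_ne_zero _ ((Polynomial.map_ne_zero_iff (algebraMap Fq _).injective).2 hp)
  exact exists_inertia_of_hom (AlgebraicClosure E) hc (fun h0 => transcendental_X h0.algebraMap) h
    j hjX

end ExistsPlace

section Orbit

variable {Fq K : Type*} [Field Fq] [Fintype Fq] [Field K] [Algebra Fq K] {q s : ℕ} {T : K}
  {φ : Fq[X] →+* AddMonoid.End K}

/-- At a pole of `T` all torsion points have absolute value less than `1`. -/
lemma IsDrinfeldAction.abv_lt_one_of_pole (h : IsDrinfeldAction q s T φ) {w : AbsoluteValue K ℝ}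
    (na : ∀ x y, w (x + y) ≤ max (w x) (w y)) (hT : 1 < w T) {a : Fq[X]} (ha : a ≠ 0) {x : K}
    (hx : φ a x = 0) : w x < 1 := by
  by_contra! h1
  have hQ := h.two_le_pow
  have hq := h.three_le
  have hstep : ∀ y, 1 ≤ w y → w y < w (φ X y) := by
    intro y hy
    have h2 : w T < w T ^ (q - 1) := lt_self_pow₀ hT (by omega)
    have h3 : w y ≤ w y ^ (q ^ s) := le_self_pow₀ hy (by omega)
    have h4 : w y ^ (q ^ s) ≤ w y ^ (q ^ s * q) := pow_le_pow_right₀ hy (by nlinarith)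
    have h5 : w y < w (T ^ (q - 1) * y ^ (q ^ s * q)) := by
      rw [map_mul, map_pow, map_pow]; nlinarith
    rw [h.apply_X, abv_add_eq_right na]
    · exact h5
    · refine abv_add_lt na ?_ ?_
      · rw [map_mul, map_mul, map_pow, map_pow]; nlinarith
      · rw [map_mul, map_pow, map_pow, map_pow]; nlinarith
  have hall : ∀ i, 1 ≤ w (φ (X ^ i) x) := by
    intro i
    induction i with
    | zero => rwa [pow_zero, action_one]
    | succ i ih => rw [pow_succ', action_mul]; exact ih.trans (hstep _ ih).le
  have h6 := abv_action_eq_of_increasing na h.apply_C ha fun i _ => by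
    rw [pow_succ' X i, action_mul]; exact hstep _ (hall i)
  rw [hx, map_zero] at h6
  linarith [hall a.natDegree]

variable [Algebra Fq[X] K] [IsScalarTower Fq Fq[X] K]

lemma abv_algebraMap_of_pole {w : AbsoluteValue K ℝ}
    (na : ∀ x y, w (x + y) ≤ max (w x) (w y)) (hT : 1 < w (algebraMap Fq[X] K X)) {c : Fq[X]}
    (hc : c ≠ 0) : w (algebraMap Fq[X] K c) = w (algebraMap Fq[X] K X) ^ c.natDegree := by
  have hψ : ∀ (b : Fq[X]) (x : K), Module.toAddMonoidEnd Fq[X] K b x = algebraMap Fq[X] K b * x :=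
    fun b x => by rw [← Algebra.smul_def]; rfl
  have h := abv_action_eq_of_increasing (φ := Module.toAddMonoidEnd Fq[X] K) na (x := 1) (b := c)
    (fun a x => by rw [hψ, IsScalarTower.algebraMap_apply Fq Fq[X] K]; rfl) hc fun i _ => by
      rw [hψ, hψ, mul_one, mul_one, map_pow, map_pow, map_pow, map_pow]
      exact pow_lt_pow_right₀ hT (Nat.lt_succ_self i)
  rwa [hψ, hψ, mul_one, mul_one, map_pow, map_pow] at h

lemma X_pow_dvd_of_abv_le {v : AbsoluteValue K ℝ} (hv : IsPlaceAtZero (algebraMap Fq[X] K X) v)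
    {c : Fq[X]} (hc : c ≠ 0) {k : ℕ}
    (h : v (algebraMap Fq[X] K c) ≤ v (algebraMap Fq[X] K X) ^ k) : X ^ k ∣ c := by
  obtain ⟨d, hd, hXd⟩ := exists_eq_pow_rootMultiplicity_mul_and_not_dvd c hc 0
  rw [C_0, sub_zero] at hd hXd
  set m := c.rootMultiplicity 0
  have hle : ∀ b : Fq[X], v (algebraMap Fq[X] K b) ≤ 1 := by
    intro b
    induction b using Polynomial.induction_on' with
    | add p p' hp hp' => rw [map_add]; exact abv_add_le hv.na hp hp'
    | monomial n c =>
      rw [← C_mul_X_pow_eq_monomial, map_mul, map_pow, ← algebraMap_eq,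
        ← IsScalarTower.algebraMap_apply Fq Fq[X] K]
      refine (abv_algebraMap_mul_le _ _).trans ?_
      rw [map_pow]
      exact pow_le_one₀ hv.T_pos.le hv.T_lt_one.le
  have hd1 : v (algebraMap Fq[X] K d) = 1 := by
    have h0 : d.coeff 0 ≠ 0 := fun h0 => hXd (X_dvd_iff.2 h0)
    rw [← d.divX_mul_X_add, map_add, map_mul, ← algebraMap_eq,
      ← IsScalarTower.algebraMap_apply Fq Fq[X] K, abv_add_eq_right hv.na,
      abv_algebraMap_eq_one h0]
    rw [abv_algebraMap_eq_one h0, map_mul]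
    exact mul_lt_one_of_nonneg_of_lt_one_right (hle _) (v.nonneg _) hv.T_lt_one
  rw [hd, map_mul, map_mul, hd1, mul_one, map_pow, map_pow] at h
  rw [hd]
  exact (pow_dvd_pow X ((pow_le_pow_iff_right_of_lt_one₀ hv.T_pos hv.T_lt_one).1 h)).mul_right _


omit [Fintype Fq] [IsScalarTower Fq Fq[X] K] [Algebra Fq K] in
lemma coeff_zero_minpoly_eq_prod {F : Type*} [Field F] [Algebra Fq[X] F]
    [IsFractionRing Fq[X] F] [Algebra F K] [IsScalarTower Fq[X] F K] [Normal F K] {z : K}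
    (hz : IsIntegral Fq[X] z) :
    algebraMap Fq[X] K ((minpoly Fq[X] z).coeff 0) =
      (-1) ^ (minpoly F z).natDegree * (((minpoly F z).map (algebraMap F K)).roots).prod := by
  have h1 := minpoly.isIntegrallyClosed_eq_field_fractions' F hz
  have h2 := (Normal.splits (F := F) inferInstance z : ((minpoly F z).map (algebraMap F K)).Splits)
  have hm : (minpoly F z).Monic := minpoly.monic (Normal.isIntegral inferInstance z)
  have h3 := h2.coeff_zero_eq_prod_roots_of_monic (hm.map _)
  rw [natDegree_map] at h3
  rw [← h3, h1, coeff_map, coeff_map, ← IsScalarTower.algebraMap_apply]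

lemma exists_pow_mul_isIntegral (h : IsDrinfeldAction q s (algebraMap Fq[X] K X) φ)
    {a : Fq[X]} (ha : a.Monic) {y : K} (hy : φ a y = 0) :
    ∃ k, IsIntegral Fq[X] (algebraMap Fq[X] K X ^ k * y) := by
  have hQ := h.two_le_pow
  have hq := h.three_le
  set d : Fq[X][X] := drinfeldPoly q s X
  have hdeg : d.natDegree = q ^ s * q := h.natDegree_drinfeldPoly X_ne_zero
  have hd2 : 2 ≤ d.natDegree := by rw [hdeg]; nlinarith
  have hlc : d.leadingCoeff = X ^ (q - 1) := by
    rw [leadingCoeff, hdeg]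
    have h1 : q ^ s * q ≠ 1 := by nlinarith
    have h2 : q ^ s * q ≠ q ^ s := by nlinarith
    simp [d, drinfeldPoly, coeff_X, coeff_C_mul, coeff_X_pow, h1.symm, h2, -map_pow]
  have hiter : ∀ n, ∃ k, (iterPoly d n).leadingCoeff = X ^ k := by
    intro n
    induction n with
    | zero => exact ⟨0, by simp [iterPoly]⟩
    | succ n ih =>
      obtain ⟨k, hk⟩ := ih
      exact ⟨(q - 1) + k * d.natDegree, by
        rw [leadingCoeff_iterPoly_succ d hd2, hlc, hk, pow_add, pow_mul]⟩
  obtain ⟨k, hk⟩ := hiter a.natDegree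
  refine ⟨k, ?_⟩
  have h3 := isIntegral_leadingCoeff_smul (actionPoly d a) y ?_
  · rwa [leadingCoeff_actionPoly d hd2 ha, hk, Algebra.smul_def, map_pow] at h3
  · rw [aeval_def, ← eval_map, actionPoly_map _ (fun c =>
      (IsScalarTower.algebraMap_apply Fq Fq[X] K c).symm), drinfeldPoly_map,
      eval_actionPoly φ h.apply_C h.apply_X_eq_eval, hy]

/-- Every nonzero torsion point has a conjugate which is not integral. -/
theorem IsDrinfeldAction.exists_one_lt_abv {F : Type*} [Field F] [Algebra Fq[X] F]
    [IsFractionRing Fq[X] F] [Algebra F K] [IsScalarTower Fq[X] F K] [Normal F K]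
    (h : IsDrinfeldAction q s (algebraMap Fq[X] K X) φ) {v w : AbsoluteValue K ℝ}
    (hv : IsPlaceAtZero (algebraMap Fq[X] K X) v) (na : ∀ x y, w (x + y) ≤ max (w x) (w y))
    (hw : 1 < w (algebraMap Fq[X] K X)) {a : Fq[X]} (ha : a.Monic) {y : K} (hy : φ a y = 0)
    (hy0 : y ≠ 0) : ∃ σ : K ≃ₐ[F] K, 1 < v (σ y) := by
  by_contra! hcon
  set T := algebraMap Fq[X] K X
  have hTF : T = algebraMap F K (algebraMap Fq[X] F X) := IsScalarTower.algebraMap_apply ..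
  have hT0 : T ≠ 0 := by have := hv.T_pos; rwa [v.pos_iff] at this
  obtain ⟨k, hk⟩ := exists_pow_mul_isIntegral h ha hy
  set z := T ^ k * y
  have hz0 : z ≠ 0 := mul_ne_zero (pow_ne_zero _ hT0) hy0
  have hA : ∀ c, algebraMap Fq K c = algebraMap F K (algebraMap Fq[X] F (C c)) := fun c => by
    rw [← IsScalarTower.algebraMap_apply, ← algebraMap_eq, ← IsScalarTower.algebraMap_apply]
  have htors : ∀ σ : K ≃ₐ[F] K, φ a (σ y) = 0 := by
    intro σ
    refine (ringHom_apply_action φ h.apply_C h.apply_X_eq_eval (σ : K →+* K) (fun c => ?_) ?_ a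
      y).symm.trans (by rw [hy, map_zero])
    · rw [hA]; exact σ.commutes _
    · rw [drinfeldPoly_map]; congr 1; rw [hTF]; exact σ.commutes _
  set c := (minpoly Fq[X] z).coeff 0
  have hc := coeff_zero_minpoly_eq_prod (F := F) hk
  set n := (minpoly F z).natDegree
  set S := ((minpoly F z).map (algebraMap F K)).roots
  have h_int : IsIntegral F z := Normal.isIntegral inferInstance z
  have hn : 0 < n := minpoly.natDegree_pos h_int
  have hS : Multiset.card S = n := by
    rw [← (Normal.splits (F := F) inferInstance z :
        ((minpoly F z).map (algebraMap F K)).Splits).natDegree_eq_card_roots,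
      natDegree_map]
  have hmem : ∀ x ∈ S, ∃ σ : K ≃ₐ[F] K, x = T ^ k * σ y := by
    intro x hx
    have hx' : minpoly F x = minpoly F z := by
      refine (minpoly.eq_of_irreducible_of_monic (minpoly.irreducible h_int) ?_
        (minpoly.monic h_int)).symm
      have := isRoot_of_mem_roots hx
      rwa [IsRoot, eval_map_algebraMap] at this
    obtain ⟨σ, hσ⟩ := (Normal.minpoly_eq_iff_mem_orbit K).1 hx'
    refine ⟨σ, hσ.symm.trans ?_⟩
    have : σ T = T := by rw [hTF]; exact σ.commutes _
    change σ (T ^ k * y) = _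
    rw [map_mul, map_pow, this]
  have habs : ∀ u : AbsoluteValue K ℝ, u (algebraMap Fq[X] K c) = (S.map u).prod := by
    intro u
    rw [hc, map_mul, map_pow, u.map_neg, map_one, one_pow, one_mul, map_multiset_prod]
  have hpos : ∀ u : AbsoluteValue K ℝ, ∀ x ∈ S, 0 < u x := by
    intro u x hx
    obtain ⟨σ, rfl⟩ := hmem x hx
    exact u.pos (mul_ne_zero (pow_ne_zero _ hT0) ((map_ne_zero σ).2 hy0))
  have hc0 : c ≠ 0 := by
    intro h0
    have h1 := habs v
    rw [h0, map_zero, map_zero] at h1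
    refine absurd h1 (ne_of_lt (Multiset.prod_pos fun x hx => ?_))
    obtain ⟨x', hx', rfl⟩ := Multiset.mem_map.1 hx
    exact hpos v x' hx'
  have h1 : v (algebraMap Fq[X] K c) ≤ v T ^ (k * n) := by
    rw [habs, pow_mul, ← hS, ← Multiset.prod_replicate, ← Multiset.map_const']
    refine Multiset.prod_map_le_prod_map₀ _ _ (fun x _ => v.nonneg x) fun x hx => ?_
    obtain ⟨σ, rfl⟩ := hmem x hx
    rw [map_mul, map_pow]
    exact mul_le_of_le_one_right (by positivity) (hcon σ)
  have h2 : w (algebraMap Fq[X] K c) < w T ^ (k * n) := by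
    rw [habs, pow_mul, ← hS, ← Multiset.prod_replicate, ← Multiset.map_const']
    refine Multiset.prod_map_lt_prod_map ?_ _ _ (hpos w) fun x hx => ?_
    · rw [← Multiset.card_pos, hS]; exact hn
    obtain ⟨σ, rfl⟩ := hmem x hx
    rw [map_mul, map_pow]
    exact mul_lt_of_lt_one_right (by positivity) (h.abv_lt_one_of_pole na hw ha.ne_zero (htors σ))
  rw [abv_algebraMap_of_pole na hw hc0] at h2
  have h3 := (pow_lt_pow_iff_right₀ hw).1 h2
  have h4 := natDegree_le_of_dvd (X_pow_dvd_of_abv_le hv hc0 h1) hc0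
  rw [natDegree_X_pow] at h4
  omega

end Orbit

lemma exists_abv_pole {Fq K : Type} [Field Fq] [Field K] [IsAlgClosed K] [Algebra (RatFunc Fq) K]
    [Algebra.IsAlgebraic (RatFunc Fq) K] [Algebra Fq K]
    (hT : Transcendental Fq (algebraMap (RatFunc Fq) K RatFunc.X)) {v : AbsoluteValue K ℝ}
    (hv : IsPlaceAtZero (algebraMap (RatFunc Fq) K RatFunc.X) v) :
    ∃ w : AbsoluteValue K ℝ, (∀ x y, w (x + y) ≤ max (w x) (w y)) ∧
      1 < w (algebraMap (RatFunc Fq) K RatFunc.X) := by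
  obtain ⟨j, hj, -⟩ := exists_ratFunc_hom (algebraMap Fq K) (algebraMap (RatFunc Fq) K RatFunc.X)⁻¹
    fun p hp h0 => hT (IsAlgebraic.inv_iff.1 ⟨p, hp, h0⟩)
  obtain ⟨τ, hτ⟩ := exists_extend (K := K) j
  refine ⟨v.comp τ.injective, fun x y => ?_, ?_⟩
  · change v (τ (x + y)) ≤ max (v (τ x)) (v (τ y))
    rw [map_add]; exact hv.na _ _
  · change 1 < v (τ _)
    rw [hτ, hj, map_inv₀]
    exact (one_lt_inv₀ hv.T_pos).2 hv.T_lt_one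

/-- `K ⊗ A/a`. -/
abbrev TorsionRing (K : Type*) {Fq : Type*} [Field Fq] [Field K] [Algebra Fq K] (a : Fq[X]) :=
  AdjoinRoot (a.map (algebraMap Fq K))

namespace TorsionRing

variable {Fq K : Type*} [Field Fq] [Field K] [Algebra Fq K] (a : Fq[X])

/-- The class of `T` in `A/a ⊆ K ⊗ A/a`. -/
def root : TorsionRing K a := AdjoinRoot.root _

/-- The embedding of `K`. -/
def of : K →+* TorsionRing K a := AdjoinRoot.of _

/-- The endomorphism of `K ⊗ A/a` induced by an endomorphism of `K`. -/
def map (σ : K →ₐ[Fq] K) : TorsionRing K a →ₐ[Fq] TorsionRing K a :=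
  AdjoinRoot.mapAlgHom σ _ _ (by rw [Polynomial.map_map, AlgHom.comp_algebraMap])

variable {a}

@[simp] lemma map_of (σ : K →ₐ[Fq] K) (x : K) : map a σ (of a x) = of a (σ x) :=
  AdjoinRoot.map_of _ _ _ (by rw [Polynomial.map_map, AlgHom.comp_algebraMap]) x

@[simp] lemma map_root (σ : K →ₐ[Fq] K) : map a σ (root a) = root a :=
  AdjoinRoot.map_root _ _ _ (by rw [Polynomial.map_map, AlgHom.comp_algebraMap])

lemma map_aeval (σ : K →ₐ[Fq] K) (b : Fq[X]) :
    map a σ (aeval (root a) b) = aeval (root a) b := by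
  rw [← aeval_algHom_apply, map_root]

@[simp] lemma of_algebraMap (c : Fq) : of a (algebraMap Fq K c) = algebraMap Fq _ c := rfl

lemma smul_eq (c : K) (x : TorsionRing K a) : c • x = of a c * x := by
  rw [Algebra.smul_def]; rfl

variable (ha : a.Monic)
include ha

lemma exists_coords (x : TorsionRing K a) :
    ∃ c : ℕ → K, x = ∑ i ∈ Finset.range a.natDegree, of a (c i) * root a ^ i := by
  have hm := ha.map (algebraMap Fq K)
  refine ⟨(AdjoinRoot.modByMonicHom hm x).coeff, ?_⟩
  conv_lhs => rw [← AdjoinRoot.mk_leftInverse hm x]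
  rcases eq_or_ne a 1 with rfl | h1
  · have : Subsingleton (TorsionRing K (1 : Fq[X])) := by
      refine subsingleton_of_zero_eq_one ?_
      rw [← map_one (AdjoinRoot.mk _), ← map_zero (AdjoinRoot.mk _), eq_comm, AdjoinRoot.mk_eq_mk]
      simp
    exact Subsingleton.elim _ _
  have hlt : (AdjoinRoot.modByMonicHom hm x).natDegree < a.natDegree := by
    obtain ⟨f, rfl⟩ := AdjoinRoot.mk_surjective x
    rw [AdjoinRoot.modByMonicHom_mk, ← ha.natDegree_map (algebraMap Fq K)]
    refine natDegree_modByMonic_lt _ hm fun h => h1 ?_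
    exact map_injective _ (algebraMap Fq K).injective (by rw [h, Polynomial.map_one])
  conv_lhs => rw [(AdjoinRoot.modByMonicHom hm x).as_sum_range_C_mul_X_pow' hlt]
  simp [of, root]

/-- The coefficient of `T^(deg a - 1)`. -/
def topCoeff : TorsionRing K a →ₗ[K] K :=
  (lcoeff K (a.natDegree - 1)).comp (AdjoinRoot.modByMonicHom (ha.map (algebraMap Fq K)))

lemma topCoeff_sum (hd : 0 < a.natDegree) (c : ℕ → K) :
    topCoeff ha (∑ i ∈ Finset.range a.natDegree, of a (c i) * root a ^ i) =
      c (a.natDegree - 1) := by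
  have hm := ha.map (algebraMap Fq K)
  have h1 : ∑ i ∈ Finset.range a.natDegree, of a (c i) * root a ^ i =
      AdjoinRoot.mk _ (∑ i ∈ Finset.range a.natDegree, C (c i) * X ^ i) := by
    simp [of, root]
  rw [h1, topCoeff, LinearMap.comp_apply, AdjoinRoot.modByMonicHom_mk,
    (modByMonic_eq_self_iff hm).2]
  · have h2 : a.natDegree - 1 ∈ Finset.range a.natDegree := Finset.mem_range.2 (by omega)
    simp [lcoeff_apply, coeff_C_mul, coeff_X_pow, h2]
  · rw [degree_eq_natDegree hm.ne_zero, ha.natDegree_map, Finset.sum_range]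
    exact degree_sum_fin_lt _

lemma topCoeff_of_mul (c : K) (x : TorsionRing K a) :
    topCoeff ha (of a c * x) = c * topCoeff ha x := by
  rw [← smul_eq, map_smul, smul_eq_mul]

lemma topCoeff_root_pow {j : ℕ} (hj : j < a.natDegree) :
    topCoeff ha (root a ^ j : TorsionRing K a) = if j = a.natDegree - 1 then 1 else 0 := by
  have h := topCoeff_sum ha (K := K) (by omega) (fun i => if i = j then 1 else 0)
  rw [Finset.sum_eq_single j (fun i _ hi => by simp [hi]) (fun h => by simp_all)] at h
  simp only [if_true, map_one, one_mul] at h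
  rw [h]; simp only [eq_comm]

lemma topCoeff_map (hd : 0 < a.natDegree) (σ : K →ₐ[Fq] K) (x : TorsionRing K a) :
    topCoeff ha (map a σ x) = σ (topCoeff ha x) := by
  obtain ⟨c, rfl⟩ := exists_coords ha x
  rw [map_sum, topCoeff_sum ha hd]
  simp only [map_mul, map_pow, map_of, map_root]
  rw [topCoeff_sum ha hd (fun i => σ (c i))]

lemma eq_zero_of_topCoeff {x : TorsionRing K a}
    (h : ∀ k < a.natDegree, topCoeff ha (root a ^ k * x) = 0) : x = 0 := by
  obtain ⟨c, hc⟩ := exists_coords ha x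
  have hzero : ∀ k < a.natDegree, c (a.natDegree - 1 - k) = 0 := by
    intro k
    induction k using Nat.strong_induction_on with
    | _ k ih =>
      intro hk
      have h1 := h k hk
      rw [hc, Finset.mul_sum, map_sum, Finset.sum_eq_single (a.natDegree - 1 - k)] at h1
      · rw [mul_left_comm, topCoeff_of_mul, ← pow_add, topCoeff_root_pow ha (by omega),
          if_pos (by omega), mul_one] at h1
        exact h1
      · intro i hi hne
        rw [Finset.mem_range] at hi
        rw [mul_left_comm, topCoeff_of_mul, ← pow_add]
        rcases lt_or_ge (k + i) a.natDegree with hlt | hge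
        · rw [topCoeff_root_pow ha hlt, if_neg (by omega), mul_zero]
        · have := ih (a.natDegree - 1 - i) (by omega) (by omega)
          rw [show a.natDegree - 1 - (a.natDegree - 1 - i) = i by omega] at this
          rw [this, zero_mul]
      · intro hn
        exact absurd (Finset.mem_range.2 (by omega)) hn
  rw [hc]
  refine Finset.sum_eq_zero fun i hi => ?_
  rw [Finset.mem_range] at hi
  have := hzero (a.natDegree - 1 - i) (by omega)
  rw [show a.natDegree - 1 - (a.natDegree - 1 - i) = i by omega] at this
  rw [this, map_zero, zero_mul]

omit ha in
lemma aeval_root_eq_zero_iff {b : Fq[X]} :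
    aeval (root a : TorsionRing K a) b = 0 ↔ a ∣ b := by
  have h : aeval (root a : TorsionRing K a) b = AdjoinRoot.mk _ (b.map (algebraMap Fq K)) := by
    rw [← AdjoinRoot.aeval_eq, aeval_map_algebraMap]; rfl
  rw [h, AdjoinRoot.mk_eq_zero, Polynomial.map_dvd_map']

end TorsionRing

lemma coeff_iterate_divX {R : Type*} [Semiring R] (a : R[X]) (i n : ℕ) :
    (divX^[i] a).coeff n = a.coeff (n + i) := by
  induction i generalizing n with
  | zero => rfl
  | succ i ih => rw [Function.iterate_succ_apply', coeff_divX, ih]; congr 1; omega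

lemma iterate_divX_natDegree {R : Type*} [Semiring R] {a : R[X]} (ha : a.Monic) :
    divX^[a.natDegree] a = 1 := by
  ext n
  rw [coeff_iterate_divX, coeff_one]
  split_ifs with h
  · rw [h, zero_add]; exact ha
  · exact coeff_eq_zero_of_natDegree_lt (by omega)

section TorsionVector

variable {Fq K : Type*} [Field Fq] [Field K] [Algebra Fq K]

open TorsionRing

/-- The element of `K ⊗ A/a` representing `b ↦ φ_b(v)` under the residue pairing. -/
def torsionVector (φ : Fq[X] →+* AddMonoid.End K) (a : Fq[X]) (v : K) : TorsionRing K a :=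
  ∑ i ∈ Finset.range a.natDegree, of a (φ (divX^[i + 1] a) v) * root a ^ i

variable {φ : Fq[X] →+* AddMonoid.End K} {a : Fq[X]}

lemma torsionVector_add (v w : K) :
    torsionVector φ a (v + w) = torsionVector φ a v + torsionVector φ a w := by
  simp [torsionVector, add_mul, Finset.sum_add_distrib]

lemma torsionVector_sum {ι : Type*} (s : Finset ι) (f : ι → K) :
    torsionVector φ a (∑ i ∈ s, f i) = ∑ i ∈ s, torsionVector φ a (f i) :=
  map_sum (AddMonoidHom.mk' (torsionVector φ a) torsionVector_add) f s

lemma topCoeff_torsionVector (ha : a.Monic) (hd : 0 < a.natDegree) (v : K) :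
    topCoeff ha (torsionVector φ a v) = v := by
  rw [torsionVector, topCoeff_sum ha hd (fun i => φ (divX^[i + 1] a) v),
    show a.natDegree - 1 + 1 = a.natDegree by omega, iterate_divX_natDegree ha, action_one]

lemma map_torsionVector (σ : K →ₐ[Fq] K) (hσ : ∀ b x, σ (φ b x) = φ b (σ x)) (v : K) :
    map a σ (torsionVector φ a v) = torsionVector φ a (σ v) := by
  simp [torsionVector, hσ]

variable (hC : ∀ (c : Fq) (x : K), φ (C c) x = algebraMap Fq K c * x)
include hC

lemma torsionVector_smul (c : Fq) (v : K) :
    torsionVector φ a (algebraMap Fq K c * v) = of a (algebraMap Fq K c) * torsionVector φ a v := by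
  rw [torsionVector, torsionVector, Finset.mul_sum]
  refine Finset.sum_congr rfl fun i _ => ?_
  rw [← hC, ← action_mul, mul_comm _ (C c), action_mul, hC, map_mul, mul_assoc]

lemma root_mul_torsionVector (ha : a.Monic) {v : K} (hv : φ a v = 0) :
    root a * torsionVector φ a v = torsionVector φ a (φ X v) := by
  have hstep : ∀ i, φ (divX^[i + 1] a) (φ X v) =
      φ (divX^[i] a) v - algebraMap Fq K (a.coeff i) * v := by
    intro i
    have h := (divX^[i] a).divX_mul_X_add
    rw [← Function.iterate_succ_apply' divX, coeff_iterate_divX, zero_add] at h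
    rw [eq_sub_iff_add_eq, ← action_mul, ← hC, ← action_add, h]
  have haroot : ∑ i ∈ Finset.range a.natDegree, of a (algebraMap Fq K (a.coeff i)) * root a ^ i +
      root a ^ a.natDegree = 0 := by
    have h := (aeval_root_eq_zero_iff (K := K)).2 (dvd_refl a)
    rw [aeval_eq_sum_range, Finset.sum_range_succ, ha.coeff_natDegree, one_smul] at h
    simpa [Algebra.smul_def] using h
  have htel : ∑ i ∈ Finset.range a.natDegree, of a (φ (divX^[i] a) v) * root a ^ i +
      of a v * root a ^ a.natDegree = root a * torsionVector φ a v := by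
    have h := Finset.sum_range_succ' (fun i => of a (φ (divX^[i] a) v) * root a ^ i) a.natDegree
    rw [Finset.sum_range_succ, iterate_divX_natDegree ha, action_one] at h
    rw [h, torsionVector, Finset.mul_sum, Function.iterate_zero_apply, hv, map_zero, zero_mul,
      add_zero]
    exact Finset.sum_congr rfl fun i _ => by ring
  rw [← htel, torsionVector]
  simp only [hstep, map_sub, map_mul, sub_mul, Finset.sum_sub_distrib]
  rw [sub_eq_add_neg, add_right_inj, eq_comm, neg_eq_iff_add_eq_zero, ← mul_zero (of a v), ← haroot,
    mul_add, Finset.mul_sum]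
  congr 1
  exact Finset.sum_congr rfl fun i _ => by ring

lemma aeval_root_mul_torsionVector (ha : a.Monic) {v : K} (hv : φ a v = 0) (b : Fq[X]) :
    aeval (root a) b * torsionVector φ a v = torsionVector φ a (φ b v) := by
  have hφ : ∀ b, φ a (φ b v) = 0 := fun b => by
    rw [← action_mul, mul_comm, action_mul, hv, map_zero]
  induction b using Polynomial.induction_on' with
  | add p p' hp hp' => rw [map_add, add_mul, hp, hp', action_add, torsionVector_add]
  | monomial n c =>
    rw [← C_mul_X_pow_eq_monomial, action_mul, hC, torsionVector_smul hC, map_mul, aeval_C,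
      mul_assoc]
    congr 1
    induction n with
    | zero => simp
    | succ n ih =>
      rw [pow_succ', action_mul, ← root_mul_torsionVector hC ha (hφ _), ← ih, map_mul, aeval_X,
        mul_assoc]

end TorsionVector

section Theta

variable {Fq K : Type*} [Field Fq] [Fintype Fq] [Field K] [Algebra Fq K] {q s : ℕ} {T : K}
  {φ : Fq[X] →+* AddMonoid.End K} {a : Fq[X]}

open TorsionRing

variable (a) in
/-- The `n`-th power of the `q`-Frobenius of `K`, extended to `K ⊗ A/a`. -/
def twist (n : ℕ) : TorsionRing K a →ₐ[Fq] TorsionRing K a := map a (frobPow Fq n)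

lemma twist_of (n : ℕ) (x : K) : twist a n (of a x) = of a (x ^ Fintype.card Fq ^ n) := by
  rw [twist, map_of, frobPow_apply]

lemma twist_twist (m n : ℕ) (x : TorsionRing K a) :
    twist a m (twist a n x) = twist a (m + n) x := by
  have h : ((twist a m).comp (twist a n) : TorsionRing K a →ₐ[Fq] TorsionRing K a) =
      twist a (m + n) := by
    refine AlgHom.coe_ringHom_injective (AdjoinRoot.ringHom_ext (RingHom.ext fun x => ?_) ?_)
    · change twist a m (twist a n (of a x)) = twist a (m + n) (of a x)
      rw [twist_of, twist_of, twist_of, ← pow_mul, ← pow_add, add_comm]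
    · change twist a m (twist a n (root a)) = twist a (m + n) (root a)
      simp [twist]
  exact DFunLike.congr_fun h x

lemma twist_zero (x : TorsionRing K a) : twist a 0 x = x := by
  have h : (twist a 0 : TorsionRing K a →ₐ[Fq] TorsionRing K a) = AlgHom.id _ _ := by
    refine AlgHom.coe_ringHom_injective (AdjoinRoot.ringHom_ext (RingHom.ext fun x => ?_) ?_)
    · change twist a 0 (of a x) = of a x
      rw [twist_of, pow_zero, pow_one]
    · change twist a 0 (root a) = root a
      simp [twist]
  exact DFunLike.congr_fun h x

lemma twist_torsionVector (n : ℕ) (v : K) : twist a n (torsionVector φ a v) =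
    ∑ i ∈ Finset.range a.natDegree, of a (φ (divX^[i + 1] a) v ^ Fintype.card Fq ^ n) * root a ^ i := by
  simp [torsionVector, twist, frobPow_apply]

variable (h : IsDrinfeldAction q s T φ)
include h

lemma torsionVector_apply_X (v : K) : torsionVector φ a (φ X v) =
    of a T * torsionVector φ a v + twist a s (torsionVector φ a v) +
      of a T ^ (q - 1) * twist a (s + 1) (torsionVector φ a v) := by
  rw [twist_torsionVector, twist_torsionVector, torsionVector, torsionVector, Finset.mul_sum,
    Finset.mul_sum, ← Finset.sum_add_distrib, ← Finset.sum_add_distrib]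
  refine Finset.sum_congr rfl fun i _ => ?_
  rw [← action_mul, mul_comm _ X, action_mul, h.apply_X, h.card, map_add, map_add, map_mul, map_mul,
    map_pow, pow_succ]
  simp only [map_pow]
  ring

lemma twist_recursion (ha : a.Monic) {v : K} (hv : φ a v = 0) :
    of a T ^ (q - 1) * twist a (s + 1) (torsionVector φ a v) =
      (root a - of a T) * torsionVector φ a v - twist a s (torsionVector φ a v) := by
  have h1 := root_mul_torsionVector h.apply_C ha hv
  rw [torsionVector_apply_X h] at h1
  rw [sub_mul, h1]; ring

/-- The Moore matrix of a family of `a`-torsion points. -/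
def mooreMatrix (φ : Fq[X] →+* AddMonoid.End K) (a : Fq[X]) {r : ℕ} (x : Fin r → K) :
    Matrix (Fin r) (Fin r) (TorsionRing K a) :=
  Matrix.of fun i j => twist a j (torsionVector φ a (x i))

/-- The determinant of the Moore matrix, scaled so as to be Carlitz torsion. -/
def theta (φ : Fq[X] →+* AddMonoid.End K) (T : K) (a : Fq[X]) {r : ℕ} (x : Fin r → K) :
    TorsionRing K a := of a T * (mooreMatrix φ a x).det

lemma twist_theta (hs : Even s) (hT : T ≠ 0) (ha : a.Monic) {x : Fin (s + 1) → K}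
    (hx : ∀ i, φ a (x i) = 0) :
    twist a 1 (theta φ T a x) = (root a - of a T) * theta φ T a x := by
  set U : TorsionRing K a := of a (T ^ (q - 1))⁻¹
  have hU : U * of a T ^ (q - 1) = 1 := by
    rw [← map_pow, ← map_mul, inv_mul_cancel₀ (pow_ne_zero _ hT), map_one]
  let N : Matrix (Fin (s + 1)) (Fin (s + 1)) (TorsionRing K a) := Matrix.of fun k j =>
    Fin.lastCases (motive := fun _ => TorsionRing K a)
      (U * ((if k = 0 then root a - of a T else 0) - if k = Fin.last s then 1 else 0))
      (fun j => if k = j.succ then 1 else 0) j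
  have hmul : (twist a 1).mapMatrix (mooreMatrix φ a x) = mooreMatrix φ a x * N := by
    ext i j
    rw [Matrix.mul_apply]
    change twist a 1 (twist a j (torsionVector φ a (x i))) = _
    rw [twist_twist]
    induction j using Fin.lastCases with
    | last =>
      have h1 := twist_recursion h ha (hx i)
      have h2 : twist a (s + 1) (torsionVector φ a (x i)) =
          U * ((root a - of a T) * torsionVector φ a (x i) - twist a s (torsionVector φ a (x i))) := by
        rw [← h1, ← mul_assoc, hU, one_mul]
      rw [Fin.val_last, add_comm, h2]
      simp only [N, Matrix.of_apply, Fin.lastCases_last, mooreMatrix, mul_sub, mul_ite, mul_zero,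
        mul_one, Finset.sum_sub_distrib, Finset.sum_ite_eq', Finset.mem_univ, if_true]
      simp only [Fin.val_zero, twist_zero, Fin.val_last]
      ring
    | cast j =>
      simp [N, mooreMatrix, add_comm]
  have hdet : N.det = U * (root a - of a T) := by
    rw [Matrix.det_succ_row_zero, Finset.sum_eq_single (Fin.last s)]
    · have hsub : N.submatrix Fin.succ (Fin.last s).succAbove = 1 := by
        ext i j
        simp [N, Matrix.one_apply]
      rw [hsub, Matrix.det_one, Fin.val_last, hs.neg_one_pow]
      have h0 : (0 : Fin (s + 1)) ≠ Fin.last s := by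
        have := h.pos
        simp [Fin.ext_iff]; omega
      simp [N, h0]
    · intro j _ hj
      induction j using Fin.lastCases with
      | last => exact absurd rfl hj
      | cast j => simp [N, (Fin.succ_ne_zero _).symm]
    · simp
  have h3 := congrArg Matrix.det hmul
  rw [← AlgHom.map_det, Matrix.det_mul, hdet] at h3
  rw [theta, map_mul, h3, twist_of, pow_one, h.card, map_pow]
  have h4 : of a T ^ q = of a T ^ (q - 1) * of a T := by
    rw [← pow_succ, Nat.sub_add_cancel (by have := h.three_le; omega)]
  rw [h4]
  linear_combination (of a T * (mooreMatrix φ a x).det * (root a - of a T)) * hU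

end Theta

section MooreIndependence

variable {Fq K : Type*} [Field Fq] [Fintype Fq] [Field K] [Algebra Fq K]

lemma exists_algebraMap_of_pow_card {x : K} (hx : x ^ Fintype.card Fq = x) :
    ∃ c : Fq, algebraMap Fq K c = x := by
  have h := prod_sub_algebraMap (Fq := Fq) x
  rw [hx, sub_self, Finset.prod_eq_zero_iff] at h
  obtain ⟨c, -, hc⟩ := h
  exact ⟨c, (sub_eq_zero.1 hc).symm⟩

lemma sum_pow_card_pow {ι : Type*} (s : Finset ι) (f : ι → K) (n : ℕ) :
    (∑ i ∈ s, f i) ^ Fintype.card Fq ^ n = ∑ i ∈ s, f i ^ Fintype.card Fq ^ n := by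
  simp only [← frobPow_apply (Fq := Fq), map_sum]

/-- Elements independent over `𝔽_q` have `K`-independent vectors of iterated `q`-th powers. -/
theorem eq_zero_of_sum_mul_pow_card_pow {ι : Type*} (s : Finset ι) {w : ι → K}
    (hw : LinearIndepOn Fq w (s : Set ι)) {x : ι → K} {n : ℕ}
    (h : ∀ j ≥ n, ∑ i ∈ s, x i * w i ^ Fintype.card Fq ^ j = 0) : ∀ i ∈ s, x i = 0 := by
  classical
  induction s using Finset.induction_on generalizing x n with
  | empty => simp
  | insert i₀ s hi₀ ih =>
    have hw' : LinearIndepOn Fq w (s : Set ι) := hw.mono (by simp)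
    by_cases hx0 : x i₀ = 0
    · intro i hi
      rcases Finset.mem_insert.1 hi with rfl | hi
      · exact hx0
      · refine ih hw' (n := n) (fun j hj => ?_) i hi
        have := h j hj
        rwa [Finset.sum_insert hi₀, hx0, zero_mul, zero_add] at this
    · exfalso
      set y : ι → K := fun i => x i / x i₀
      have hy0 : y i₀ = 1 := div_self hx0
      have hy : ∀ j ≥ n, ∑ i ∈ insert i₀ s, y i * w i ^ Fintype.card Fq ^ j = 0 := by
        intro j hj
        simp only [y, div_mul_eq_mul_div]
        rw [← Finset.sum_div, h j hj, zero_div]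
      have hfix : ∀ i ∈ s, y i ^ Fintype.card Fq - y i = 0 := by
        refine ih hw' (n := n + 1) fun j hj => ?_
        obtain ⟨j, rfl⟩ : ∃ k, j = k + 1 := ⟨j - 1, by omega⟩
        have h1 := congrArg (· ^ Fintype.card Fq ^ 1) (hy j (by omega))
        simp only [sum_pow_card_pow, mul_pow, ← pow_mul, ← pow_add] at h1
        rw [zero_pow (by simp)] at h1
        have h2 := hy (j + 1) (by omega)
        rw [Finset.sum_insert hi₀, hy0] at h1 h2
        simp only [pow_one, one_pow] at h1
        simp only [sub_mul, Finset.sum_sub_distrib]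
        linear_combination h1 - h2
      have hfix' : ∀ i, ∃ c : Fq, i ∈ insert i₀ s → algebraMap Fq K c = y i := by
        intro i
        by_cases hi : i ∈ insert i₀ s
        · rcases Finset.mem_insert.1 hi with rfl | hi
          · exact ⟨1, fun _ => by rw [map_one, hy0]⟩
          · obtain ⟨c, hc⟩ := exists_algebraMap_of_pow_card (sub_eq_zero.1 (hfix i hi))
            exact ⟨c, fun _ => hc⟩
        · exact ⟨0, fun h => absurd h hi⟩
      choose c hc using hfix'
      have h3 : (∑ i ∈ insert i₀ s, c i • w i) ^ Fintype.card Fq ^ n = 0 := by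
        rw [sum_pow_card_pow, ← hy n le_rfl]
        refine Finset.sum_congr rfl fun i hi => ?_
        rw [Algebra.smul_def, mul_pow, algebraMap_pow_card_pow, hc i hi]
      have h4 := linearIndepOn_finset_iff.1 hw c (pow_eq_zero_iff (by simp) |>.1 h3) i₀ (by simp)
      have h5 := hc i₀ (by simp)
      rw [h4, map_zero, hy0] at h5
      exact zero_ne_one h5

end MooreIndependence

section MooreDet

variable {Fq K : Type*} [Field Fq] [Fintype Fq] [Field K] [Algebra Fq K] {q s : ℕ} {T : K}
  {φ : Fq[X] →+* AddMonoid.End K} {a : Fq[X]}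

open TorsionRing

omit [Fintype Fq] in
lemma linearIndepOn_of_independent {r : ℕ} {x : Fin r → K}
    (hC : ∀ (c : Fq) (x : K), φ (C c) x = algebraMap Fq K c * x) (ha : a.Monic)
    (hx : ∀ f : Fin r → Fq[X], ∑ i, φ (f i) (x i) = 0 → ∀ i, a ∣ f i) :
    LinearIndepOn Fq (fun p : Fin r × ℕ => φ (X ^ p.2) (x p.1))
      (Finset.univ ×ˢ Finset.range a.natDegree : Finset (Fin r × ℕ)) := by
  rw [linearIndepOn_finset_iff]
  intro c hc p hp
  rw [Finset.mem_product, Finset.mem_range] at hp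
  set f : Fin r → Fq[X] := fun i => ∑ k ∈ Finset.range a.natDegree, C (c (i, k)) * X ^ k
  have hf : ∀ i, f i = 0 := by
    intro i
    refine Polynomial.eq_zero_of_dvd_of_degree_lt (hx f ?_ i) ?_
    · rw [← hc, Finset.sum_product]
      refine Finset.sum_congr rfl fun i _ => ?_
      rw [action_sum]
      refine Finset.sum_congr rfl fun k _ => ?_
      rw [action_mul, hC, Algebra.smul_def]
    · rw [degree_eq_natDegree ha.ne_zero]
      simp only [f, Finset.sum_range]
      exact degree_sum_fin_lt _
  have h1 := congrArg (coeff · p.2) (hf p.1)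
  simpa [f, coeff_C_mul, coeff_X_pow, hp.2] using h1

namespace IsDrinfeldAction

variable (h : IsDrinfeldAction q s T φ)
include h

lemma eq_zero_of_vecMul_mooreMatrix (hT : T ≠ 0) (ha : a.Monic) (hd : 0 < a.natDegree)
    {x : Fin (s + 1) → K}
    (hxa : ∀ i, φ a (x i) = 0) (hx : ∀ f : Fin (s + 1) → Fq[X], ∑ i, φ (f i) (x i) = 0 → ∀ i, a ∣ f i)
    {y : Fin (s + 1) → TorsionRing K a} (hy : Matrix.vecMul y (mooreMatrix φ a x) = 0) : y = 0 := by
  have hL : ∀ j, ∑ i, y i * twist a j (torsionVector φ a (x i)) = 0 := by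
    intro j
    induction j using Nat.strong_induction_on with
    | _ j ih =>
      rcases lt_or_ge j (s + 1) with hj | hj
      · exact congrFun hy ⟨j, hj⟩
      · obtain ⟨k, rfl⟩ := Nat.exists_eq_add_of_le' hj
        have hrec : ∀ i, twist a k (of a T ^ (q - 1)) *
            (y i * twist a (k + (s + 1)) (torsionVector φ a (x i))) =
            twist a k (root a - of a T) * (y i * twist a k (torsionVector φ a (x i))) -
              y i * twist a (k + s) (torsionVector φ a (x i)) := by
          intro i
          have h1 := congrArg (twist a k) (twist_recursion h ha (hxa i))
          rw [map_mul, twist_twist, map_sub, map_mul, twist_twist] at h1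
          linear_combination y i * h1
        have h2 := Finset.sum_congr (rfl : (Finset.univ : Finset (Fin (s + 1))) = _) fun i _ => hrec i
        have hpos := h.pos
        rw [Finset.sum_sub_distrib, ← Finset.mul_sum, ← Finset.mul_sum, ih k (by omega),
          ih (k + s) (by omega), mul_zero, sub_zero, map_pow, twist_of, ← map_pow] at h2
        have h3 := congrArg (of a ((T ^ Fintype.card Fq ^ k) ^ (q - 1))⁻¹ * ·) h2
        simp only [← mul_assoc, ← map_mul, mul_zero] at h3
        rwa [inv_mul_cancel₀ (pow_ne_zero _ (pow_ne_zero _ hT)), map_one, one_mul] at h3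
  have hcoords := fun i => exists_coords ha (y i)
  choose c hc using hcoords
  have hX : ∀ k v, φ a v = 0 → φ a (φ (X ^ k) v) = 0 := fun k v hv => by
    rw [← action_mul, mul_comm, action_mul, hv, map_zero]
  have hc0 : ∀ p ∈ (Finset.univ ×ˢ Finset.range a.natDegree : Finset (Fin (s + 1) × ℕ)),
      c p.1 p.2 = 0 := by
    refine eq_zero_of_sum_mul_pow_card_pow _ (linearIndepOn_of_independent h.apply_C ha hx) (n := 0)
      fun j _ => ?_
    have h1 := congrArg (topCoeff ha) (hL j)
    rw [map_zero, map_sum] at h1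
    rw [← h1, Finset.sum_product]
    refine Finset.sum_congr rfl fun i _ => ?_
    conv_rhs => rw [hc i, Finset.sum_mul, map_sum]
    refine Finset.sum_congr rfl fun k _ => ?_
    have h2 : root a ^ k * twist a j (torsionVector φ a (x i)) =
        twist a j (torsionVector φ a (φ (X ^ k) (x i))) := by
      rw [← aeval_root_mul_torsionVector h.apply_C ha (hxa i), map_mul, map_pow, map_pow, aeval_X,
        twist, map_root]
    rw [mul_assoc, topCoeff_of_mul, h2, twist, topCoeff_map ha hd, topCoeff_torsionVector ha hd,
      frobPow_apply]
  funext i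
  rw [hc i, Pi.zero_apply]
  refine Finset.sum_eq_zero fun k hk => ?_
  rw [hc0 (i, k) (by simpa using hk), map_zero, zero_mul]

lemma isUnit_theta (hT : T ≠ 0) (ha : a.Monic) (hd : 0 < a.natDegree)
    {x : Fin (s + 1) → K}
    (hxa : ∀ i, φ a (x i) = 0) (hx : ∀ f : Fin (s + 1) → Fq[X], ∑ i, φ (f i) (x i) = 0 → ∀ i, a ∣ f i) :
    IsUnit (theta φ T a x) := by
  refine IsUnit.mul ((isUnit_iff_ne_zero.2 hT).map (of a)) ?_
  have : Module.Finite K (TorsionRing K a) := (ha.map (algebraMap Fq K)).finite_adjoinRoot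
  let L : (Fin (s + 1) → TorsionRing K a) →ₗ[K] (Fin (s + 1) → TorsionRing K a) :=
    (Matrix.vecMulLinear (mooreMatrix φ a x)).restrictScalars K
  have hL : Function.Injective L := by
    rw [← LinearMap.ker_eq_bot, LinearMap.ker_eq_bot']
    exact fun y hy => h.eq_zero_of_vecMul_mooreMatrix hT ha hd hxa hx hy
  have hsurj : Function.Surjective L := LinearMap.injective_iff_surjective.1 hL
  choose N hN using fun i => hsurj (Pi.single i 1)
  refine Matrix.isUnit_det_of_left_inverse (B := Matrix.of N) ?_
  ext i j
  have := congrFun (hN i) j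
  rw [Matrix.one_apply]
  rw [Pi.single_apply] at this
  simp only [eq_comm (a := i)]
  exact this

end IsDrinfeldAction

end MooreDet

/-- The Carlitz action of `𝔽_q[T]`, in which `T` acts as `x ↦ t x + x^q`. -/
def carlitzAction (Fq : Type*) {S : Type*} [Field Fq] [Fintype Fq] [CommRing S] [Algebra Fq S] (t : S) :
    Fq[X] →+* AddMonoid.End S :=
  (Module.toAddMonoidEnd (Module.End Fq S) S).comp (aeval (LinearMap.mulLeft Fq t +
    (FiniteField.frobeniusAlgHom Fq S).toLinearMap) : Fq[X] →ₐ[Fq] Module.End Fq S).toRingHom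

section Carlitz

variable {Fq S : Type*} [Field Fq] [Fintype Fq] [CommRing S] [Algebra Fq S] (t : S)

lemma carlitzAction_C (c : Fq) (x : S) :
    carlitzAction Fq t (C c) x = algebraMap Fq S c * x := by
  change (aeval _ (C c) : Module.End Fq S) x = _
  rw [aeval_C, ← Algebra.smul_def]; rfl

lemma carlitzAction_X (x : S) : carlitzAction Fq t X x = t * x + x ^ Fintype.card Fq := by
  change (aeval _ X : Module.End Fq S) x = _
  rw [aeval_X]; rfl

/-- The polynomial `t Y + Y^q`. -/
def carlitzPoly (q : ℕ) (t : S) : S[X] := C t * X + X ^ q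

omit [Fintype Fq] [Algebra Fq S] [Field Fq] in
lemma carlitzPoly_map {S' : Type*} [CommRing S'] (q : ℕ) (f : S →+* S') (t : S) :
    (carlitzPoly q t).map f = carlitzPoly q (f t) := by
  simp [carlitzPoly]

lemma carlitzAction_X_eq_eval (x : S) :
    carlitzAction Fq t X x = (carlitzPoly (Fintype.card Fq) t).eval x := by
  rw [carlitzAction_X]; simp [carlitzPoly]

variable (Fq) in
lemma derivative_carlitzPoly : derivative (carlitzPoly (Fintype.card Fq) t) = C t := by
  have h0 : ((Fintype.card Fq : ℕ) : S) = 0 := by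
    rw [← map_natCast (algebraMap Fq S), Nat.cast_card_eq_zero, map_zero]
  simp [carlitzPoly, h0, derivative_X_pow]

lemma monic_carlitzPoly {q : ℕ} (hq : 2 ≤ q) [Nontrivial S] : (carlitzPoly q t).Monic := by
  rw [carlitzPoly, add_comm]
  exact (monic_X_pow q).add_of_left
    ((degree_C_mul_X_le t).trans_lt (by rw [degree_X_pow]; exact_mod_cast (by omega : 1 < q)))

lemma natDegree_carlitzPoly {q : ℕ} (hq : 2 ≤ q) [Nontrivial S] :
    (carlitzPoly q t).natDegree = q := by
  rw [carlitzPoly, natDegree_add_eq_right_of_natDegree_lt, natDegree_X_pow]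
  rw [natDegree_X_pow]
  exact ((natDegree_C_mul_le _ _).trans natDegree_X_le).trans_lt (by omega)

variable (Fq) in
lemma two_le_card : 2 ≤ Fintype.card Fq := Fintype.one_lt_card

lemma monic_carlitz_actionPoly [IsDomain S] [FaithfulSMul Fq S] {b : Fq[X]} (hb : b.Monic) :
    (actionPoly (carlitzPoly (Fintype.card Fq) t) b).Monic := by
  have hq := two_le_card Fq
  have hd : 2 ≤ (carlitzPoly (Fintype.card Fq) t).natDegree := by rwa [natDegree_carlitzPoly t hq]
  rw [Monic, leadingCoeff_actionPoly _ hd hb]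
  induction b.natDegree with
  | zero => simp [iterPoly]
  | succ n ih =>
    rw [leadingCoeff_iterPoly_succ _ hd, (monic_carlitzPoly t hq).leadingCoeff, ih, one_pow, one_mul]

lemma eval_carlitz_actionPoly (b : Fq[X]) (x : S) :
    (actionPoly (carlitzPoly (Fintype.card Fq) t) b).eval x = carlitzAction Fq t b x :=
  eval_actionPoly _ (carlitzAction_C t) (carlitzAction_X_eq_eval t) b x

lemma ringHom_carlitzAction {σ : S →+* S} (hσ : ∀ c, σ (algebraMap Fq S c) = algebraMap Fq S c)
    (ht : σ t = t) (b : Fq[X]) (x : S) :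
    σ (carlitzAction Fq t b x) = carlitzAction Fq t b (σ x) :=
  ringHom_apply_action _ (carlitzAction_C t) (carlitzAction_X_eq_eval t) σ hσ
    (by rw [carlitzPoly_map, ht]) b x

end Carlitz

section Determinant

variable {Fq K : Type*} [Field Fq] [Fintype Fq] [Field K] [Algebra Fq K] {q s : ℕ} {T : K}
  {φ : Fq[X] →+* AddMonoid.End K} {a : Fq[X]}

open TorsionRing

lemma map_twist (σ : K →ₐ[Fq] K) (n : ℕ) (x : TorsionRing K a) :
    map a σ (twist a n x) = twist a n (map a σ x) := by
  have h : ((map a σ).comp (twist a n) : TorsionRing K a →ₐ[Fq] TorsionRing K a) =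
      (twist a n).comp (map a σ) := by
    refine AlgHom.coe_ringHom_injective (AdjoinRoot.ringHom_ext (RingHom.ext fun x => ?_) ?_)
    · change map a σ (twist a n (of a x)) = twist a n (map a σ (of a x))
      rw [twist_of, map_of, map_of, twist_of, map_pow]
    · change map a σ (twist a n (root a)) = twist a n (map a σ (root a))
      simp [twist]
  exact DFunLike.congr_fun h x

lemma map_theta (hC : ∀ (c : Fq) (x : K), φ (C c) x = algebraMap Fq K c * x) (ha : a.Monic)
    {σ : K →ₐ[Fq] K} (hσT : σ T = T) (hσ : ∀ b x, σ (φ b x) = φ b (σ x)) {r : ℕ} {x : Fin r → K}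
    (hx : ∀ i, φ a (x i) = 0) {g : Matrix (Fin r) (Fin r) Fq[X]}
    (hg : ∀ i, σ (x i) = ∑ j, φ (g i j) (x j)) :
    map a σ (theta φ T a x) = aeval (root a) g.det * theta φ T a x := by
  have h1 : (map a σ).mapMatrix (mooreMatrix φ a x) =
      (aeval (root a : TorsionRing K a)).mapMatrix g * mooreMatrix φ a x := by
    ext i j
    rw [Matrix.mul_apply]
    change map a σ (twist a j (torsionVector φ a (x i))) =
      ∑ k, aeval (root a) (g i k) * twist a j (torsionVector φ a (x k))
    rw [map_twist, map_torsionVector σ hσ, hg, torsionVector_sum, map_sum]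
    refine Finset.sum_congr rfl fun k _ => ?_
    rw [← aeval_root_mul_torsionVector hC ha (hx k), map_mul, twist, map_aeval]
  rw [theta, map_mul, map_of, hσT, AlgHom.map_det, h1, Matrix.det_mul, ← AlgHom.map_det]
  ring

/-- The Carlitz torsion point attached to a family of `a`-torsion points. -/
def carlitzPoint (φ : Fq[X] →+* AddMonoid.End K) (T : K) (ha : a.Monic) {r : ℕ} (x : Fin r → K) : K :=
  topCoeff ha (theta φ T a x)

lemma carlitzAction_topCoeff (ha : a.Monic) (hd : 0 < a.natDegree) {θ : TorsionRing K a}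
    (hθ : twist a 1 θ = (root a - of a T) * θ) (b : Fq[X]) :
    carlitzAction Fq T b (topCoeff ha θ) = topCoeff ha (aeval (root a) b * θ) := by
  have hX : ∀ n, carlitzAction Fq T (X ^ n) (topCoeff ha θ) = topCoeff ha (root a ^ n * θ) := by
    intro n
    induction n with
    | zero => rw [pow_zero, pow_zero, one_mul, action_one]
    | succ n ih =>
      rw [pow_succ', action_mul, ih, carlitzAction_X]
      have h1 : topCoeff ha (root a ^ n * θ) ^ Fintype.card Fq =
          topCoeff ha (root a ^ n * ((root a - of a T) * θ)) := by
        rw [← hθ, ← pow_one (Fintype.card Fq), ← frobPow_apply, ← topCoeff_map ha hd, map_mul,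
          map_pow, map_root]; rfl
      rw [h1, ← topCoeff_of_mul, ← map_add]
      congr 1; ring
  induction b using Polynomial.induction_on' with
  | add p p' hp hp' => rw [action_add, hp, hp', map_add, add_mul, map_add]
  | monomial n c =>
    rw [← C_mul_X_pow_eq_monomial, action_mul, carlitzAction_C, hX,
      map_mul (aeval (root a : TorsionRing K a)) (C c), aeval_C, map_pow, aeval_X, ← topCoeff_of_mul,
      of_algebraMap, mul_assoc]

lemma IsDrinfeldAction.carlitzAction_carlitzPoint (h : IsDrinfeldAction q s T φ) (hs : Even s)
    (hT : T ≠ 0) (ha : a.Monic) (hd : 0 < a.natDegree) {x : Fin (s + 1) → K}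
    (hx : ∀ i, φ a (x i) = 0) : carlitzAction Fq T a (carlitzPoint φ T ha x) = 0 := by
  rw [carlitzPoint, carlitzAction_topCoeff ha hd (twist_theta h hs hT ha hx),
    aeval_root_eq_zero_iff.2 dvd_rfl, zero_mul, map_zero]

/-- The determinant of the action on `a`-torsion is determined by the action on a Carlitz torsion
point. -/
theorem IsDrinfeldAction.dvd_det_sub (h : IsDrinfeldAction q s T φ) (hs : Even s)
    (hT : T ≠ 0) (ha : a.Monic) (hd : 0 < a.natDegree) {x : Fin (s + 1) → K}
    (hxa : ∀ i, φ a (x i) = 0)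
    (hx : ∀ f : Fin (s + 1) → Fq[X], ∑ i, φ (f i) (x i) = 0 → ∀ i, a ∣ f i)
    {σ : K →ₐ[Fq] K} (hσT : σ T = T) {u : Fq[X]}
    (hσu : σ (carlitzPoint φ T ha x) = carlitzAction Fq T u (carlitzPoint φ T ha x))
    {g : Matrix (Fin (s + 1)) (Fin (s + 1)) Fq[X]}
    (hg : ∀ i, σ (x i) = ∑ j, φ (g i j) (x j)) : a ∣ g.det - u := by
  have hσ : ∀ b x, σ (φ b x) = φ b (σ x) := fun b x =>
    ringHom_apply_action φ h.apply_C h.apply_X_eq_eval (σ : K →+* K) (fun c => σ.commutes c)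
      (by rw [drinfeldPoly_map]; congr 1) b x
  have hθ := twist_theta h hs hT ha hxa
  have hC := carlitzAction_topCoeff ha hd hθ
  have h1 : map a σ (theta φ T a x) = aeval (root a) u * theta φ T a x := by
    rw [← sub_eq_zero]
    refine eq_zero_of_topCoeff ha fun k _ => ?_
    have h2 : (root a : TorsionRing K a) ^ k = aeval (root a) (X ^ k : Fq[X]) := by simp
    have h3 : topCoeff ha (root a ^ k * map a σ (theta φ T a x)) =
        topCoeff ha (root a ^ k * (aeval (root a) u * theta φ T a x)) := by
      rw [h2, ← mul_assoc, ← map_mul, ← hC, action_mul, ← carlitzPoint, ← hσu, ← map_aeval σ,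
        ← map_mul, topCoeff_map ha hd, ← hC]
      exact ringHom_carlitzAction T (σ := (σ : K →+* K)) (fun c => σ.commutes c) hσT _ _
    rw [mul_sub, map_sub, h3, sub_self]
  rw [map_theta h.apply_C ha hσT hσ hxa hg] at h1
  rw [← aeval_root_eq_zero_iff (K := K), map_sub, sub_eq_zero]
  exact (h.isUnit_theta hT ha hd hxa hx).mul_right_cancel h1

end Determinant

section Frobenius

variable {Fq : Type*} [Field Fq] [Fintype Fq]

/-- Modulo a prime `P`, the Carlitz action of `P` is the Frobenius. -/
lemma carlitz_actionPoly_eq_X_pow {k : Type*} [Field k] [Algebra Fq k] {t : k} {P : Fq[X]}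
    (hP : P.Monic) (hPi : Irreducible P) (ht : aeval t P = 0) :
    actionPoly (carlitzPoly (Fintype.card Fq) t) P = X ^ Fintype.card Fq ^ P.natDegree := by
  classical
  set g := actionPoly (carlitzPoly (Fintype.card Fq) t) P with hg
  have hq := two_le_card Fq
  have hgm : g.Monic := monic_carlitz_actionPoly t hP
  have hgd : g.natDegree = Fintype.card Fq ^ P.natDegree := by
    rw [hg, natDegree_actionPoly _ (by rwa [natDegree_carlitzPoly t hq]) hP.ne_zero,
      natDegree_carlitzPoly t hq]
  have hgder : derivative g = 0 := by
    rw [hg, derivative_actionPoly (derivative_carlitzPoly Fq t), ht, C_0]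
  let L := AlgebraicClosure k
  let t' : L := algebraMap k L t
  have hg' : g.map (algebraMap k L) = actionPoly (carlitzPoly (Fintype.card Fq) t') P := by
    rw [hg, actionPoly_map _ (fun c => (IsScalarTower.algebraMap_apply Fq k L c).symm),
      carlitzPoly_map]
  have hgm' := hgm.map (algebraMap k L)
  have hgd' : (g.map (algebraMap k L)).natDegree = Fintype.card Fq ^ P.natDegree := by
    rw [hgm.natDegree_map, hgd]
  have heval : ∀ x : L, (g.map (algebraMap k L)).eval x = carlitzAction Fq t' P x := fun x => by
    rw [hg', eval_carlitz_actionPoly]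
  have hroot : ∀ x : L, carlitzAction Fq t' P x = 0 → x = 0 := by
    intro x hx
    by_contra hx0
    have hinj : Set.InjOn (fun f : Fq[X] => carlitzAction Fq t' f x)
        {f : Fq[X] | f ∈ degreeLT Fq P.natDegree} := by
      intro f hf f' hf' hff
      by_contra hne
      have hsub : carlitzAction Fq t' (f - f') x = 0 := by
        rw [action_sub]; exact sub_eq_zero.2 hff
      have hlt : (f - f').degree < P.degree := by
        rw [degree_eq_natDegree hP.ne_zero]
        exact mem_degreeLT.1 (Submodule.sub_mem _ hf hf')
      have hcop : IsCoprime P (f - f') := by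
        refine (hPi.coprime_iff_not_dvd).2 fun hdvd => ?_
        exact (not_le_of_gt hlt) (degree_le_of_dvd hdvd (sub_ne_zero.2 hne))
      obtain ⟨a, b, hab⟩ := hcop
      have h1 : carlitzAction Fq t' (a * P + b * (f - f')) x = 0 := by
        rw [action_add, action_mul, action_mul, hx, hsub, map_zero, map_zero, add_zero]
      rw [hab, action_one] at h1
      exact hx0 h1
    have hmaps : (fun f : Fq[X] => carlitzAction Fq t' f x) ''
        {f : Fq[X] | f ∈ degreeLT Fq P.natDegree} ⊆
          ((g.map (algebraMap k L)).roots.toFinset : Set L) := by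
      rintro _ ⟨f, -, rfl⟩
      simp only [Finset.mem_coe, Multiset.mem_toFinset]
      rw [mem_roots hgm'.ne_zero, IsRoot, heval, ← action_mul, mul_comm, action_mul, hx, map_zero]
    have hcard := Set.ncard_le_ncard hmaps (Finset.finite_toSet _)
    rw [hinj.ncard_image, ncard_degreeLT, Set.ncard_coe_finset, ← hgd'] at hcard
    have hnodup : (g.map (algebraMap k L)).roots.Nodup := by
      rw [← Multiset.toFinset_card_eq_card_iff_nodup]
      exact le_antisymm (Multiset.toFinset_card_le _) ((card_roots' _).trans hcard)
    rw [nodup_roots_iff_of_splits hgm'.ne_zero (IsAlgClosed.splits _), separable_def,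
      derivative_map, hgder, Polynomial.map_zero, isCoprime_zero_right] at hnodup
    have := natDegree_eq_zero_of_isUnit hnodup
    rw [hgd'] at this
    exact (pow_pos (by omega : 0 < Fintype.card Fq) _).ne' this
  refine map_injective _ (algebraMap k L).injective ?_
  have hsp : (g.map (algebraMap k L)).Splits := IsAlgClosed.splits _
  have hrep : (g.map (algebraMap k L)).roots =
      Multiset.replicate (Fintype.card Fq ^ P.natDegree) 0 := by
    refine Multiset.eq_replicate.2 ⟨?_, fun x hx => hroot x ?_⟩
    · rw [← hgd', splits_iff_card_roots.1 hsp]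
    · rw [← heval]; exact (mem_roots'.1 hx).2
  rw [hsp.eq_prod_roots_of_monic hgm', hrep]
  simp

variable {F K : Type*} [Field F] [Field K] [Algebra Fq K] [Algebra Fq[X] F]
  [IsFractionRing Fq[X] F] [Algebra Fq[X] K] [Algebra F K] [IsScalarTower Fq Fq[X] K]
  [IsScalarTower Fq[X] F K] [Normal F K]

variable (F) in
lemma exists_algEquiv_eq_carlitzAction_of_irreducible {a P : Fq[X]} (ha : a.Monic) (hP : P.Monic)
    (hPi : Irreducible P) (hPa : ¬ P ∣ a) {y : K}
    (hy : carlitzAction Fq (algebraMap Fq[X] K X) a y = 0) :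
    ∃ σ : K ≃ₐ[F] K, σ y = carlitzAction Fq (algebraMap Fq[X] K X) P y := by
  have hAK : Function.Injective (algebraMap Fq[X] K) := by
    rw [IsScalarTower.algebraMap_eq Fq[X] F K]
    exact (algebraMap F K).injective.comp (IsFractionRing.injective Fq[X] F)
  have : FaithfulSMul Fq[X] K := (faithfulSMul_iff_algebraMap_injective _ _).2 hAK
  set T := algebraMap Fq[X] K X with hT
  set q := Fintype.card Fq with hqdef
  have hmap : ∀ b : Fq[X], (actionPoly (carlitzPoly q (X : Fq[X])) b).map (algebraMap Fq[X] K) =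
      actionPoly (carlitzPoly q T) b := fun b => by
    rw [actionPoly_map _ (fun c => (IsScalarTower.algebraMap_apply Fq Fq[X] K c).symm),
      carlitzPoly_map]
  have haeval : ∀ (b : Fq[X]) (x : K), aeval x (actionPoly (carlitzPoly q (X : Fq[X])) b) =
      carlitzAction Fq T b x := fun b x => by
    rw [← eval_map_algebraMap, hmap, eval_carlitz_actionPoly]
  have h_int : ∀ x : K, carlitzAction Fq T a x = 0 → IsIntegral Fq[X] x := fun x hx =>
    ⟨_, monic_carlitz_actionPoly (X : Fq[X]) ha, by rw [← aeval_def, haeval, hx]⟩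
  have hμ0 : carlitzAction Fq T a (carlitzAction Fq T P y) = 0 := by
    rw [← action_mul, mul_comm, action_mul, hy, map_zero]
  have hyi := h_int y hy
  set f := minpoly Fq[X] y with hf
  have hfm : f.Monic := minpoly.monic hyi
  obtain ⟨g, hg⟩ := minpoly.isIntegrallyClosed_dvd hyi (p := actionPoly (carlitzPoly q (X : Fq[X])) a)
    (by rw [haeval, hy])
  rw [← hf] at hg
  have key : aeval (carlitzAction Fq T P y) f = 0 := by
    by_contra hne
    have hgμ : aeval (carlitzAction Fq T P y) g = 0 := by
      have h1 := haeval a (carlitzAction Fq T P y)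
      rw [hμ0, hg, map_mul] at h1
      exact (mul_eq_zero.1 h1).resolve_left hne
    obtain ⟨h, hh⟩ := minpoly.isIntegrallyClosed_dvd hyi
      (p := g.comp (actionPoly (carlitzPoly q (X : Fq[X])) P))
      (by rw [aeval_comp, haeval, hgμ])
    rw [← hf] at hh
    have : Fact (Irreducible P) := ⟨hPi⟩
    let k := AdjoinRoot P
    let π : Fq[X] →+* k := AdjoinRoot.mk P
    let t : k := AdjoinRoot.root P
    have hπ : ∀ b, π b = aeval t b := fun b => (AdjoinRoot.aeval_eq b).symm
    have hmapk : ∀ b : Fq[X], (actionPoly (carlitzPoly q (X : Fq[X])) b).map π =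
        actionPoly (carlitzPoly q t) b := fun b => by
      rw [actionPoly_map (S' := k) π (fun c => rfl), carlitzPoly_map]
      rfl
    have hfin : Module.Finite Fq k := (AdjoinRoot.powerBasis hP.ne_zero).finite
    have : Finite k := Module.finite_of_finite Fq
    have : Fintype k := Fintype.ofFinite k
    have hcard : Fintype.card k = q ^ P.natDegree := by
      rw [← Nat.card_eq_fintype_card, Module.natCard_eq_pow_finrank (K := Fq),
        (AdjoinRoot.powerBasis hP.ne_zero).finrank, AdjoinRoot.powerBasis_dim,
        Nat.card_eq_fintype_card]
    have hdiv : f.map π ∣ g.map π ^ (q ^ P.natDegree) := by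
      rw [← hcard, ← FiniteField.expand_card, expand_eq_comp_X_pow, hcard,
        ← carlitz_actionPoly_eq_X_pow hP hPi (t := t) (by rw [← hπ]; exact AdjoinRoot.mk_self),
        ← hmapk, ← Polynomial.map_comp, hh, Polynomial.map_mul]
      exact dvd_mul_right _ _
    have hsep : (f.map π * g.map π).Separable := by
      rw [← Polynomial.map_mul, ← hg, hmapk]
      refine actionPoly_separable (derivative_carlitzPoly Fq t) ?_
      rw [← hπ]
      exact fun h0 => hPa (AdjoinRoot.mk_eq_zero.1 h0)
    have hunit : IsUnit (f.map π) :=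
      (hsep.isCoprime.pow_right (n := q ^ P.natDegree)).isUnit_of_dvd' dvd_rfl hdiv
    have hdeg := natDegree_eq_zero_of_isUnit hunit
    rw [hfm.natDegree_map] at hdeg
    exact (minpoly.natDegree_pos hyi).ne' hdeg
  have hFy : minpoly F y = f.map (algebraMap Fq[X] F) :=
    minpoly.isIntegrallyClosed_eq_field_fractions' F hyi
  have heq : minpoly F (carlitzAction Fq T P y) = minpoly F y := by
    refine (minpoly.eq_of_irreducible_of_monic ?_ ?_ ?_).symm
    · exact minpoly.irreducible (hyi.tower_top)
    · rw [hFy, aeval_map_algebraMap, key]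
    · exact minpoly.monic hyi.tower_top
  exact (Normal.minpoly_eq_iff_mem_orbit K).1 heq

variable (F) in
/-- Every class prime to `a` is realised by an automorphism on the Carlitz `a`-torsion. -/
theorem exists_algEquiv_eq_carlitzAction {a u : Fq[X]} (ha : a.Monic) (hu : u.Monic)
    (hau : IsCoprime u a) {y : K} (hy : carlitzAction Fq (algebraMap Fq[X] K X) a y = 0) :
    ∃ σ : K ≃ₐ[F] K, σ y = carlitzAction Fq (algebraMap Fq[X] K X) u y := by
  induction hn : u.natDegree using Nat.strong_induction_on generalizing u with
  | _ n ih =>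
  by_cases hu1 : IsUnit u
  · exact ⟨1, by rw [hu.eq_one_of_isUnit hu1, action_one]; rfl⟩
  obtain ⟨P, hP, hPi, u', rfl⟩ := exists_monic_irreducible_factor u hu1
  have hu' : u'.Monic := hP.of_mul_monic_left hu
  have hlt : u'.natDegree < n := by
    rw [← hn, hP.natDegree_mul hu']
    have := hPi.natDegree_pos
    omega
  obtain ⟨σ, hσ⟩ := ih _ hlt hu' hau.of_mul_left_right rfl
  obtain ⟨τ, hτ⟩ := exists_algEquiv_eq_carlitzAction_of_irreducible F ha hP hPi
    (hPi.coprime_iff_not_dvd.1 hau.of_mul_left_left) hy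
  have hτX : τ (algebraMap Fq[X] K X) = algebraMap Fq[X] K X := by
    rw [IsScalarTower.algebraMap_apply Fq[X] F K, τ.commutes]
  have hτC : ∀ c, τ (algebraMap Fq K c) = algebraMap Fq K c := fun c => by
    rw [IsScalarTower.algebraMap_apply Fq Fq[X] K, IsScalarTower.algebraMap_apply Fq[X] F K,
      τ.commutes]
  refine ⟨τ * σ, ?_⟩
  rw [AlgEquiv.mul_apply, hσ, mul_comm P u', action_mul, ← hτ]
  exact ringHom_carlitzAction (algebraMap Fq[X] K X) (σ := (τ : K →+* K)) hτC hτX u' y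

end Frobenius

section DeterminantImage

variable {Fq F K : Type*} [Field Fq] [Fintype Fq] [Field F] [Field K] [Algebra Fq K]
  [Algebra Fq[X] F] [IsFractionRing Fq[X] F] [Algebra Fq[X] K] [Algebra F K]
  [IsScalarTower Fq Fq[X] K] [IsScalarTower Fq[X] F K] [Normal F K] {q s : ℕ}
  {φ : Fq[X] →+* AddMonoid.End K}

omit [Fintype Fq] in
lemma exists_monic_congr {a₁ a₂ : Fq[X]} (ha₁ : a₁.Monic) (ha₂ : a₂.Monic) (hd : 0 < a₁.natDegree)
    (hc : IsCoprime a₁ a₂) (d₁ d₂ : Fq[X]) : ∃ u : Fq[X], u.Monic ∧ a₁ ∣ u - d₁ ∧ a₂ ∣ u - d₂ := by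
  obtain ⟨e₁, h₁, h₂⟩ := exists_idempotent hc
  obtain ⟨e₂, h₃, h₄⟩ := exists_idempotent hc.symm
  set m := (d₁ * e₁ + d₂ * e₂) %ₘ (a₁ * a₂) with hm
  have hmon := ha₁.mul ha₂
  have hne : a₁ * a₂ ≠ 1 := fun h1 => by
    have := ha₁.natDegree_mul ha₂
    rw [h1, natDegree_one] at this
    omega
  have hlt : m.degree < (a₁ * a₂).degree := degree_modByMonic_lt _ hmon
  have hdvd : a₁ * a₂ ∣ a₁ * a₂ + m - (d₁ * e₁ + d₂ * e₂) := by
    have := modByMonic_add_div (d₁ * e₁ + d₂ * e₂) (a₁ * a₂)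
    refine ⟨1 - (d₁ * e₁ + d₂ * e₂) /ₘ (a₁ * a₂), ?_⟩
    rw [← hm] at this
    linear_combination this
  refine ⟨a₁ * a₂ + m, hmon.add_of_left hlt, ?_, ?_⟩
  · have : a₁ * a₂ + m - d₁ = (a₁ * a₂ + m - (d₁ * e₁ + d₂ * e₂)) + d₁ * (e₁ - 1) + d₂ * e₂ := by ring
    rw [this]
    exact dvd_add (dvd_add ((Dvd.intro _ rfl).trans hdvd) (h₁.mul_left _)) (h₄.mul_left _)
  · have : a₁ * a₂ + m - d₂ = (a₁ * a₂ + m - (d₁ * e₁ + d₂ * e₂)) + d₂ * (e₂ - 1) + d₁ * e₁ := by ring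
    rw [this]
    exact dvd_add (dvd_add ((Dvd.intro_left _ rfl).trans hdvd) (h₃.mul_left _)) (h₂.mul_left _)

variable (F) in
/-- The determinants of the Galois action on `φ[a₁]` and `φ[a₂]` are independent. -/
theorem IsDrinfeldAction.exists_dvd_det_sub
    (h : IsDrinfeldAction q s (algebraMap Fq[X] K X) φ) (hs : Even s) {a₁ a₂ : Fq[X]}
    (ha₁ : a₁.Monic) (ha₂ : a₂.Monic) (hd₁ : 0 < a₁.natDegree) (hd₂ : 0 < a₂.natDegree)
    (hc : IsCoprime a₁ a₂) {x₁ x₂ : Fin (s + 1) → K}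
    (hx₁ : ∀ i, φ a₁ (x₁ i) = 0) (hx₂ : ∀ i, φ a₂ (x₂ i) = 0)
    (hi₁ : ∀ f : Fin (s + 1) → Fq[X], ∑ i, φ (f i) (x₁ i) = 0 → ∀ i, a₁ ∣ f i)
    (hi₂ : ∀ f : Fin (s + 1) → Fq[X], ∑ i, φ (f i) (x₂ i) = 0 → ∀ i, a₂ ∣ f i)
    {d₁ d₂ : Fq[X]} (hda₁ : IsCoprime d₁ a₁) (hda₂ : IsCoprime d₂ a₂) :
    ∃ σ : K ≃ₐ[F] K,
      (∀ g : Matrix (Fin (s + 1)) (Fin (s + 1)) Fq[X],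
        (∀ i, σ (x₁ i) = ∑ j, φ (g i j) (x₁ j)) → a₁ ∣ g.det - d₁) ∧
      (∀ g : Matrix (Fin (s + 1)) (Fin (s + 1)) Fq[X],
        (∀ i, σ (x₂ i) = ∑ j, φ (g i j) (x₂ j)) → a₂ ∣ g.det - d₂) := by
  have hT : algebraMap Fq[X] K X ≠ 0 := by
    rw [IsScalarTower.algebraMap_apply Fq[X] F K]
    simp
  obtain ⟨u, hu, hu₁, hu₂⟩ := exists_monic_congr ha₁ ha₂ hd₁ hc d₁ d₂
  have hcop : ∀ {a d : Fq[X]}, IsCoprime d a → a ∣ u - d → IsCoprime u a := by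
    rintro a d hda ⟨c, hc⟩
    obtain rfl : u = d + a * c := by linear_combination hc
    exact hda.add_mul_left_left c
  obtain ⟨e₁, h₁, h₂⟩ := exists_idempotent hc
  obtain ⟨e₂, h₃, h₄⟩ := exists_idempotent hc.symm
  have hp₁ := h.carlitzAction_carlitzPoint hs hT ha₁ hd₁ hx₁
  have hp₂ := h.carlitzAction_carlitzPoint hs hT ha₂ hd₂ hx₂
  obtain ⟨σ, hσ⟩ := exists_algEquiv_eq_carlitzAction F (ha₁.mul ha₂) hu
    ((hcop hda₁ hu₁).mul_right (hcop hda₂ hu₂))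
    (y := carlitzPoint φ _ ha₁ x₁ + carlitzPoint φ _ ha₂ x₂) (by
      rw [map_add, action_eq_zero_of_dvd (Dvd.intro _ rfl) hp₁,
        action_eq_zero_of_dvd (Dvd.intro_left _ rfl) hp₂, add_zero])
  have hσX : σ (algebraMap Fq[X] K X) = algebraMap Fq[X] K X := by
    rw [IsScalarTower.algebraMap_apply Fq[X] F K, σ.commutes]
  have hσC : ∀ c, σ (algebraMap Fq K c) = algebraMap Fq K c := fun c => by
    rw [IsScalarTower.algebraMap_apply Fq Fq[X] K, IsScalarTower.algebraMap_apply Fq[X] F K,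
      σ.commutes]
  let σ' : K →ₐ[Fq] K := { (σ : K →+* K) with commutes' := hσC }
  have hcomm := ringHom_carlitzAction (algebraMap Fq[X] K X) (σ := (σ : K →+* K)) hσC hσX
  have hproj : ∀ (e : Fq[X]) (z z' : K), carlitzAction Fq (algebraMap Fq[X] K X) (e - 1) z = 0 →
      carlitzAction Fq (algebraMap Fq[X] K X) e z' = 0 →
      σ (z + z') = carlitzAction Fq (algebraMap Fq[X] K X) u (z + z') →
      σ z = carlitzAction Fq (algebraMap Fq[X] K X) u z := by
    intro e z z' hz hz' hzz
    rw [action_sub, action_one, sub_eq_zero] at hz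
    have h5 : carlitzAction Fq (algebraMap Fq[X] K X) e (z + z') = z := by
      rw [map_add, hz, hz', add_zero]
    have h6 := hcomm e (z + z')
    rw [h5] at h6
    refine h6.trans ?_
    change carlitzAction Fq _ e (σ (z + z')) = _
    rw [hzz, ← action_mul, mul_comm, action_mul, h5]
  refine ⟨σ, fun g hg => ?_, fun g hg => ?_⟩
  · have h5 := h.dvd_det_sub hs hT ha₁ hd₁ hx₁ hi₁ (σ := σ') hσX
      (hproj e₁ _ _ (action_eq_zero_of_dvd h₁ hp₁) (action_eq_zero_of_dvd h₂ hp₂) hσ) hg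
    simpa using dvd_add h5 hu₁
  · rw [add_comm] at hσ
    have h5 := h.dvd_det_sub hs hT ha₂ hd₂ hx₂ hi₂ (σ := σ') hσX
      (hproj e₂ _ _ (action_eq_zero_of_dvd h₃ hp₂) (action_eq_zero_of_dvd h₄ hp₁) hσ) hg
    simpa using dvd_add h5 hu₂

end DeterminantImage

section TransvectionBasis

variable {Fq M G : Type*} [Field Fq] [Fintype Fq] [AddCommGroup M] [Group G] [DistribMulAction G M]
  {φ : Fq[X] →+* AddMonoid.End M}

omit [Fintype Fq] in
lemma eq_zero_of_isCoprime_of_mem {l f : Fq[X]} (hl : Irreducible l) (hlf : ¬ l ∣ f) {I : AddSubgroup M}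
    (hI : ∀ f, ∀ y ∈ I, φ f y ∈ I) {y : M} (hy : φ l y = 0) (hfy : φ f y ∈ I) : y ∈ I := by
  obtain ⟨a, b, hab⟩ := hl.coprime_iff_not_dvd.2 hlf
  have h1 : φ (a * l + b * f) y = y := by rw [hab, action_one]
  rw [action_add, action_mul, action_mul, hy, map_zero, zero_add] at h1
  exact h1 ▸ hI b _ hfy

/-- Finitely many conjugates of the functional defining `I` separate the points of `H`. -/
lemma exists_separating {l : Fq[X]} (hl : Irreducible l) {I : AddSubgroup M}
    (hI : ∀ f, ∀ y ∈ I, φ f y ∈ I) (hG : ∀ (σ : G) f y, σ • φ f y = φ f (σ • y))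
    (hirr : ∀ y : M, φ l y = 0 → y ≠ 0 → ∃ σ : G, σ • y ∉ I) (n : ℕ) :
    ∀ H : AddSubgroup M, (∀ y ∈ H, φ l y = 0) → (∀ f, ∀ y ∈ H, φ f y ∈ H) → (H : Set M).Finite →
      (H : Set M).ncard ≤ (Fintype.card Fq ^ l.natDegree) ^ n →
      ∃ σ : Fin n → G, ∀ y ∈ H, (∀ i, σ i • y ∈ I) → y = 0 := by
  induction n with
  | zero =>
    intro H _ _ hfin hcard
    refine ⟨Fin.elim0, fun y hy _ => ?_⟩
    exact Set.ncard_le_one hfin |>.1 (by simpa using hcard) _ hy _ H.zero_mem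
  | succ n ih =>
    intro H hHl hHφ hfin hcard
    by_cases hH : ∀ y ∈ H, y = 0
    · exact ⟨fun _ => 1, fun y hy _ => hH y hy⟩
    push Not at hH
    obtain ⟨y, hyH, hy0⟩ := hH
    obtain ⟨σ, hσ⟩ := hirr y (hHl y hyH) hy0
    let J : AddSubgroup M := H ⊓ I.comap (DistribSMul.toAddMonoidHom M σ)
    have hJ : ∀ z, z ∈ J ↔ z ∈ H ∧ σ • z ∈ I := fun z => Iff.rfl
    have hJfin : (J : Set M).Finite := hfin.subset fun z hz => hz.1
    set D := {f : Fq[X] | f ∈ degreeLT Fq l.natDegree} with hD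
    have hDfin : D.Finite := Set.finite_of_ncard_pos (by
      rw [hD, ncard_degreeLT]; exact pow_pos Fintype.card_pos _)
    have hinj : Set.InjOn (fun p : Fq[X] × M => φ p.1 y + p.2) (D ×ˢ (J : Set M)) := by
      rintro ⟨f, z⟩ ⟨hf, hz⟩ ⟨f', z'⟩ ⟨hf', hz'⟩ heq
      have h1 : φ (f - f') y = z' - z := by
        rw [action_sub, sub_eq_sub_iff_add_eq_add]
        rw [show φ f y + z = φ f' y + z' from heq]; abel
      have hff : f = f' := by
        by_contra hne
        have hnd : ¬ l ∣ f - f' := fun hdvd => by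
          have hlt : (f - f').degree < l.degree := by
            rw [degree_eq_natDegree hl.ne_zero]
            exact mem_degreeLT.1 (Submodule.sub_mem _ hf hf')
          exact (not_le_of_gt hlt) (degree_le_of_dvd hdvd (sub_ne_zero.2 hne))
        refine hσ (eq_zero_of_isCoprime_of_mem hl hnd hI (y := σ • y) ?_ ?_)
        · rw [← hG, hHl y hyH, smul_zero]
        · rw [← hG, h1]
          exact ((hJ _).1 (J.sub_mem hz' hz)).2
      subst hff
      rw [sub_self, action_zero, eq_comm, sub_eq_zero] at h1
      rw [h1]
    have hmaps : (fun p : Fq[X] × M => φ p.1 y + p.2) '' (D ×ˢ (J : Set M)) ⊆ H := by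
      rintro _ ⟨⟨f, z⟩, ⟨-, hz⟩, rfl⟩
      exact H.add_mem (hHφ f y hyH) hz.1
    have h1 := Set.ncard_le_ncard hmaps hfin
    rw [hinj.ncard_image, Set.ncard_prod, hD, ncard_degreeLT] at h1
    have hpos : 0 < Fintype.card Fq ^ l.natDegree := pow_pos Fintype.card_pos _
    have h2 : (J : Set M).ncard ≤ (Fintype.card Fq ^ l.natDegree) ^ n := by
      rw [pow_succ'] at hcard
      exact Nat.le_of_mul_le_mul_left (h1.trans hcard) hpos
    obtain ⟨τ, hτ⟩ := ih J (fun z hz => hHl z hz.1)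
      (fun f z hz => ⟨hHφ f z hz.1, by
        change σ • φ f z ∈ I
        rw [hG]; exact hI f _ hz.2⟩) hJfin h2
    refine ⟨Fin.cons σ τ, fun z hz hzI => hτ z ⟨hz, hzI 0⟩ fun i => by simpa using hzI i.succ⟩

/-- A basis of the `a`-torsion all of whose transvections come from elements of `G` fixing the
`b`-torsion. -/
structure IsTransvectionBasis (G : Type*) [Group G] [DistribMulAction G M]
    (φ : Fq[X] →+* AddMonoid.End M) (a b : Fq[X]) {r : ℕ}
    (x : Fin r → M) : Prop where
  torsion : ∀ i, φ a (x i) = 0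
  span : ∀ y, φ a y = 0 → ∃ f : Fin r → Fq[X], y = ∑ i, φ (f i) (x i)
  indep : ∀ f : Fin r → Fq[X], ∑ i, φ (f i) (x i) = 0 → ∀ i, a ∣ f i
  transvection : ∀ i j, i ≠ j → ∀ f, ∃ σ : G, σ • x i = x i + φ f (x j) ∧
    (∀ k, k ≠ i → σ • x k = x k) ∧ ∀ y, φ b y = 0 → σ • y = y

lemma exists_isTransvectionBasis {l a b : Fq[X]} (hl : Irreducible l) {n : ℕ} (ha : a = l ^ n)
    (hlm : l.Monic)
    {I : AddSubgroup M} (hI : ∀ f, ∀ y ∈ I, φ f y ∈ I)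
    (hG : ∀ (σ : G) f y, σ • φ f y = φ f (σ • y))
    (hirr : ∀ y : M, φ a y = 0 → y ≠ 0 → ∃ σ : G, σ • y ∉ I) {r : ℕ}
    (hn : 1 ≤ n)
    (hlfin : {y | φ l y = 0}.Finite)
    (hlcard : {y | φ l y = 0}.ncard ≤ (Fintype.card Fq ^ l.natDegree) ^ r)
    (hacard : {y | φ a y = 0}.ncard = (Fintype.card Fq ^ a.natDegree) ^ r) {x₀ : M}
    (hx₀ : φ a x₀ = 0)
    (hspan : ∀ y, φ a y = 0 → ∃ f w, φ a w = 0 ∧ w ∈ I ∧ y = φ f x₀ + w)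
    (hdvd : ∀ f, φ f x₀ ∈ I → a ∣ f)
    (htrans : ∀ w, φ a w = 0 → w ∈ I → ∃ σ : G, (∀ y, φ a y = 0 → y ∈ I → σ • y = y) ∧
      σ • x₀ = x₀ + w ∧ ∀ y, φ b y = 0 → σ • y = y) :
    ∃ x : Fin r → M, IsTransvectionBasis G φ a b x := by
  have hla : l ∣ a := ha ▸ dvd_pow_self l (by omega)
  have ham : a.Monic := ha ▸ hlm.pow n
  have hcommφ : ∀ f g y, φ f (φ g y) = φ g (φ f y) := fun f g y => by
    rw [← action_mul, mul_comm, action_mul]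
  obtain ⟨σ, hσ⟩ := exists_separating hl hI hG
    (fun y hy hy0 => hirr y (action_eq_zero_of_dvd hla hy) hy0) r
    (AddMonoidHom.ker (φ l : M →+ M)) (fun y hy => hy)
    (fun f y hy => by
      change φ l (φ f y) = 0
      rw [hcommφ, show φ l y = 0 from hy, map_zero]) hlfin hlcard
  have hσa : ∀ y, φ a y = 0 → (∀ i, σ i • y ∈ I) → y = 0 := by
    intro y hy hyI
    by_contra hy0
    have hex : ∃ k, φ (l ^ k) y = 0 := ⟨n, ha ▸ hy⟩
    classical
    have hk := Nat.find_spec hex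
    set k := Nat.find hex with hkdef
    have hk0 : k ≠ 0 := by
      intro h0
      rw [h0, pow_zero, action_one] at hk
      exact hy0 hk
    have hlt : ¬ φ (l ^ (k - 1)) y = 0 := Nat.find_min hex (by omega)
    refine hlt (hσ _ ?_ fun i => ?_)
    · change φ l (φ (l ^ (k - 1)) y) = 0
      rw [← action_mul, ← pow_succ', Nat.sub_add_cancel (by omega), hk]
    · rw [hG]; exact hI _ _ (hyI i)
  choose! c w hwa hwI hcw using hspan
  have hσtor : ∀ (τ : G) y, φ a y = 0 → φ a (τ • y) = 0 := fun τ y hy => by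
    rw [← hG, hy, smul_zero]
  let E : M → Fin r → Fq[X] ⧸ Ideal.span {a} := fun y i => Ideal.Quotient.mk _ (c (σ i • y))
  have hcI : ∀ y y', φ a y = 0 → φ a y' = 0 → a ∣ c y - c y' → y - y' ∈ I := by
    intro y y' hy hy' hd
    have h1 : y - y' = φ (c y - c y') x₀ + (w y - w y') := by
      rw [action_sub]
      conv_lhs => rw [hcw y hy, hcw y' hy']
      abel
    rw [h1, action_eq_zero_of_dvd hd hx₀, zero_add]
    exact I.sub_mem (hwI y hy) (hwI y' hy')
  have hEinj : Set.InjOn E {y | φ a y = 0} := by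
    intro y hy y' hy' hE
    refine sub_eq_zero.1 (hσa _ ?_ fun i => ?_)
    · rw [map_sub, show φ a y = 0 from hy, show φ a y' = 0 from hy', sub_zero]
    · rw [smul_sub]
      refine hcI _ _ (hσtor _ _ hy) (hσtor _ _ hy') ?_
      exact Ideal.mem_span_singleton.1 (Ideal.Quotient.eq.1 (congrFun hE i))
  have hRcard : Nat.card (Fq[X] ⧸ Ideal.span {a}) = Fintype.card Fq ^ a.natDegree := by
    change Nat.card (AdjoinRoot a) = _
    have hfin : Module.Finite Fq (AdjoinRoot a) := (AdjoinRoot.powerBasis ham.ne_zero).finite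
    rw [Module.natCard_eq_pow_finrank (K := Fq), (AdjoinRoot.powerBasis ham.ne_zero).finrank,
      AdjoinRoot.powerBasis_dim, Nat.card_eq_fintype_card]
  have hRfin : Finite (Fq[X] ⧸ Ideal.span {a}) := Nat.finite_of_card_ne_zero (by
    rw [hRcard]; exact (pow_pos Fintype.card_pos _).ne')
  have hsurj : E '' {y | φ a y = 0} = Set.univ := by
    refine Set.eq_of_subset_of_ncard_le (Set.subset_univ _) ?_
    rw [hEinj.ncard_image, Set.ncard_univ, Nat.card_fun, hacard, hRcard, Nat.card_eq_fintype_card,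
      Fintype.card_fin]
  have hx : ∀ j : Fin r, ∃ x, φ a x = 0 ∧ E x = Pi.single j 1 := fun j => by
    have : (Pi.single j 1 : Fin r → Fq[X] ⧸ Ideal.span {a}) ∈ E '' {y | φ a y = 0} := by
      rw [hsurj]; trivial
    exact this
  choose x hxa hxE using hx
  have hxne : ∀ i j, i ≠ j → σ i • x j ∈ I := by
    intro i j hij
    have h1 : E (x j) i = 0 := by rw [hxE, Pi.single_eq_of_ne hij]
    have h2 : a ∣ c (σ i • x j) := Ideal.mem_span_singleton.1 (Ideal.Quotient.eq_zero_iff_mem.1 h1)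
    rw [hcw _ (hσtor _ _ (hxa j)), action_eq_zero_of_dvd h2 hx₀, zero_add]
    exact hwI _ (hσtor _ _ (hxa j))
  have hxeq : ∀ i, σ i • x i - x₀ ∈ I := by
    intro i
    have h1 : E (x i) i = 1 := by rw [hxE, Pi.single_eq_same]
    have h2 : a ∣ c (σ i • x i) - 1 := by
      rw [← map_one (Ideal.Quotient.mk (Ideal.span {a}))] at h1
      exact Ideal.mem_span_singleton.1 (Ideal.Quotient.eq.1 h1)
    have h3 : σ i • x i - x₀ = φ (c (σ i • x i) - 1) x₀ + w (σ i • x i) := by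
      rw [action_sub, action_one]
      conv_lhs => rw [hcw _ (hσtor _ _ (hxa i))]
      abel
    rw [h3, action_eq_zero_of_dvd h2 hx₀, zero_add]
    exact hwI _ (hσtor _ _ (hxa i))
  have hsum : ∀ (f : Fin r → Fq[X]) i, σ i • (∑ j, φ (f j) (x j)) - φ (f i) x₀ ∈ I := by
    intro f i
    have h1 : σ i • (∑ j, φ (f j) (x j)) - φ (f i) x₀ =
        φ (f i) (σ i • x i - x₀) + ∑ j ∈ Finset.univ.erase i, φ (f j) (σ i • x j) := by
      rw [Finset.smul_sum, ← Finset.add_sum_erase _ _ (Finset.mem_univ i), hG, map_sub]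
      simp only [hG]
      abel
    rw [h1]
    exact I.add_mem (hI _ _ (hxeq i)) (I.sum_mem fun j hj =>
      hI _ _ (hxne i j (Finset.ne_of_mem_erase hj).symm))
  refine ⟨x, hxa, fun y hy => ⟨fun i => c (σ i • y), ?_⟩, fun f hf i => hdvd _ ?_, ?_⟩
  · refine sub_eq_zero.1 (hσa _ ?_ fun i => ?_)
    · rw [map_sub, hy, map_sum, zero_sub, neg_eq_zero]
      exact Finset.sum_eq_zero fun i _ => by rw [hcommφ, hxa, map_zero]
    · have h1 := hsum (fun i => c (σ i • y)) i
      have h2 := hwI _ (hσtor (σ i) y hy)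
      have h3 : σ i • (y - ∑ j, φ (c (σ j • y)) (x j)) = w (σ i • y) -
          (σ i • (∑ j, φ (c (σ j • y)) (x j)) - φ (c (σ i • y)) x₀) := by
        rw [smul_sub]
        conv_lhs => rw [hcw _ (hσtor (σ i) y hy)]
        abel
      rw [h3]
      exact I.sub_mem h2 h1
  · have h1 := hsum f i
    rw [hf, smul_zero, zero_sub] at h1
    exact (I.neg_mem_iff).1 h1
  · intro i j hij f
    obtain ⟨τ, h1, h2, h3⟩ := htrans (φ f (σ i • x j))
      (by rw [hcommφ, hσtor _ _ (hxa j), map_zero]) (hI _ _ (hxne i j hij))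
    refine ⟨(σ i)⁻¹ * τ * σ i, ?_, fun k hk => ?_, fun y hy => ?_⟩
    · have h4 : τ • (σ i • x i - x₀) = σ i • x i - x₀ := by
        refine h1 _ ?_ (hxeq i)
        rw [map_sub, hσtor _ _ (hxa i), hx₀, sub_zero]
      have h5 : τ • σ i • x i = σ i • (x i + φ f (x j)) := by
        rw [smul_sub, h2, sub_eq_sub_iff_add_eq_add] at h4
        rw [smul_add, hG]
        have : τ • σ i • x i + x₀ = (σ i • x i + φ f (σ i • x j)) + x₀ := by rw [h4]; abel
        exact add_right_cancel this
      rw [mul_smul, mul_smul, h5, inv_smul_smul]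
    · rw [mul_smul, mul_smul, h1 _ (hσtor _ _ (hxa k)) (hxne i k hk.symm), inv_smul_smul]
    · rw [mul_smul, mul_smul, h3 _ (by rw [← hG, hy, smul_zero]), inv_smul_smul]

end TransvectionBasis

section Goursat

variable {n R R₁ R₂ G : Type*} [Fintype n] [DecidableEq n] [CommRing R] [CommRing R₁] [CommRing R₂]
  [Group G]

lemma transvection_mul_transvection {i j k : n} (hjk : j ≠ k) (hij : i ≠ j) (c : R) :
    Matrix.transvection i k c * Matrix.transvection k j 1 =
      Matrix.transvection i j c * (Matrix.transvection k j 1 * Matrix.transvection i k c) := by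
  simp only [Matrix.transvection, mul_add, add_mul, mul_one, one_mul,
    Matrix.single_mul_single_same, Matrix.single_mul_single_of_ne _ _ _ _ hjk,
    Matrix.single_mul_single_of_ne _ _ _ _ hij.symm, add_zero]
  abel

/-- A pair of representations whose images contain enough transvections and whose determinants are
independent is jointly surjective. -/
theorem exists_eq_and_eq_of_transvections [IsLocalRing R₁] [IsLocalRing R₂] (hn : 3 ≤ Fintype.card n)
    (m₁ : G →* Matrix n n R₁) (m₂ : G →* Matrix n n R₂)
    (h₁ : ∀ i j, i ≠ j → ∀ c, ∃ σ, m₁ σ = Matrix.transvection i j c ∧ m₂ σ = 1)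
    (h₂ : ∀ i j, i ≠ j → ∀ c, ∃ σ, m₂ σ = Matrix.transvection i j c)
    (h₃ : ∀ d₁ d₂, IsUnit d₁ → IsUnit d₂ → ∃ σ, (m₁ σ).det = d₁ ∧ (m₂ σ).det = d₂)
    {g₁ : Matrix n n R₁} {g₂ : Matrix n n R₂} (hg₁ : IsUnit g₁.det) (hg₂ : IsUnit g₂.det) :
    ∃ σ, m₁ σ = g₁ ∧ m₂ σ = g₂ := by
  have hSL₁ : ∀ M : Matrix n n R₁, M.det = 1 → ∃ σ, m₁ σ = M ∧ m₂ σ = 1 := by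
    intro M hM
    obtain ⟨σ, hσ, rfl⟩ := mem_of_det_eq_one (S := (MonoidHom.mker m₂).map m₁)
      (fun i j hij c => by
        obtain ⟨σ, hσ₁, hσ₂⟩ := h₁ i j hij c
        exact ⟨σ, hσ₂, hσ₁⟩) hM
    exact ⟨σ, rfl, hσ⟩
  have hSL₂ : ∀ M : Matrix n n R₂, M.det = 1 → ∃ σ, (m₁ σ).det = 1 ∧ m₂ σ = M := by
    intro M hM
    obtain ⟨σ, hσ, rfl⟩ := mem_of_det_eq_one
      (S := (MonoidHom.mker (Matrix.detMonoidHom.comp m₁)).map m₂)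
      (fun i j hij c => by
        obtain ⟨k, hk⟩ : ∃ k, k ∉ ({i, j} : Finset n) := by
          by_contra hcon
          push Not at hcon
          have := Finset.card_le_card (Finset.subset_iff.2 fun k (_ : k ∈ Finset.univ) => hcon k)
          have h2 : ({i, j} : Finset n).card ≤ 2 := Finset.card_le_two
          rw [Finset.card_univ] at this
          omega
        simp only [Finset.mem_insert, Finset.mem_singleton, not_or] at hk
        obtain ⟨σ, hσ⟩ := h₂ i k (Ne.symm hk.1) c
        obtain ⟨τ, hτ⟩ := h₂ k j hk.2 1
        refine ⟨σ * τ * (τ * σ)⁻¹, ?_, ?_⟩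
        · change Matrix.detMonoidHom.comp m₁ _ = 1
          rw [map_mul, map_mul, mul_comm (Matrix.detMonoidHom.comp m₁ σ), ← map_mul, ← map_mul,
            mul_inv_cancel, map_one]
        · rw [map_mul, map_mul, hσ, hτ,
            transvection_mul_transvection (Ne.symm hk.2) hij, ← hσ, ← hτ, ← map_mul,
            mul_assoc, ← map_mul, mul_inv_cancel, map_one, mul_one]) hM
    exact ⟨σ, hσ, rfl⟩
  have hinv₁ : ∀ σ, m₁ σ⁻¹ * m₁ σ = 1 := fun σ => by rw [← map_mul, inv_mul_cancel, map_one]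
  have hinv₂ : ∀ σ, m₂ σ⁻¹ * m₂ σ = 1 := fun σ => by rw [← map_mul, inv_mul_cancel, map_one]
  obtain ⟨σ₀, hd₁, hd₂⟩ := h₃ _ _ hg₁ hg₂
  obtain ⟨σ₂, hσ₂, hσ₂'⟩ := hSL₂ (g₂ * m₂ σ₀⁻¹) (by
    rw [Matrix.det_mul, ← hd₂, ← Matrix.det_mul, ← map_mul, mul_inv_cancel, map_one, Matrix.det_one])
  obtain ⟨σ₁, hσ₁, hσ₁'⟩ := hSL₁ (g₁ * m₁ σ₀⁻¹ * m₁ σ₂⁻¹) (by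
    have h4 : (m₁ σ₂⁻¹).det = 1 := by
      have := congrArg Matrix.det (hinv₁ σ₂)
      rwa [Matrix.det_mul, hσ₂, mul_one, Matrix.det_one] at this
    rw [Matrix.det_mul, h4, mul_one, Matrix.det_mul, ← hd₁, ← Matrix.det_mul, ← map_mul,
      mul_inv_cancel, map_one, Matrix.det_one])
  refine ⟨σ₁ * σ₂ * σ₀, ?_, ?_⟩
  · rw [map_mul, map_mul, hσ₁, mul_assoc (g₁ * m₁ σ₀⁻¹), hinv₁, mul_one, mul_assoc, hinv₁, mul_one]
  · rw [map_mul, map_mul, hσ₁', one_mul, hσ₂', mul_assoc, hinv₂, mul_one]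

end Goursat

section MatrixRepresentation

variable {Fq M G : Type*} [Field Fq] [AddCommGroup M] [Group G] [DistribMulAction G M]
  {φ : Fq[X] →+* AddMonoid.End M} {a : Fq[X]} {r : ℕ} {x : Fin r → M}

lemma action_eq_of_dvd_sub {f f' : Fq[X]} (h : a ∣ f - f') {y : M} (hy : φ a y = 0) :
    φ f y = φ f' y := by
  have := action_eq_zero_of_dvd h hy
  rwa [action_sub, sub_eq_zero] at this

lemma mk_matrix_eq_iff (N N' : Matrix (Fin r) (Fin r) Fq[X]) :
    N.map (Ideal.Quotient.mk (Ideal.span {a})) = N'.map (Ideal.Quotient.mk (Ideal.span {a})) ↔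
      ∀ i j, a ∣ N i j - N' i j := by
  simp only [← Matrix.ext_iff, Matrix.map_apply, Ideal.Quotient.eq, Ideal.mem_span_singleton]

/-- The matrix representation attached to a basis of the `a`-torsion. -/
lemma exists_matrixRep (hG : ∀ (σ : G) f y, σ • φ f y = φ f (σ • y)) (hx : ∀ i, φ a (x i) = 0)
    (hspan : ∀ y, φ a y = 0 → ∃ f : Fin r → Fq[X], y = ∑ i, φ (f i) (x i))
    (hindep : ∀ f : Fin r → Fq[X], ∑ i, φ (f i) (x i) = 0 → ∀ i, a ∣ f i) :
    ∃ m : G →* Matrix (Fin r) (Fin r) (Fq[X] ⧸ Ideal.span {a}),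
      ∀ σ (N : Matrix (Fin r) (Fin r) Fq[X]),
        m σ = N.map (Ideal.Quotient.mk (Ideal.span {a})) ↔ ∀ j, σ • x j = ∑ i, φ (N i j) (x i) := by
  have hN : ∀ σ : G, ∃ N : Matrix (Fin r) (Fin r) Fq[X], ∀ j, σ • x j = ∑ i, φ (N i j) (x i) := by
    intro σ
    have h1 : ∀ j, ∃ f : Fin r → Fq[X], σ • x j = ∑ i, φ (f i) (x i) := fun j =>
      hspan _ (by rw [← hG, hx, smul_zero])
    choose f hf using h1
    exact ⟨Matrix.of fun i j => f j i, hf⟩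
  choose N hN using hN
  have key : ∀ σ (N' : Matrix (Fin r) (Fin r) Fq[X]),
      (N σ).map (Ideal.Quotient.mk (Ideal.span {a})) = N'.map (Ideal.Quotient.mk (Ideal.span {a})) ↔
        ∀ j, σ • x j = ∑ i, φ (N' i j) (x i) := by
    intro σ N'
    rw [mk_matrix_eq_iff]
    constructor
    · intro h j
      rw [hN]
      exact Finset.sum_congr rfl fun i _ => action_eq_of_dvd_sub (h i j) (hx i)
    · intro h i j
      refine hindep (fun i => N σ i j - N' i j) ?_ i
      simp only [action_sub]
      rw [Finset.sum_sub_distrib, ← hN, ← h, sub_self]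
  refine ⟨⟨⟨fun σ => (N σ).map (Ideal.Quotient.mk (Ideal.span {a})), ?_⟩, ?_⟩, key⟩
  · have h1 := (key 1 1).2 fun j => by
      rw [one_smul, Finset.sum_eq_single j]
      · rw [Matrix.one_apply_eq, action_one]
      · intro i _ hij
        rw [Matrix.one_apply_ne hij, action_zero]
      · simp
    rw [h1]
    exact Matrix.map_one _ (map_zero _) (map_one _)
  · intro σ τ
    have h1 := (key (σ * τ) (N σ * N τ)).2 fun j => by
      rw [mul_smul, hN τ, Finset.smul_sum]
      simp only [hG, hN σ, Matrix.mul_apply, action_sum]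
      simp only [map_sum]
      rw [Finset.sum_comm]
      refine Finset.sum_congr rfl fun i _ => Finset.sum_congr rfl fun k _ => ?_
      rw [← action_mul, mul_comm]
    change (N (σ * τ)).map _ = (N σ).map _ * (N τ).map _
    rw [h1, Matrix.map_mul]

lemma isLocalRing_quotient_pow {l : Fq[X]} (hl : Irreducible l) {n : ℕ} (hn : 1 ≤ n) :
    IsLocalRing (Fq[X] ⧸ Ideal.span {l ^ n}) := by
  have hunit : ∀ f, ¬ l ∣ f → IsUnit (Ideal.Quotient.mk (Ideal.span {l ^ n}) f) := by
    intro f hf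
    obtain ⟨u, v, huv⟩ := (hl.coprime_iff_not_dvd.2 hf).pow_left (m := n)
    refine .of_mul_eq_one (Ideal.Quotient.mk _ v) ?_
    rw [← map_mul, ← map_one (Ideal.Quotient.mk _), Ideal.Quotient.eq, Ideal.mem_span_singleton]
    exact ⟨-u, by linear_combination huv⟩
  have : Nontrivial (Fq[X] ⧸ Ideal.span {l ^ n}) := by
    rw [Ideal.Quotient.nontrivial_iff, Ne, Ideal.span_singleton_eq_top]
    exact fun h => hl.not_isUnit ((isUnit_pow_iff (by omega)).1 h)
  refine .of_isUnit_or_isUnit_one_sub_self fun f => ?_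
  obtain ⟨f, rfl⟩ := Ideal.Quotient.mk_surjective f
  by_cases hf : l ∣ f
  · refine .inr ?_
    rw [← map_one (Ideal.Quotient.mk _), ← map_sub]
    refine hunit _ fun h => hl.not_isUnit (isUnit_of_dvd_one ?_)
    simpa using dvd_add h hf
  · exact .inl (hunit f hf)

lemma isUnit_mk_iff {f : Fq[X]} : IsUnit (Ideal.Quotient.mk (Ideal.span {a}) f) ↔ IsCoprime f a := by
  constructor
  · intro h
    obtain ⟨g, hg⟩ := h.exists_right_inv
    obtain ⟨g, rfl⟩ := Ideal.Quotient.mk_surjective g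
    rw [← map_mul, ← map_one (Ideal.Quotient.mk _), Ideal.Quotient.eq, Ideal.mem_span_singleton] at hg
    obtain ⟨c, hc⟩ := hg
    exact ⟨g, -c, by linear_combination hc⟩
  · rintro ⟨u, v, huv⟩
    refine .of_mul_eq_one (Ideal.Quotient.mk _ u) ?_
    rw [← map_mul, ← map_one (Ideal.Quotient.mk _), Ideal.Quotient.eq, Ideal.mem_span_singleton]
    exact ⟨-v, by linear_combination huv⟩

lemma matrixRep_eq_transvection {m : G →* Matrix (Fin r) (Fin r) (Fq[X] ⧸ Ideal.span {a})}
    (hm : ∀ σ (N : Matrix (Fin r) (Fin r) Fq[X]),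
        m σ = N.map (Ideal.Quotient.mk (Ideal.span {a})) ↔ ∀ j, σ • x j = ∑ i, φ (N i j) (x i))
    {σ : G} {i j : Fin r} {f : Fq[X]} (hσ : σ • x i = x i + φ f (x j))
    (hk : ∀ k, k ≠ i → σ • x k = x k) :
    m σ = Matrix.transvection j i (Ideal.Quotient.mk _ f) := by
  have h1 : m σ = (Matrix.transvection j i f).map (Ideal.Quotient.mk (Ideal.span {a})) := by
    refine (hm σ _).2 fun k => ?_
    simp only [Matrix.transvection, Matrix.add_apply, action_add, Finset.sum_add_distrib]
    have h2 : ∑ k', φ ((1 : Matrix (Fin r) (Fin r) Fq[X]) k' k) (x k') = x k := by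
      rw [Finset.sum_eq_single k]
      · rw [Matrix.one_apply_eq, action_one]
      · intro k' _ hk'
        rw [Matrix.one_apply_ne hk', action_zero]
      · simp
    rw [h2, Finset.sum_eq_single j]
    · rcases eq_or_ne k i with rfl | hki
      · rw [Matrix.single_apply_same, hσ]
      · rw [Matrix.single_apply_of_ne _ _ _ _ _ (by tauto), action_zero, add_zero, hk k hki]
    · intro k' _ hk'
      rw [Matrix.single_apply_of_ne _ _ _ _ _ (by tauto), action_zero]
    · simp
  rw [h1, Matrix.transvection, Matrix.transvection, Matrix.map_add _ (map_add _),
    Matrix.map_one _ (map_zero _) (map_one _)]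
  congr 1
  exact Matrix.map_single j i f _

end MatrixRepresentation

section Surjectivity

variable {Fq F K : Type*} [Field Fq] [Fintype Fq] [Field F] [Field K] [Algebra Fq K]
  [Algebra Fq[X] F] [IsFractionRing Fq[X] F] [Algebra Fq[X] K] [Algebra F K]
  [IsScalarTower Fq Fq[X] K] [IsScalarTower Fq[X] F K] [Normal F K] {q s : ℕ}
  {φ : Fq[X] →+* AddMonoid.End K}

omit [IsFractionRing Fq[X] F] [Normal F K] in
variable (F) in
lemma IsDrinfeldAction.smul_action (h : IsDrinfeldAction q s (algebraMap Fq[X] K X) φ)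
    (σ : K ≃ₐ[F] K) (f : Fq[X]) (y : K) : σ • φ f y = φ f (σ • y) := by
  have hσX : σ (algebraMap Fq[X] K X) = algebraMap Fq[X] K X := by
    rw [IsScalarTower.algebraMap_apply Fq[X] F K, σ.commutes]
  have hσC : ∀ c, σ (algebraMap Fq K c) = algebraMap Fq K c := fun c => by
    rw [IsScalarTower.algebraMap_apply Fq Fq[X] K, IsScalarTower.algebraMap_apply Fq[X] F K,
      σ.commutes]
  exact ringHom_apply_action φ h.apply_C h.apply_X_eq_eval (σ : K →+* K) hσC
    (by rw [drinfeldPoly_map]; exact congrArg _ hσX) f y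

theorem IsDrinfeldAction.exists_algEquiv_matrix
    (h : IsDrinfeldAction q s (algebraMap Fq[X] K X) φ) (hs : Even s) {l₁ l₂ : Fq[X]}
    (hl₁ : Irreducible l₁) (hl₂ : Irreducible l₂) (hm₁ : l₁.Monic) (hm₂ : l₂.Monic)
    {n₁ n₂ : ℕ} (hn₁ : 1 ≤ n₁) (hn₂ : 1 ≤ n₂) (hc : IsCoprime (l₁ ^ n₁) (l₂ ^ n₂))
    {x₁ x₂ : Fin (s + 1) → K} (hx₁ : IsTransvectionBasis (K ≃ₐ[F] K) φ (l₁ ^ n₁) (l₂ ^ n₂) x₁)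
    (hx₂ : IsTransvectionBasis (K ≃ₐ[F] K) φ (l₂ ^ n₂) 1 x₂)
    {N₁ N₂ : Matrix (Fin (s + 1)) (Fin (s + 1)) Fq[X]}
    (hN₁ : IsCoprime N₁.det (l₁ ^ n₁)) (hN₂ : IsCoprime N₂.det (l₂ ^ n₂)) :
    ∃ σ : K ≃ₐ[F] K, (∀ j, σ (x₁ j) = ∑ i, φ (N₁ i j) (x₁ i)) ∧
      ∀ j, σ (x₂ j) = ∑ i, φ (N₂ i j) (x₂ i) := by
  have hG := h.smul_action F
  have hdeg : ∀ {l : Fq[X]} {n : ℕ}, l.Monic → Irreducible l → 1 ≤ n → 0 < (l ^ n).natDegree := by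
    intro l n hm hl hn
    rw [hm.natDegree_pow]
    exact Nat.mul_pos (by omega) hl.natDegree_pos
  have := isLocalRing_quotient_pow hl₁ hn₁
  have := isLocalRing_quotient_pow hl₂ hn₂
  obtain ⟨m₁, hr₁⟩ := exists_matrixRep hG hx₁.torsion hx₁.span hx₁.indep
  obtain ⟨m₂, hr₂⟩ := exists_matrixRep hG hx₂.torsion hx₂.span hx₂.indep
  have hdet : ∀ {l : Fq[X]} (N : Matrix (Fin (s + 1)) (Fin (s + 1)) Fq[X]),
      (N.map (Ideal.Quotient.mk (Ideal.span {l}))).det = Ideal.Quotient.mk _ N.det := fun N =>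
    ((Ideal.Quotient.mk _).map_det N).symm
  have hsurj : ∀ {l : Fq[X]} (M : Matrix (Fin (s + 1)) (Fin (s + 1)) (Fq[X] ⧸ Ideal.span {l})),
      ∃ N : Matrix (Fin (s + 1)) (Fin (s + 1)) Fq[X], M = N.map (Ideal.Quotient.mk _) := by
    intro l M
    choose N hN using fun i j => Ideal.Quotient.mk_surjective (M i j)
    exact ⟨Matrix.of N, by ext i j; exact (hN i j).symm⟩
  suffices H : ∃ σ, m₁ σ = N₁.map (Ideal.Quotient.mk (Ideal.span {l₁ ^ n₁})) ∧
      m₂ σ = N₂.map (Ideal.Quotient.mk (Ideal.span {l₂ ^ n₂})) by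
    obtain ⟨σ, hσ₁, hσ₂⟩ := H
    exact ⟨σ, (hr₁ _ _).1 hσ₁, (hr₂ _ _).1 hσ₂⟩
  have hcard : 3 ≤ Fintype.card (Fin (s + 1)) := by
    have := h.pos
    obtain ⟨k, hk⟩ := hs
    rw [Fintype.card_fin]
    omega
  refine exists_eq_and_eq_of_transvections hcard m₁ m₂ ?_ ?_ ?_
    (by rw [hdet]; exact isUnit_mk_iff.2 hN₁) (by rw [hdet]; exact isUnit_mk_iff.2 hN₂)
  · intro i j hij c
    obtain ⟨f, rfl⟩ := Ideal.Quotient.mk_surjective c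
    obtain ⟨σ, h1, h2, h3⟩ := hx₁.transvection j i hij.symm f
    refine ⟨σ, matrixRep_eq_transvection hr₁ h1 h2, ?_⟩
    have h4 : m₂ 1 = (1 : Matrix (Fin (s + 1)) (Fin (s + 1)) Fq[X]).map
        (Ideal.Quotient.mk (Ideal.span {l₂ ^ n₂})) := by
      rw [map_one, Matrix.map_one _ (map_zero _) (map_one _)]
    rw [← map_one m₂, h4]
    refine (hr₂ _ _).2 fun k => ?_
    rw [h3 _ (hx₂.torsion k), ← (hr₂ _ _).1 h4, one_smul]
  · intro i j hij c
    obtain ⟨f, rfl⟩ := Ideal.Quotient.mk_surjective c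
    obtain ⟨σ, h1, h2, -⟩ := hx₂.transvection j i hij.symm f
    exact ⟨σ, matrixRep_eq_transvection hr₂ h1 h2⟩
  · intro d₁ d₂ hd₁ hd₂
    obtain ⟨d₁, rfl⟩ := Ideal.Quotient.mk_surjective d₁
    obtain ⟨d₂, rfl⟩ := Ideal.Quotient.mk_surjective d₂
    obtain ⟨σ, h1, h2⟩ := h.exists_dvd_det_sub F hs (hm₁.pow n₁) (hm₂.pow n₂) (hdeg hm₁ hl₁ hn₁)
      (hdeg hm₂ hl₂ hn₂) hc hx₁.torsion hx₂.torsion hx₁.indep hx₂.indep (isUnit_mk_iff.1 hd₁)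
      (isUnit_mk_iff.1 hd₂)
    obtain ⟨M₁, hM₁⟩ := hsurj (m₁ σ)
    obtain ⟨M₂, hM₂⟩ := hsurj (m₂ σ)
    refine ⟨σ, ?_, ?_⟩
    · rw [hM₁, hdet, Ideal.Quotient.eq, Ideal.mem_span_singleton, ← Matrix.det_transpose]
      exact h1 _ ((hr₁ _ _).1 hM₁)
    · rw [hM₂, hdet, Ideal.Quotient.eq, Ideal.mem_span_singleton, ← Matrix.det_transpose]
      exact h2 _ ((hr₂ _ _).1 hM₂)

end Surjectivity

section ExistsBasis

variable {Fq F K : Type*} [Field Fq] [Fintype Fq] [Field F] [Field K] [Algebra Fq K]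
  [Algebra Fq[X] F] [IsFractionRing Fq[X] F] [Algebra Fq[X] K] [Algebra F K]
  [IsScalarTower Fq Fq[X] K] [IsScalarTower Fq[X] F K] [Normal F K] [IsAlgClosed K] {q s : ℕ}
  {φ : Fq[X] →+* AddMonoid.End K}

lemma IsDrinfeldAction.exists_isTransvectionBasis
    (h : IsDrinfeldAction q s (algebraMap Fq[X] K X) φ)
    (hT : Transcendental Fq (algebraMap Fq[X] K X)) {v w : AbsoluteValue K ℝ}
    (hv : IsPlaceAtZero (algebraMap Fq[X] K X) v) (hwna : ∀ x y, w (x + y) ≤ max (w x) (w y))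
    (hw : 1 < w (algebraMap Fq[X] K X)) {Γ : Subgroup (K ≃ₐ[F] K)} {l b : Fq[X]}
    (hl : Irreducible l) (hlm : l.Monic) {n : ℕ} (hn : 1 ≤ n)
    (htr : HasTranslations Γ φ v (l ^ n) b) :
    ∃ x : Fin (s + 1) → K, IsTransvectionBasis (K ≃ₐ[F] K) φ (l ^ n) b x := by
  let I : AddSubgroup K :=
    { carrier := {y | v y ≤ 1}
      add_mem' := fun {y z} hy hz => (hv.na y z).trans (max_le hy hz)
      zero_mem' := by simp
      neg_mem' := fun {y} hy => by simpa using hy }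
  have hcard : ∀ a : Fq[X], a ≠ 0 →
      {y | φ a y = 0}.Finite ∧ {y | φ a y = 0}.ncard = (Fintype.card Fq ^ a.natDegree) ^ (s + 1) := by
    intro a ha
    obtain ⟨h1, h2⟩ := h.ncard_torsion hT ha
    refine ⟨h1, ?_⟩
    rw [h2, h.card, ← pow_succ, ← pow_mul, ← pow_mul, mul_comm]
  obtain ⟨x₀, h1, h2, h3, h4⟩ := htr
  refine _root_.exists_isTransvectionBasis hl rfl hlm (I := I)
    (fun f y hy => h.abv_apply_le_one hv f hy) (h.smul_action F) (fun y hy hy0 => ?_) hn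
    (hcard l hlm.ne_zero).1 (hcard l hlm.ne_zero).2.le (hcard _ (hlm.pow n).ne_zero).2 h1 h2 h3
    fun w hw hwI => ?_
  · obtain ⟨σ, hσ⟩ := h.exists_one_lt_abv (F := F) hv hwna hw (hlm.pow n) hy hy0
    exact ⟨σ, not_le_of_gt hσ⟩
  · obtain ⟨σ, hσ⟩ := h4 w hw hwI
    exact ⟨σ, hσ⟩

end ExistsBasis

section TorsionAut

variable {Fq M : Type*} [Field Fq] [AddCommGroup M] {φ : Fq[X] →+* AddMonoid.End M} {a b : Fq[X]}
  {r : ℕ} {g : M → M}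

lemma map_sum_of_additive {p : Fq[X]}
    (hadd : ∀ y, φ p y = 0 → ∀ z, φ p z = 0 → g (y + z) = g y + g z) {ι : Type*} (u : Finset ι)
    {y : ι → M} (hy : ∀ i, φ p (y i) = 0) : g (∑ i ∈ u, y i) = ∑ i ∈ u, g (y i) := by
  classical
  have h0 : g 0 = 0 := by
    have := hadd 0 (map_zero _) 0 (map_zero _)
    rwa [add_zero, left_eq_add] at this
  induction u using Finset.induction_on with
  | empty => simpa using h0
  | insert i u hi ih =>
    rw [Finset.sum_insert hi, Finset.sum_insert hi, hadd _ (hy i) _ ?_, ih]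
    rw [map_sum]
    exact Finset.sum_eq_zero fun i _ => hy i

lemma map_combination {p : Fq[X]}
    (hadd : ∀ y, φ p y = 0 → ∀ z, φ p z = 0 → g (y + z) = g y + g z)
    (hφ : ∀ f y, φ p y = 0 → g (φ f y) = φ f (g y)) {ι : Type*} (u : Finset ι) (f : ι → Fq[X])
    {y : ι → M} (hy : ∀ i, φ p (y i) = 0) :
    g (∑ i ∈ u, φ (f i) (y i)) = ∑ i ∈ u, φ (f i) (g (y i)) := by
  rw [map_sum_of_additive (p := p) hadd]
  · exact Finset.sum_congr rfl fun i _ => hφ _ _ (hy i)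
  · intro i
    rw [← action_mul, mul_comm, action_mul, hy, map_zero]

lemma exists_matrix_of_bijOn {x : Fin r → M} (hx : ∀ i, φ a (x i) = 0)
    (hspan : ∀ y, φ a y = 0 → ∃ f : Fin r → Fq[X], y = ∑ i, φ (f i) (x i))
    (hindep : ∀ f : Fin r → Fq[X], ∑ i, φ (f i) (x i) = 0 → ∀ i, a ∣ f i) {p : Fq[X]} (hap : a ∣ p)
    (hg : Set.BijOn g {y | φ p y = 0} {y | φ p y = 0})
    (hadd : ∀ y, φ p y = 0 → ∀ z, φ p z = 0 → g (y + z) = g y + g z)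
    (hφ : ∀ f y, φ p y = 0 → g (φ f y) = φ f (g y)) :
    ∃ N : Matrix (Fin r) (Fin r) Fq[X], (∀ j, g (x j) = ∑ i, φ (N i j) (x i)) ∧
      IsCoprime N.det a := by
  have h0 : g 0 = 0 := by
    have := hadd 0 (map_zero _) 0 (map_zero _)
    rwa [add_zero, left_eq_add] at this
  have hp : ∀ {y}, φ a y = 0 → φ p y = 0 := fun hy => action_eq_zero_of_dvd hap hy
  have hN : ∀ j, ∃ f : Fin r → Fq[X], g (x j) = ∑ i, φ (f i) (x i) := fun j =>
    hspan _ (by rw [← hφ _ _ (hp (hx j)), hx, h0])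
  choose N hN using hN
  have hB : ∀ k, ∃ f : Fin r → Fq[X], g (∑ j, φ (f j) (x j)) = x k := by
    intro k
    obtain ⟨y, hy, hyk⟩ := hg.surjOn (hp (hx k))
    obtain ⟨f, rfl⟩ := hspan y (by
      refine hg.injOn ?_ (map_zero (φ p)) ?_
      · change φ p (φ a y) = 0
        rw [← action_mul, mul_comm, action_mul, show φ p y = 0 from hy, map_zero]
      · rw [hφ _ _ hy, hyk, hx, h0])
    exact ⟨f, hyk⟩
  choose B hB using hB
  refine ⟨Matrix.of fun i j => N j i, hN, ?_⟩
  have hNB : (Matrix.of (fun i j => N j i) * Matrix.of (fun j k => B k j)).map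
      (Ideal.Quotient.mk (Ideal.span {a})) =
        (1 : Matrix (Fin r) (Fin r) Fq[X]).map (Ideal.Quotient.mk (Ideal.span {a})) := by
    rw [mk_matrix_eq_iff]
    intro i k
    refine hindep (fun i => (Matrix.of (fun i j => N j i) * Matrix.of (fun j k => B k j)) i k -
      (1 : Matrix (Fin r) (Fin r) Fq[X]) i k) ?_ i
    simp only [action_sub]
    rw [Finset.sum_sub_distrib, sub_eq_zero]
    have h1 : ∑ i, φ ((1 : Matrix (Fin r) (Fin r) Fq[X]) i k) (x i) = x k := by
      rw [Finset.sum_eq_single k]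
      · rw [Matrix.one_apply_eq, action_one]
      · intro k' _ hk'
        rw [Matrix.one_apply_ne hk', action_zero]
      · simp
    rw [h1]
    conv_rhs => rw [← hB k, map_combination hadd hφ _ _ fun i => hp (hx i)]
    simp only [Matrix.mul_apply, action_sum, hN]
    simp only [map_sum]
    rw [Finset.sum_comm]
    refine Finset.sum_congr rfl fun i _ => Finset.sum_congr rfl fun k _ => ?_
    rw [← action_mul, mul_comm]; rfl
  have hdet := congrArg Matrix.det hNB
  rw [Matrix.map_mul, Matrix.det_mul, Matrix.map_one _ (map_zero _) (map_one _),
    Matrix.det_one] at hdet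
  refine isUnit_mk_iff.1 ?_
  rw [RingHom.map_det]
  exact .of_mul_eq_one _ hdet

end TorsionAut

section Extend

variable {Fq F K : Type*} [Field Fq] [Fintype Fq] [Field F] [Field K] [Algebra Fq K]
  [Algebra Fq[X] F] [IsFractionRing Fq[X] F] [Algebra Fq[X] K] [Algebra F K]
  [IsScalarTower Fq Fq[X] K] [IsScalarTower Fq[X] F K] [Normal F K] {q s : ℕ}
  {φ : Fq[X] →+* AddMonoid.End K}

lemma IsDrinfeldAction.exists_algEquiv_eq
    (h : IsDrinfeldAction q s (algebraMap Fq[X] K X) φ) (hs : Even s) {l₁ l₂ : Fq[X]}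
    (hl₁ : Irreducible l₁) (hl₂ : Irreducible l₂) (hm₁ : l₁.Monic) (hm₂ : l₂.Monic)
    {n₁ n₂ : ℕ} (hn₁ : 1 ≤ n₁) (hn₂ : 1 ≤ n₂) (hc : IsCoprime (l₁ ^ n₁) (l₂ ^ n₂))
    {x₁ x₂ : Fin (s + 1) → K} (hx₁ : IsTransvectionBasis (K ≃ₐ[F] K) φ (l₁ ^ n₁) (l₂ ^ n₂) x₁)
    (hx₂ : IsTransvectionBasis (K ≃ₐ[F] K) φ (l₂ ^ n₂) 1 x₂) {g : K → K}
    (hg : Set.BijOn g {y | φ (l₁ ^ n₁ * l₂ ^ n₂) y = 0} {y | φ (l₁ ^ n₁ * l₂ ^ n₂) y = 0})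
    (hadd : ∀ y, φ (l₁ ^ n₁ * l₂ ^ n₂) y = 0 → ∀ z, φ (l₁ ^ n₁ * l₂ ^ n₂) z = 0 →
      g (y + z) = g y + g z)
    (hφ : ∀ f y, φ (l₁ ^ n₁ * l₂ ^ n₂) y = 0 → g (φ f y) = φ f (g y)) :
    ∃ σ : K ≃ₐ[F] K, ∀ y, φ (l₁ ^ n₁ * l₂ ^ n₂) y = 0 → σ y = g y := by
  have hd₁ : l₁ ^ n₁ ∣ l₁ ^ n₁ * l₂ ^ n₂ := dvd_mul_right _ _
  have hd₂ : l₂ ^ n₂ ∣ l₁ ^ n₁ * l₂ ^ n₂ := dvd_mul_left _ _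
  obtain ⟨N₁, hgN₁, hN₁⟩ :=
    exists_matrix_of_bijOn hx₁.torsion hx₁.span hx₁.indep hd₁ hg hadd hφ
  obtain ⟨N₂, hgN₂, hN₂⟩ :=
    exists_matrix_of_bijOn hx₂.torsion hx₂.span hx₂.indep hd₂ hg hadd hφ
  obtain ⟨σ, hσ₁, hσ₂⟩ := h.exists_algEquiv_matrix hs hl₁ hl₂ hm₁ hm₂ hn₁ hn₂ hc hx₁ hx₂ hN₁ hN₂
  have hagree : ∀ {a : Fq[X]} {x : Fin (s + 1) → K}, a ∣ l₁ ^ n₁ * l₂ ^ n₂ →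
      (∀ i, φ a (x i) = 0) → (∀ i, σ (x i) = g (x i)) →
      ∀ f : Fin (s + 1) → Fq[X], σ (∑ i, φ (f i) (x i)) = g (∑ i, φ (f i) (x i)) := by
    intro a x ha hx hxg f
    rw [map_combination hadd hφ _ _ fun i => action_eq_zero_of_dvd ha (hx i), map_sum]
    refine Finset.sum_congr rfl fun i _ => ?_
    rw [← hxg]
    exact h.smul_action F σ (f i) (x i)
  have h₁ : ∀ y, φ (l₁ ^ n₁) y = 0 → σ y = g y := by
    intro y hy
    obtain ⟨f, rfl⟩ := hx₁.span y hy
    exact hagree hd₁ hx₁.torsion (fun i => (hσ₁ i).trans (hgN₁ i).symm) f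
  have h₂ : ∀ y, φ (l₂ ^ n₂) y = 0 → σ y = g y := by
    intro y hy
    obtain ⟨f, rfl⟩ := hx₂.span y hy
    exact hagree hd₂ hx₂.torsion (fun i => (hσ₂ i).trans (hgN₂ i).symm) f
  refine ⟨σ, fun y hy => ?_⟩
  obtain ⟨u, w, huw⟩ := hc
  have hy₁ : φ (l₁ ^ n₁) (φ (w * l₂ ^ n₂) y) = 0 := by
    rw [← action_mul]
    exact action_eq_zero_of_dvd ⟨w, by ring⟩ hy
  have hy₂ : φ (l₂ ^ n₂) (φ (u * l₁ ^ n₁) y) = 0 := by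
    rw [← action_mul]
    exact action_eq_zero_of_dvd ⟨u, by ring⟩ hy
  have hsum : y = φ (u * l₁ ^ n₁) y + φ (w * l₂ ^ n₂) y := by
    rw [← action_add, huw, action_one]
  rw [hsum, map_add, hadd _ (action_eq_zero_of_dvd hd₂ hy₂) _ (action_eq_zero_of_dvd hd₁ hy₁),
    h₁ _ hy₁, h₂ _ hy₂]

end Extend

section RationalFunctionField

variable {Fq : Type} [Field Fq]

lemma eq_X_of_coeff_zero_eq_zero {l : Fq[X]} (hl : Irreducible l) (hm : l.Monic)
    (h0 : l.coeff 0 = 0) : l = X := by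
  have hd : X ∣ l := X_dvd_iff.2 h0
  exact (eq_of_monic_of_associated monic_X hm (irreducible_X.associated_of_dvd hl hd)).symm

theorem IsDrinfeldAction.exists_algEquiv_eq_of_coeff_zero_ne_zero [Fintype Fq] {q s : ℕ}
    {φ : Fq[X] →+* AddMonoid.End (AlgebraicClosure (RatFunc Fq))}
    (h : IsDrinfeldAction q s
      (algebraMap (RatFunc Fq) (AlgebraicClosure (RatFunc Fq)) RatFunc.X) φ)
    (hs : Even s) {l₁ l₂ : Fq[X]}
    (hl₁ : Irreducible l₁) (hl₂ : Irreducible l₂) (hm₁ : l₁.Monic) (hm₂ : l₂.Monic)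
    {n₁ n₂ : ℕ} (hn₁ : 1 ≤ n₁) (hn₂ : 1 ≤ n₂) (hc : IsCoprime (l₁ ^ n₁) (l₂ ^ n₂))
    (h0 : l₂.coeff 0 ≠ 0) {g : AlgebraicClosure (RatFunc Fq) → AlgebraicClosure (RatFunc Fq)}
    (hg : Set.BijOn g {y | φ (l₁ ^ n₁ * l₂ ^ n₂) y = 0} {y | φ (l₁ ^ n₁ * l₂ ^ n₂) y = 0})
    (hadd : ∀ y, φ (l₁ ^ n₁ * l₂ ^ n₂) y = 0 → ∀ z, φ (l₁ ^ n₁ * l₂ ^ n₂) z = 0 →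
      g (y + z) = g y + g z)
    (hφ : ∀ f y, φ (l₁ ^ n₁ * l₂ ^ n₂) y = 0 → g (φ f y) = φ f (g y)) :
    ∃ σ : AlgebraicClosure (RatFunc Fq) ≃ₐ[RatFunc Fq] AlgebraicClosure (RatFunc Fq),
      ∀ y, φ (l₁ ^ n₁ * l₂ ^ n₂) y = 0 → σ y = g y := by
  have hT := transcendental_X (Fq := Fq)
  obtain ⟨Γ, v, hv, hΓ⟩ := exists_inertia h
  obtain ⟨w, hwna, hw⟩ := exists_abv_pole hT hv
  have hne : ∀ {l : Fq[X]} {n : ℕ}, Irreducible l → 1 ≤ n → l ^ n ≠ 1 := fun hl hn h1 =>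
    hl.not_isUnit (IsUnit.of_pow_eq_one h1 (by omega))
  have hcoeff : ∀ {l : Fq[X]} (n : ℕ), l.coeff 0 ≠ 0 → (l ^ n).coeff 0 ≠ 0 := fun n h1 => by
    rw [coeff_zero_eq_eval_zero, eval_pow, ← coeff_zero_eq_eval_zero]
    exact pow_ne_zero n h1
  have ht₁ : HasTranslations Γ φ v (l₁ ^ n₁) (l₂ ^ n₂) := by
    by_cases h1 : l₁.coeff 0 = 0
    · obtain rfl := eq_X_of_coeff_zero_eq_zero hl₁ hm₁ h1
      exact h.hasTranslations_X_pow hT hΓ hv hn₁ (hm₂.pow n₂) hc (hcoeff n₂ h0)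
    · exact h.hasTranslations_of_coeff_zero_ne_zero hT hΓ hv (hm₁.pow n₁) (hm₂.pow n₂)
        (hne hl₁ hn₁) hc (hcoeff n₁ h1) (hcoeff n₂ h0)
  have ht₂ : HasTranslations Γ φ v (l₂ ^ n₂) 1 :=
    h.hasTranslations_of_coeff_zero_ne_zero hT hΓ hv (hm₂.pow n₂) monic_one
      (hne hl₂ hn₂) isCoprime_one_right (hcoeff n₂ h0) (by simp)
  have hX : algebraMap (RatFunc Fq) (AlgebraicClosure (RatFunc Fq)) RatFunc.X =
      algebraMap Fq[X] (AlgebraicClosure (RatFunc Fq)) X := by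
    rw [IsScalarTower.algebraMap_apply Fq[X] (RatFunc Fq), RatFunc.algebraMap_X]
  rw [hX] at h hT hv hw
  obtain ⟨x₁, hx₁⟩ := h.exists_isTransvectionBasis hT hv hwna hw hl₁ hm₁ hn₁ ht₁
  obtain ⟨x₂, hx₂⟩ := h.exists_isTransvectionBasis hT hv hwna hw hl₂ hm₂ hn₂ ht₂
  exact h.exists_algEquiv_eq hs hl₁ hl₂ hm₁ hm₂ hn₁ hn₂ hc hx₁ hx₂ hg hadd hφ

end RationalFunctionField

/-- There is `c = c(r)` such that for `p > c` and `q ≡ 1 (mod r)`: for any two distinct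
nonzero primes `𝔩₁ = (l₁) ≠ 𝔩₂ = (l₂)` of `A` and any `n₁, n₂ ≥ 1`, every
`A/(𝔩₁^{n₁}𝔩₂^{n₂})`-module automorphism of `φ[𝔩₁^{n₁}𝔩₂^{n₂}]` is the restriction of
some `σ ∈ Gal(F̄/F)`. -/
theorem mod_l1n1_l2n2_galois_representation_surjective (r : ℕ) (hr : r.Prime) (hr3 : 3 ≤ r) :
    ∃ c : ℕ, ∀ (p e q : ℕ), p.Prime → 5 ≤ p → c < p → 0 < e → q = p ^ e → q % r = 1 →
    ∀ (Fq : Type) [Field Fq] [Fintype Fq], Fintype.card Fq = q →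
    ∀ φ : Polynomial Fq →+* AddMonoid.End (Kbar Fq), IsDrinfeldPhi Fq q r φ →
    ∀ l₁ l₂ : Polynomial Fq, l₁.Monic → Irreducible l₁ → l₂.Monic → Irreducible l₂ →
    l₁ ≠ l₂ →
    ∀ n₁ n₂ : ℕ, 1 ≤ n₁ → 1 ≤ n₂ →
    ∀ g : Kbar Fq → Kbar Fq, IsTorsionAut Fq φ (l₁ ^ n₁ * l₂ ^ n₂) g →
    ∃ σ : Kbar Fq ≃ₐ[RatFunc Fq] Kbar Fq,
      ∀ x ∈ phiTorsion Fq φ (l₁ ^ n₁ * l₂ ^ n₂), σ x = g x := by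
  refine ⟨0, ?_⟩
  intro p e q hp hp5 _ he hq _ Fq _ _ hcard φ hDr l₁ l₂ hm₁ hl₁ hm₂ hl₂ hne n₁ n₂ hn₁ hn₂ g hg
  have hs : Even (r - 1) := Nat.Odd.sub_odd (hr.odd_of_ne_two (by omega)) odd_one
  have hrs : r = r - 1 + 1 := by omega
  have h : IsDrinfeldAction q (r - 1) (algebraMap (RatFunc Fq) (Kbar Fq) RatFunc.X) φ :=
    { card := hcard
      three_le := by
        rw [hq]
        exact (by omega : 3 ≤ p).trans (Nat.le_self_pow he.ne' p)
      pos := by omega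
      apply_C := fun c x => by
        rw [hDr.1, IsScalarTower.algebraMap_apply Fq (RatFunc Fq) (Kbar Fq),
          RatFunc.algebraMap_eq_C]
      apply_X := fun x => by rw [hDr.2, ← pow_succ, ← hrs] }
  have hndvd : ¬ l₁ ∣ l₂ := fun hd =>
    hne (eq_of_monic_of_associated hm₁ hm₂ (hl₁.associated_of_dvd hl₂ hd))
  have hc : IsCoprime (l₁ ^ n₁) (l₂ ^ n₂) := (hl₁.coprime_iff_not_dvd.2 hndvd).pow
  by_cases h0 : l₂.coeff 0 = 0
  · have h1 : l₁.coeff 0 ≠ 0 := fun h1 => hne <|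
      (eq_X_of_coeff_zero_eq_zero hl₁ hm₁ h1).trans (eq_X_of_coeff_zero_eq_zero hl₂ hm₂ h0).symm
    rw [mul_comm] at hg ⊢
    exact h.exists_algEquiv_eq_of_coeff_zero_ne_zero hs hl₂ hl₁ hm₂ hm₁ hn₂ hn₁ hc.symm h1
      hg.1 hg.2.1 hg.2.2
  · exact h.exists_algEquiv_eq_of_coeff_zero_ne_zero hs hl₁ hl₂ hm₁ hm₂ hn₁ hn₂ hc h0
      hg.1 hg.2.1 hg.2.2
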